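/- arXiv:0712.3238 — 2 statements merged into one kernel-verified Lean document; each statement's English description precedes it below -/
import Mathlib

section
/- Fix a real number κ and a real x₀ > 0, and suppose F : ℂ → ℂ is an entire function such that F(μ) = W_{κ,μ}(x₀) for every complex μ with 2μ not an integer. Then there exist constants T₁ and C > 0 such that for every T ≥ T₁ the set {ρ ∈ ℂ : F(ρ) = 0 and |Im(ρ)| ≤ T} is finite and its cardinality N(T) satisfies |N(T) − ((2/π)·T·log T + (2/π)·(2·log 2 − 1 − log x₀)·T)| ≤ C. -/
open Filter Topology

/-- The Whittaker M-function `M_{κ,μ}(x)` for real `x > 0`, defined by its series. -/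
noncomputable def whittakerM (κ μ : ℂ) (x : ℝ) : ℂ :=
  Complex.exp (-(x:ℂ)/2) * Complex.exp ((1/2 + μ) * (Real.log x : ℂ)) *
    ∑' j : ℕ, (Polynomial.eval (1/2 - κ + μ) (ascPochhammer ℂ j)) /
      ((Polynomial.eval (2*μ + 1) (ascPochhammer ℂ j)) * (Nat.factorial j : ℂ)) * (x:ℂ)^j

/-- The Whittaker W-function `W_{κ,μ}(x)` for real `x > 0` and `2μ` not an integer. -/
noncomputable def whittakerW (κ μ : ℂ) (x : ℝ) : ℂ :=
  Complex.Gamma (-(2*μ)) / Complex.Gamma (1/2 - κ - μ) * whittakerM κ μ x +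
  Complex.Gamma (2*μ) / Complex.Gamma (1/2 - κ + μ) * whittakerM κ (-μ) x

/-- coefficients of the Kummer series -/
noncomputable def kc (a b : ℂ) (j : ℕ) : ℂ :=
  (Polynomial.eval a (ascPochhammer ℂ j)) /
      ((Polynomial.eval b (ascPochhammer ℂ j)) * (Nat.factorial j : ℂ))

/-- Kummer function -/
noncomputable def kf (a b z : ℂ) : ℂ := ∑' j : ℕ, kc a b j * z ^ j

theorem whittakerM_eq (κ μ : ℂ) (x : ℝ) : whittakerM κ μ x =
    Complex.exp (-(x:ℂ)/2) * Complex.exp ((1/2 + μ) * (Real.log x : ℂ)) *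
      kf (1/2 - κ + μ) (2*μ+1) x := rfl

theorem poch_ne (b : ℂ) (hb : ∀ n : ℕ, b + n ≠ 0) (j : ℕ) :
    Polynomial.eval b (ascPochhammer ℂ j) ≠ 0 := by
  induction j with
  | zero => simp
  | succ j ih => rw [ascPochhammer_succ_eval]; exact mul_ne_zero ih (hb j)

theorem kc_zero (a b : ℂ) : kc a b 0 = 1 := by simp [kc]

theorem kc_succ (a b : ℂ) (j : ℕ) :
    kc a b (j+1) = kc a b j * ((a + j) / (b + j)) / (j+1) := by
  unfold kc
  rw [ascPochhammer_succ_eval, ascPochhammer_succ_eval, Nat.factorial_succ]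
  push_cast
  rw [div_mul_div_comm, div_div]
  congr 1; ring

theorem kc_rec (a b : ℂ) (hb : ∀ n : ℕ, b + n ≠ 0) (j : ℕ) :
    kc a b (j+1) * (b + j) * (j+1) = kc a b j * (a + j) := by
  rw [kc_succ]
  have h1 := hb j
  have h2 : (j:ℂ) + 1 ≠ 0 := Nat.cast_add_one_ne_zero j
  field_simp

theorem kc_shift (a b : ℂ) (hb : ∀ n : ℕ, b + n ≠ 0) (j : ℕ) :
    kc a b (j+1) * (j+1) = a / b * kc (a+1) (b+1) j := by
  have hb1 : ∀ n : ℕ, b + 1 + n ≠ 0 := fun n => by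
    have := hb (n+1); push_cast at this; rwa [add_assoc, add_comm (1:ℂ)]
  have h2 : ∀ j : ℕ, (j:ℂ) + 1 ≠ 0 := fun j => Nat.cast_add_one_ne_zero j
  have hb0 : b ≠ 0 := by simpa using hb 0
  induction j with
  | zero => rw [kc_succ]; simp [kc_zero]
  | succ j ih =>
    have e1 := kc_rec a b hb (j+1)
    have e2 := kc_rec (a+1) (b+1) hb1 j
    have h3 := hb (j+1)
    push_cast at *
    have h4 : (b + 1 + j) ≠ 0 := hb1 j
    have : kc (a+1) (b+1) (j+1) = kc (a+1) (b+1) j * (a+1+j) / ((b+1+j) * (j+1)) := by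
      rw [eq_div_iff (mul_ne_zero h4 (h2 j))]; rw [← e2]; ring
    rw [this]
    have h5 : kc (a+1) (b+1) j = b / a * (kc a b (j+1) * (j+1)) ∨ a = 0 := by
      by_cases ha : a = 0
      · right; exact ha
      · left; rw [ih]; field_simp
    have e1' : kc a b (j+1+1) * (↑j+1+1) = kc a b (j+1) * (a + (j+1)) / (b + (j+1)) := by
      rw [eq_div_iff h3, ← e1]; ring
    rw [e1']
    have : kc a b (j+1) = a / b * kc (a+1) (b+1) j / (j+1) := by
      rw [← ih]; field_simp [h2 j]
    rw [this]
    have h6 : b + (j + 1) = b + 1 + j := by ring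
    rw [h6]
    field_simp
    ring

/-- if the ratios are bounded by `K`, coefficients are bounded -/
theorem kc_bound (a b : ℂ) (K : ℝ) (hK : ∀ j : ℕ, ‖(a + j) / (b + j)‖ ≤ K) (j : ℕ) :
    ‖kc a b j‖ ≤ K ^ j / (Nat.factorial j) := by
  have hK0 : 0 ≤ K := (norm_nonneg _).trans (hK 0)
  induction j with
  | zero => simp [kc_zero]
  | succ j ih =>
    rw [kc_succ, norm_div, norm_mul, Nat.factorial_succ]
    have : ‖(j:ℂ)+1‖ = j + 1 := by
      have := Complex.norm_natCast (j+1); push_cast at this; exact this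
    rw [this]
    calc _ ≤ K^j / (Nat.factorial j) * K / (j+1) := by
            gcongr
            exact hK j
      _ = _ := by push_cast; rw [pow_succ]; field_simp

theorem ratio_bdd (a b : ℂ) : ∃ K : ℝ, ∀ j : ℕ, ‖(a + j) / (b + j)‖ ≤ K := by
  have h : Tendsto (fun j : ℕ => (a + j) / (b + j)) atTop (𝓝 1) := by
    have h1 : Tendsto (fun j : ℕ => a * (j:ℂ)⁻¹ + 1) atTop (𝓝 (a * 0 + 1)) :=
      (tendsto_const_nhds.mul (tendsto_inv_atTop_nhds_zero_nat (𝕜 := ℂ))).add tendsto_const_nhds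
    have h2 : Tendsto (fun j : ℕ => b * (j:ℂ)⁻¹ + 1) atTop (𝓝 (b * 0 + 1)) :=
      (tendsto_const_nhds.mul (tendsto_inv_atTop_nhds_zero_nat (𝕜 := ℂ))).add tendsto_const_nhds
    have h3 := h1.div h2 (by simp)
    simp only [mul_zero, zero_add, div_one] at h3
    refine h3.congr' ?_
    filter_upwards [eventually_gt_atTop 0] with j hj
    have : (j:ℂ) ≠ 0 := by exact_mod_cast hj.ne'
    simp only [Pi.div_apply]
    rw [← mul_div_mul_right _ _ this]
    congr 1 <;> field_simp
  obtain ⟨K, hK⟩ := h.norm.bddAbove_range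
  exact ⟨K, fun j => hK ⟨j, rfl⟩⟩

theorem kc_bdd (a b : ℂ) : ∃ K : ℝ, 0 ≤ K ∧ ∀ j : ℕ, ‖kc a b j‖ ≤ K ^ j / (Nat.factorial j) := by
  obtain ⟨K, hK⟩ := ratio_bdd a b
  exact ⟨K, (norm_nonneg _).trans (hK 0), kc_bound a b K hK⟩

theorem kf_term_bound (c : ℕ → ℂ) (K : ℝ) (hK : ∀ j : ℕ, ‖c j‖ ≤ K ^ j / (Nat.factorial j))
    (z : ℂ) (R : ℝ) (hz : ‖z‖ ≤ R) (j : ℕ) : ‖c j * z ^ j‖ ≤ (K * R) ^ j / (Nat.factorial j) := by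
  rw [norm_mul, norm_pow, mul_pow, mul_div_right_comm]
  have : 0 ≤ K ^ j / (Nat.factorial j) := (norm_nonneg _).trans (hK j)
  gcongr
  exact hK j

theorem kf_summable (a b z : ℂ) : Summable (fun j => kc a b j * z ^ j) := by
  obtain ⟨K, hK0, hK⟩ := kc_bdd a b
  exact Summable.of_norm_bounded (Real.summable_pow_div_factorial (K * ‖z‖))
    (kf_term_bound _ K hK z _ le_rfl)

theorem kf_norm_le (a b z : ℂ) (K : ℝ) (hK : ∀ j : ℕ, ‖(a + j) / (b + j)‖ ≤ K) :
    ‖kf a b z‖ ≤ Real.exp (K * ‖z‖) := by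
  have h := kf_term_bound _ K (kc_bound a b K hK) z _ le_rfl
  rw [Real.exp_eq_exp_ℝ, NormedSpace.exp_eq_tsum_div]
  exact tsum_of_norm_bounded (Real.summable_pow_div_factorial (K * ‖z‖)).hasSum h

theorem kf_zero (a b : ℂ) : kf a b 0 = 1 := by
  unfold kf
  rw [tsum_eq_single 0]
  · simp [kc_zero]
  · intro j hj; simp [hj]

theorem kf_hasDerivAt (a b : ℂ) (hb : ∀ n : ℕ, b + n ≠ 0) (z : ℂ) :
    HasDerivAt (kf a b) (a / b * kf (a+1) (b+1) z) z := by
  obtain ⟨K, hK0, hK⟩ := kc_bdd a b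
  have hU : IsOpen (Metric.ball (0:ℂ) (‖z‖+1)) := Metric.isOpen_ball
  have hz : z ∈ Metric.ball (0:ℂ) (‖z‖+1) := by simp
  have hu := Real.summable_pow_div_factorial (K * (‖z‖+1))
  have hf : ∀ i : ℕ, DifferentiableOn ℂ (fun w => kc a b i * w ^ i) (Metric.ball (0:ℂ) (‖z‖+1)) := by
    intro i; fun_prop
  have hle : ∀ (i : ℕ) (w : ℂ), w ∈ Metric.ball (0:ℂ) (‖z‖+1) →
      ‖kc a b i * w ^ i‖ ≤ (K * (‖z‖+1)) ^ i / (Nat.factorial i) := by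
    intro i w hw
    exact kf_term_bound _ K hK w _ (by simpa using (mem_ball_zero_iff.mp hw).le) i
  have hd := Complex.differentiableOn_tsum_of_summable_norm hu hf hU hle
  have hs := Complex.hasSum_deriv_of_summable_norm hu hf hU hle hz
  have h1 : HasDerivAt (kf a b) (deriv (kf a b) z) z :=
    (hd.differentiableAt (hU.mem_nhds hz)).hasDerivAt
  have h2 : deriv (kf a b) z = a / b * kf (a+1) (b+1) z := by
    refine hs.unique ?_ |>.trans rfl
    rw [← hasSum_nat_add_iff' 1]
    simp only [Finset.range_one, Finset.sum_singleton, pow_zero, mul_one, deriv_const, sub_zero]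
    have := ((kf_summable (a+1) (b+1) z).hasSum).mul_left (a/b)
    refine this.congr_fun ?_ |> fun h => h
    intro j
    rw [deriv_const_mul_field]
    simp only [deriv_pow_field]
    rw [← mul_assoc (a/b), ← kc_shift a b hb]
    simp; ring
  rw [← h2]; exact h1

theorem kf_mul_hasSum (a b : ℂ) (hb : ∀ n : ℕ, b + n ≠ 0) (z : ℂ) :
    HasSum (fun j : ℕ => j * kc a b j * z ^ j) (z * (a / b * kf (a+1) (b+1) z)) := by
  rw [← hasSum_nat_add_iff' 1]
  simp only [Finset.range_one, Finset.sum_singleton, pow_zero, mul_one, Nat.cast_zero, zero_mul,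
    sub_zero]
  have := (((kf_summable (a+1) (b+1) z).hasSum).mul_left (a/b)).mul_left z
  refine this.congr_fun ?_
  intro j
  have := kc_shift a b hb j
  rw [← mul_assoc (a/b), ← this]
  push_cast; ring

theorem kf_ode (a b : ℂ) (hb : ∀ n : ℕ, b + n ≠ 0) (z : ℂ) :
    z * ((a/b) * ((a+1)/(b+1) * kf (a+1+1) (b+1+1) z)) + (b - z) * (a/b * kf (a+1) (b+1) z)
      - a * kf a b z = 0 := by
  have hb1 : ∀ n : ℕ, b + 1 + n ≠ 0 := fun n => by
    have := hb (n+1); push_cast at this; rwa [add_assoc, add_comm (1:ℂ)]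
  have s1 := (kf_mul_hasSum (a+1) (b+1) hb1 z).mul_left (a/b)
  have s2 := (((kf_summable (a+1) (b+1) z).hasSum).mul_left (a/b)).mul_left b
  have s3 := kf_mul_hasSum a b hb z
  have s4 := ((kf_summable a b z).hasSum).mul_left a
  have s := ((s1.add s2).sub s3).sub s4
  have h0 : HasSum (fun _ : ℕ => (0:ℂ)) 0 := hasSum_zero
  have := s.unique (h0.congr_fun (fun j => ?_))
  · rw [← this]; unfold kf; ring
  · have e1 := kc_shift a b hb j
    have e2 := kc_rec a b hb j
    have : a / b * (j * kc (a+1) (b+1) j * z ^ j) + b * (a / b * (kc (a+1) (b+1) j * z ^ j))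
      - j * kc a b j * z ^ j - a * (kc a b j * z ^ j)
      = ((a / b * kc (a+1) (b+1) j) * (b + j) - kc a b j * (a + j)) * z ^ j := by ring
    rw [this, ← e1, ← e2]; ring

theorem kc_pred (a b : ℂ) (j : ℕ) :
    kc (a-1) b (j+1) = kc a b j * ((a-1) / (b+j)) / (j+1) := by
  induction j with
  | zero => rw [kc_succ]; simp [kc_zero]
  | succ j ih =>
    rw [kc_succ, ih, kc_succ a b j]
    push_cast
    have : a - 1 + (j + 1) = a + j := by ring
    rw [this]
    ring

theorem kf_contig (a b : ℂ) (hb : ∀ n : ℕ, b + n ≠ 0) (z : ℂ) :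
    z * (a / b * kf (a+1) (b+1) z) = (z - (b - a)) * kf a b z + (b - a) * kf (a-1) b z := by
  have s1 := (kf_mul_hasSum a b hb z)
  have s2 := ((kf_summable a b z).hasSum).mul_left (b-a)
  have s3 := ((kf_summable (a-1) b z).hasSum).mul_left (b-a)
  have s := (s1.add s2).sub s3
  rw [← hasSum_nat_add_iff' 1] at s
  have s4 := ((kf_summable a b z).hasSum).mul_left z
  have := s.unique (s4.congr_fun (fun j => ?_))
  · simp only [Finset.range_one, Finset.sum_singleton, pow_zero, mul_one, Nat.cast_zero, zero_mul,
      kc_zero] at this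
    change _ + (b-a) * kf a b z - (b-a) * kf (a-1) b z - _ = z * kf a b z at this
    linear_combination this
  · have h1 := hb j
    have h2 : (j:ℂ) + 1 ≠ 0 := Nat.cast_add_one_ne_zero j
    rw [kc_pred, kc_succ]
    push_cast
    field_simp
    ring

open Filter Topology

/-- potential of the Whittaker equation -/
noncomputable def wQ (κ μ : ℂ) (x : ℝ) : ℂ := 1/4 - κ/x + (μ^2 - 1/4)/(x:ℂ)^2

/-- solution of the Whittaker equation on the half line, with its derivative -/
def WSol (κ μ : ℂ) (y y' : ℝ → ℂ) : Prop :=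
  ∀ x : ℝ, 0 < x → HasDerivAt y (y' x) x ∧ HasDerivAt y' (wQ κ μ x * y x) x

/-- prefactor -/
noncomputable def wE (μ : ℂ) (x : ℝ) : ℂ :=
  Complex.exp (-(x:ℂ)/2) * Complex.exp ((1/2 + μ) * (Real.log x : ℂ))

theorem wE_hasDerivAt (μ : ℂ) (x : ℝ) (hx : 0 < x) :
    HasDerivAt (wE μ) ((-1/2 + (1/2+μ)/x) * wE μ x) x := by
  have h1 : HasDerivAt (fun x : ℝ => (x:ℂ)) 1 x := Complex.ofRealCLM.hasDerivAt
  have h2 : HasDerivAt (fun x : ℝ => ((Real.log x : ℝ):ℂ)) ((x⁻¹:ℝ):ℂ) x :=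
    (Real.hasDerivAt_log hx.ne').ofReal_comp
  have h3 := (((h1.neg).div_const 2).cexp).mul ((h2.const_mul (1/2+μ)).cexp)
  refine h3.congr_deriv ?_
  unfold wE
  push_cast
  simp only [Pi.neg_apply]
  ring

theorem wsol_of_kummer (κ μ : ℂ) (f f1 f2 : ℝ → ℂ)
    (h1 : ∀ x : ℝ, 0 < x → HasDerivAt f (f1 x) x)
    (h2 : ∀ x : ℝ, 0 < x → HasDerivAt f1 (f2 x) x)
    (h3 : ∀ x : ℝ, 0 < x → x * f2 x + ((2*μ+1) - x) * f1 x - (1/2 - κ + μ) * f x = 0) :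
    WSol κ μ (fun x => wE μ x * f x)
      (fun x => wE μ x * ((-1/2 + (1/2+μ)/x) * f x + f1 x)) := by
  intro x hx
  have hxc : (x:ℂ) ≠ 0 := by exact_mod_cast hx.ne'
  have g1 : HasDerivAt (fun x : ℝ => (x:ℂ)) 1 x := Complex.ofRealCLM.hasDerivAt
  have hE := wE_hasDerivAt μ x hx
  refine ⟨(hE.mul (h1 x hx)).congr_deriv (by ring), ?_⟩
  have g2 : HasDerivAt (fun x : ℝ => (-1/2 + (1/2+μ)/x : ℂ)) (-(1/2+μ)/(x:ℂ)^2) x := by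
    have := ((g1.inv hxc).const_mul (1/2+μ)).const_add (-1/2)
    refine this.congr_deriv ?_
    ring
  refine (hE.mul ((g2.mul (h1 x hx)).add (h2 x hx))).congr_deriv ?_
  have e := h3 x hx
  unfold wQ
  have e2 : f2 x = ((1/2 - κ + μ) * f x - ((2*μ+1) - x) * f1 x) / x := by
    rw [eq_div_iff hxc]; linear_combination e
  simp only [Pi.add_apply, Pi.mul_apply]
  rw [e2]
  field_simp
  ring

theorem const_Ioi (f : ℝ → ℂ) (h : ∀ x : ℝ, 0 < x → HasDerivAt f 0 x) (x y : ℝ) (hx : 0 < x)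
    (hy : 0 < y) : f x = f y := by
  have := (convex_Ioi (0:ℝ)).norm_image_sub_le_of_norm_hasDerivWithin_le (f := f) (f' := fun _ => 0)
    (C := 0) (x := y) (y := x) (fun z hz => (h z hz).hasDerivWithinAt) (by simp) hy hx
  simpa [sub_eq_zero] using this

theorem wronsk_const (κ μ : ℂ) (y y' u u' : ℝ → ℂ) (hy : WSol κ μ y y') (hu : WSol κ μ u u')
    (x t : ℝ) (hx : 0 < x) (ht : 0 < t) :
    y x * u' x - y' x * u x = y t * u' t - y' t * u t := by
  refine const_Ioi (fun x => y x * u' x - y' x * u x) (fun x hx => ?_) x t hx ht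
  obtain ⟨a1, a2⟩ := hy x hx
  obtain ⟨b1, b2⟩ := hu x hx
  exact ((a1.mul b2).sub (a2.mul b1)).congr_deriv (by ring)

/-- derivative of the Whittaker M function -/
noncomputable def whittakerM' (κ μ : ℂ) (x : ℝ) : ℂ :=
  wE μ x * ((-1/2 + (1/2+μ)/x) * kf (1/2 - κ + μ) (2*μ+1) x +
    (1/2 - κ + μ) / (2*μ+1) * kf (1/2 - κ + μ + 1) (2*μ+1+1) x)

theorem shift_ne {b : ℂ} (hb : ∀ n : ℕ, b + n ≠ 0) : ∀ n : ℕ, b + 1 + n ≠ 0 := fun n => by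
    have := hb (n+1); push_cast at this; rwa [add_assoc, add_comm (1:ℂ)]

theorem kf_hasDerivAt_real (a b : ℂ) (hb : ∀ n : ℕ, b + n ≠ 0) (x : ℝ) :
    HasDerivAt (fun x : ℝ => kf a b x) (a / b * kf (a+1) (b+1) x) x :=
  (kf_hasDerivAt a b hb x).comp_ofReal

theorem whittakerM_sol (κ μ : ℂ) (hb : ∀ n : ℕ, 2*μ+1 + n ≠ 0) :
    WSol κ μ (whittakerM κ μ) (whittakerM' κ μ) := by
  refine wsol_of_kummer κ μ (fun x => kf (1/2 - κ + μ) (2*μ+1) x)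
    (fun x => (1/2 - κ + μ) / (2*μ+1) * kf (1/2 - κ + μ + 1) (2*μ+1+1) x)
    (fun x => (1/2 - κ + μ) / (2*μ+1) * ((1/2 - κ + μ + 1) / (2*μ+1+1) *
      kf (1/2 - κ + μ + 1 + 1) (2*μ+1+1+1) x)) ?_ ?_ ?_
  · exact fun x _ => kf_hasDerivAt_real _ _ hb x
  · exact fun x _ => (kf_hasDerivAt_real _ _ (shift_ne hb) x).const_mul _
  · exact fun x _ => kf_ode _ _ hb x

theorem whittakerM_rec (κ μ : ℂ) (hb : ∀ n : ℕ, 2*μ+1 + n ≠ 0) (x : ℝ) (hx : 0 < x) :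
    (x/2 - κ) * whittakerM κ μ x - x * whittakerM' κ μ x =
      -(1/2 + κ + μ) * whittakerM (κ+1) μ x := by
  have hxc : (x:ℂ) ≠ 0 := by exact_mod_cast hx.ne'
  have e := kf_contig (1/2 - κ + μ) (2*μ+1) hb x
  rw [whittakerM_eq, whittakerM_eq, whittakerM']
  have e1 : 1/2 - (κ+1) + μ = 1/2 - κ + μ - 1 := by ring
  rw [e1]
  have : (x:ℂ) * (wE μ x * ((-1/2 + (1/2+μ)/x) * kf (1/2 - κ + μ) (2*μ+1) x +
    (1/2 - κ + μ) / (2*μ+1) * kf (1/2 - κ + μ + 1) (2*μ+1+1) x)) =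
    wE μ x * ((-x/2 + (1/2+μ)) * kf (1/2 - κ + μ) (2*μ+1) x +
    x * ((1/2 - κ + μ) / (2*μ+1) * kf (1/2 - κ + μ + 1) (2*μ+1+1) x)) := by
    field_simp
  rw [this, e]
  unfold wE
  ring

theorem nn_of_int {μ : ℂ} (h : ∀ n : ℤ, 2*μ ≠ (n:ℂ)) : ∀ n : ℕ, 2*μ+1 + n ≠ 0 := by
  intro n h0
  apply h (-(n+1))
  push_cast
  linear_combination h0

theorem int_neg {μ : ℂ} (h : ∀ n : ℤ, 2*μ ≠ (n:ℂ)) : ∀ n : ℤ, 2*(-μ) ≠ (n:ℂ) := by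
  intro n h0
  apply h (-n)
  push_cast
  linear_combination -h0

theorem wE_mul_neg (μ : ℂ) (x : ℝ) (hx : 0 < x) : wE μ x * wE (-μ) x = Complex.exp (-x) * x := by
  have hxc : (x:ℂ) ≠ 0 := by exact_mod_cast hx.ne'
  have : (x:ℂ) = Complex.exp (Real.log x) := by
    rw [← Complex.ofReal_exp, Real.exp_log hx]
  unfold wE
  conv_rhs => rw [this]
  rw [← Complex.exp_add, ← Complex.exp_add, ← Complex.exp_add, ← Complex.exp_add,
    ← this]
  congr 1; ring

theorem wronsk_MM (κ μ : ℂ) (h : ∀ n : ℤ, 2*μ ≠ (n:ℂ)) (x : ℝ) (hx : 0 < x) :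
    whittakerM κ μ x * whittakerM' κ (-μ) x - whittakerM' κ μ x * whittakerM κ (-μ) x = -2*μ := by
  have hb := nn_of_int h
  have hb' := nn_of_int (int_neg h)
  obtain ⟨g, hg⟩ : ∃ g : ℝ → ℂ, g =
      (fun t : ℝ => Complex.exp (-t) * (-2*μ * (kf (1/2 - κ + μ) (2*μ+1) t *
        kf (1/2 - κ + -μ) (2*(-μ)+1) t) + t * (kf (1/2 - κ + μ) (2*μ+1) t *
        ((1/2 - κ + -μ) / (2*(-μ)+1) * kf (1/2 - κ + -μ + 1) (2*(-μ)+1+1) t) -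
        ((1/2 - κ + μ) / (2*μ+1) * kf (1/2 - κ + μ + 1) (2*μ+1+1) t) *
        kf (1/2 - κ + -μ) (2*(-μ)+1) t))) := ⟨_, rfl⟩
  have key : ∀ t : ℝ, 0 < t →
    whittakerM κ μ t * whittakerM' κ (-μ) t - whittakerM' κ μ t * whittakerM κ (-μ) t =
      g t := by
    intro t ht
    have htc : (t:ℂ) ≠ 0 := by exact_mod_cast ht.ne'
    have e := wE_mul_neg μ t ht
    rw [hg]
    change wE μ t * kf _ _ t * (wE (-μ) t * _) - wE μ t * _ * (wE (-μ) t * kf _ _ t) = _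
    have : ∀ A B C D : ℂ, wE μ t * A * (wE (-μ) t * B) - wE μ t * C * (wE (-μ) t * D)
      = Complex.exp (-t) * (t * (A * B - C * D)) := by
      intro A B C D
      linear_combination (A * B - C * D) * e
    rw [this]
    congr 1
    field_simp
    ring
  have hc : ∀ t : ℝ, 0 < t → whittakerM κ μ t * whittakerM' κ (-μ) t
      - whittakerM' κ μ t * whittakerM κ (-μ) t = whittakerM κ μ x * whittakerM' κ (-μ) x
      - whittakerM' κ μ x * whittakerM κ (-μ) x := by
    intro t ht
    have hs : WSol κ μ (whittakerM κ (-μ)) (whittakerM' κ (-μ)) := by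
      have := whittakerM_sol κ (-μ) hb'
      unfold WSol wQ at *
      simpa using this
    exact wronsk_const κ μ _ _ _ _ (whittakerM_sol κ μ hb) hs t x ht hx
  have hkc : ∀ a b : ℂ, (∀ n : ℕ, b + n ≠ 0) → Continuous (fun t : ℝ => kf a b t) := by
    intro a b hb
    exact continuous_iff_continuousAt.mpr (fun t => (kf_hasDerivAt_real a b hb t).continuousAt)
  have c1 := hkc (1/2 - κ + μ) _ hb
  have c2 := hkc (1/2 - κ + -μ) _ hb'
  have c3 := hkc (1/2 - κ + μ + 1) _ (shift_ne hb)
  have c4 := hkc (1/2 - κ + -μ + 1) _ (shift_ne hb')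
  have hgc : Continuous g := by
    rw [hg]
    fun_prop
  have hg0 : g 0 = -2*μ := by
    rw [hg]; simp [kf_zero]
  have l1 : Tendsto g (𝓝[>] 0) (𝓝 (-2*μ)) := by
    rw [← hg0]; exact hgc.continuousAt.tendsto.mono_left nhdsWithin_le_nhds
  refine tendsto_nhds_unique (tendsto_const_nhds.congr' ?_) l1
  filter_upwards [self_mem_nhdsWithin] with t ht
  rw [← hc t ht]
  exact key t ht

open Filter Topology MeasureTheory Set

/-- power `t ^ s` for positive real `t` -/
noncomputable def pw (t : ℝ) (s : ℂ) : ℂ := Complex.exp (s * (Real.log t : ℂ))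

theorem pw_cpow (t : ℝ) (ht : 0 < t) (s : ℂ) : (t:ℂ) ^ s = pw t s := by
  have : (t:ℂ) ≠ 0 := by exact_mod_cast ht.ne'
  rw [pw, Complex.cpow_def_of_ne_zero this, Complex.ofReal_log ht.le, mul_comm]

theorem pw_norm (t : ℝ) (ht : 0 < t) (s : ℂ) : ‖pw t s‖ = t ^ s.re := by
  rw [← pw_cpow t ht, Complex.norm_cpow_eq_rpow_re_of_pos ht]

theorem pw_add (t : ℝ) (s r : ℂ) : pw t (s + r) = pw t s * pw t r := by
  unfold pw; rw [← Complex.exp_add]; congr 1; ring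

theorem pw_one (t : ℝ) (ht : 0 < t) : pw t 1 = t := by
  unfold pw; rw [one_mul, ← Complex.ofReal_exp, Real.exp_log ht]

theorem pw_ne (t : ℝ) (s : ℂ) : pw t s ≠ 0 := Complex.exp_ne_zero _

theorem pw_zero (t : ℝ) : pw t 0 = 1 := by simp [pw]

theorem pw_mul (t x : ℝ) (ht : 0 < t) (hx : 0 < x) (s : ℂ) : pw (t * x) s = pw t s * pw x s := by
  unfold pw; rw [← Complex.exp_add, Real.log_mul ht.ne' hx.ne']; congr 1; push_cast; ring

theorem pw_hasDerivAt (t : ℝ) (ht : 0 < t) (s : ℂ) :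
    HasDerivAt (fun t => pw t s) (s * pw t (s - 1)) t := by
  have h2 : HasDerivAt (fun x : ℝ => ((Real.log x : ℝ):ℂ)) ((t⁻¹:ℝ):ℂ) t :=
    (Real.hasDerivAt_log ht.ne').ofReal_comp
  refine ((h2.const_mul s).cexp).congr_deriv ?_
  have : (t:ℂ) ≠ 0 := by exact_mod_cast ht.ne'
  have e := pw_add t (s-1) 1
  rw [pw_one t ht, sub_add_cancel] at e
  change pw t s * _ = _
  rw [e]; push_cast; field_simp

theorem pw_measurable (s : ℂ) : Measurable (fun t => pw t s) := by
  unfold pw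
  exact Complex.measurable_exp.comp
    ((Complex.measurable_ofReal.comp Real.measurable_log).const_mul s)

/-- integrand of the Laplace type integral -/
noncomputable def jI (p q : ℂ) (x t : ℝ) : ℂ :=
  Complex.exp (-(x * t : ℂ)) * (pw t (p - 1) * pw (1 + t) (q - 1))

/-- real majorant -/
noncomputable def rI (p q x t : ℝ) : ℝ := Real.exp (-(x * t)) * (t ^ (p-1) * (1+t) ^ (q-1))

/-- Laplace type integral -/
noncomputable def kJ (p q : ℂ) (x : ℝ) : ℂ := ∫ t in Ioi (0:ℝ), jI p q x t

theorem jI_norm (p q : ℂ) (x t : ℝ) (ht : 0 < t) : ‖jI p q x t‖ = rI p.re q.re x t := by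
  unfold jI rI
  rw [norm_mul, norm_mul, pw_norm t ht, pw_norm (1+t) (by linarith), Complex.norm_exp]
  simp

theorem jI_measurable (p q : ℂ) (x : ℝ) : Measurable (jI p q x) := by
  unfold jI
  refine Measurable.mul ?_ ((pw_measurable _).mul ((pw_measurable _).comp (measurable_const_add 1)))
  fun_prop

theorem rI_measurable (p q x : ℝ) : Measurable (rI p q x) := by
  unfold rI
  fun_prop

theorem one_add_rpow_le (r ε : ℝ) (hε : 0 < ε) : ∃ C : ℝ, 0 < C ∧ ∀ t : ℝ, 0 < t →
    (1+t) ^ r ≤ C * Real.exp (ε * t) := by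
  obtain ⟨n, hn⟩ := exists_nat_ge r
  refine ⟨n.factorial / ε ^ n * Real.exp ε, by positivity, fun t ht => ?_⟩
  have h1 : (1+t) ^ r ≤ (1+t) ^ (n:ℝ) := Real.rpow_le_rpow_of_exponent_le (by linarith) hn
  rw [Real.rpow_natCast] at h1
  have h2 := Real.pow_div_factorial_le_exp (ε * (1+t)) (by positivity) n
  rw [div_le_iff₀ (by positivity), mul_pow] at h2
  have h3 : Real.exp (ε * (1+t)) = Real.exp ε * Real.exp (ε * t) := by
    rw [← Real.exp_add]; congr 1; ring
  rw [h3] at h2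
  refine h1.trans ?_
  have : 0 < ε ^ n := by positivity
  rw [div_mul_eq_mul_div, div_mul_eq_mul_div, le_div_iff₀ this]
  linarith

theorem rI_integrable (p q x : ℝ) (hp : 0 < p) (hx : 0 < x) :
    IntegrableOn (rI p q x) (Ioi 0) := by
  obtain ⟨C, hC, hle⟩ := one_add_rpow_le (q-1) (x/2) (by linarith)
  have h := (integrableOn_rpow_mul_exp_neg_mul_rpow (p := 1) (s := p-1) (b := x/2) (by linarith)
    one_pos (by linarith)).const_mul C
  refine Integrable.mono' h (rI_measurable p q x).aestronglyMeasurable ?_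
  filter_upwards [ae_restrict_mem measurableSet_Ioi] with t ht
  have ht : 0 < t := ht
  unfold rI
  rw [Real.norm_of_nonneg (by positivity), Real.rpow_one]
  have e : Real.exp (-(x*t)) * Real.exp (x/2*t) = Real.exp (-(x/2)*t) := by
    rw [← Real.exp_add]; congr 1; ring
  calc _ ≤ Real.exp (-(x*t)) * (t ^ (p-1) * (C * Real.exp (x/2*t))) := by
        gcongr
        exact hle t ht
    _ = C * (t ^ (p-1) * (Real.exp (-(x*t)) * Real.exp (x/2*t))) := by ring
    _ = _ := by rw [e]

theorem jI_integrable (p q : ℂ) (x : ℝ) (hp : 0 < p.re) (hx : 0 < x) :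
    IntegrableOn (jI p q x) (Ioi 0) := by
  refine Integrable.mono' (rI_integrable p.re q.re x hp hx) (jI_measurable p q x).aestronglyMeasurable ?_
  filter_upwards [ae_restrict_mem measurableSet_Ioi] with t ht
  rw [jI_norm p q x t ht]

theorem jI_succ (p q : ℂ) (x t : ℝ) (ht : 0 < t) : jI (p+1) q x t = t * jI p q x t := by
  unfold jI
  have : p + 1 - 1 = (p - 1) + 1 := by ring
  rw [this, pw_add, pw_one t ht]; ring

theorem kJ_hasDerivAt (p q : ℂ) (x : ℝ) (hp : 0 < p.re) (hx : 0 < x) :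
    HasDerivAt (kJ p q) (- kJ (p+1) q x) x := by
  have hb := rI_integrable (p.re+1) q.re (x/2) (by linarith) (by linarith)
  have key := hasDerivAt_integral_of_dominated_loc_of_deriv_le (μ := volume.restrict (Ioi (0:ℝ)))
    (F := fun x t => jI p q x t) (F' := fun x t => - jI (p+1) q x t) (x₀ := x)
    (s := Ioi (x/2)) (bound := rI (p.re+1) q.re (x/2)) (Ioi_mem_nhds (by linarith))
    (Eventually.of_forall fun x => (jI_measurable p q x).aestronglyMeasurable)
    (jI_integrable p q x hp hx) (jI_measurable _ q x).neg.aestronglyMeasurable ?_ hb ?_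
  · have := key.2
    rw [integral_neg] at this
    exact this
  · filter_upwards [ae_restrict_mem measurableSet_Ioi] with t ht y hy
    have ht : 0 < t := ht
    have hy : x/2 < y := hy
    rw [norm_neg, jI_norm _ _ _ _ ht]
    simp only [Complex.add_re, Complex.one_re]
    unfold rI
    gcongr
  · filter_upwards [ae_restrict_mem measurableSet_Ioi] with t ht y hy
    rw [jI_succ p q y t ht]
    have g1 : HasDerivAt (fun x : ℝ => (x:ℂ)) 1 y := Complex.ofRealCLM.hasDerivAt
    have := (((g1.mul_const (t:ℂ)).neg).cexp).mul_const (pw t (p - 1) * pw (1 + t) (q - 1))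
    refine this.congr_deriv ?_
    simp only [jI, Pi.neg_apply]; ring

theorem kJ_ode (p q : ℂ) (x : ℝ) (hp : 0 < p.re) (hx : 0 < x) :
    x * kJ (p+1+1) q x + (p + q - x) * (-kJ (p+1) q x) - p * kJ p q x = 0 := by
  have i0 := jI_integrable p q x hp hx
  have i1 := jI_integrable (p+1) q x (by simp; linarith) hx
  have i2 := jI_integrable (p+1+1) q x (by simp; linarith) hx
  have hder : ∀ t ∈ Ioi (0:ℝ), HasDerivAt (fun t => jI (p+1) (q+1) x t)
      (-(x * jI (p+1+1) q x t - (p + q - x) * jI (p+1) q x t - p * jI p q x t)) t := by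
    intro t ht
    have ht : 0 < t := ht
    rw [jI_succ (p+1) q x t ht, jI_succ p q x t ht]
    have g1 : HasDerivAt (fun x : ℝ => (x:ℂ)) 1 t := Complex.ofRealCLM.hasDerivAt
    have g2 := (((g1.const_mul (x:ℂ)).neg).cexp)
    have g3 := pw_hasDerivAt t ht p
    have g4 : HasDerivAt (fun t => pw (1+t) q) (q * pw (1+t) (q-1)) t := by
      have := (pw_hasDerivAt (1+t) (by linarith) q).comp_const_add 1 t
      exact this
    have g5 := g2.mul (g3.mul g4)
    have e1 : pw t p = pw t (p-1) * t := by
      have := pw_add t (p-1) 1; rwa [pw_one t ht, sub_add_cancel] at this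
    have e2 : pw (1+t) q = pw (1+t) (q-1) * (1+t) := by
      have := pw_add (1+t) (q-1) 1; rw [pw_one _ (by linarith), sub_add_cancel] at this
      push_cast at this; exact this
    have : (fun t => jI (p+1) (q+1) x t) =
      (fun t : ℝ => Complex.exp (-(x * t : ℂ)) * (pw t p * pw (1 + t) q)) := by
      funext t; simp [jI]
    rw [this]
    refine g5.congr_deriv ?_
    simp only [jI, Pi.neg_apply, Pi.mul_apply]
    rw [e1, e2]
    ring
  have hnonint : IntegrableOn (fun t => -(x * jI (p+1+1) q x t - (p + q - x) * jI (p+1) q x t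
      - p * jI p q x t)) (Ioi 0) :=
    (((i2.const_mul _).sub (i1.const_mul _)).sub (i0.const_mul _)).neg
  obtain ⟨C, hC, hCle⟩ := one_add_rpow_le (p.re + |q.re|) (x/2) (by linarith)
  have hnorm : ∀ t : ℝ, 0 < t → ‖jI (p+1) (q+1) x t‖ = Real.exp (-(x*t)) * (t ^ p.re * (1+t)^q.re) := by
    intro t ht
    rw [jI_norm _ _ _ _ ht]; simp [rI]
  have htop : Tendsto (fun t => jI (p+1) (q+1) x t) atTop (𝓝 0) := by
    have h0 : Tendsto (fun t : ℝ => C * Real.exp (-(x/2*t))) atTop (𝓝 (C * 0)) := by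
      refine Tendsto.const_mul _ (Real.tendsto_exp_neg_atTop_nhds_zero.comp ?_)
      exact tendsto_id.const_mul_atTop (by linarith)
    rw [mul_zero] at h0
    refine squeeze_zero_norm' ?_ h0
    filter_upwards [eventually_gt_atTop 0] with t ht
    rw [hnorm t ht]
    have e : Real.exp (-(x*t)) * Real.exp (x/2*t) = Real.exp (-(x/2*t)) := by
      rw [← Real.exp_add]; congr 1; ring
    calc _ ≤ Real.exp (-(x*t)) * ((1+t)^p.re * (1+t)^|q.re|) := by
          gcongr
          · linarith
          · linarith
          · exact le_abs_self _
      _ = Real.exp (-(x*t)) * ((1+t)^(p.re+|q.re|)) := by rw [Real.rpow_add (by linarith)]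
      _ ≤ Real.exp (-(x*t)) * (C * Real.exp (x/2*t)) := by gcongr; exact hCle t ht
      _ = C * (Real.exp (-(x*t)) * Real.exp (x/2*t)) := by ring
      _ = _ := by rw [e]
  -- value at zero: use modified function
  have h0lim : Tendsto (fun t => jI (p+1) (q+1) x t) (𝓝[>] 0) (𝓝 0) := by
    have : Tendsto (fun t : ℝ => Real.exp (-(x*t)) * (t ^ p.re * (1+t)^q.re)) (𝓝[>] 0) (𝓝 0) := by
      have hc : ContinuousAt (fun t : ℝ => Real.exp (-(x*t)) * (t ^ p.re * (1+t)^q.re)) 0 := by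
        refine ContinuousAt.mul (by fun_prop) (ContinuousAt.mul ?_ ?_)
        · exact Real.continuousAt_rpow_const _ _ (Or.inr hp.le)
        · exact ContinuousAt.rpow_const (by fun_prop) (Or.inl (by norm_num))
      have := hc.tendsto.mono_left (nhdsWithin_le_nhds (s := Ioi 0))
      simpa [Real.zero_rpow hp.ne'] using this
    refine squeeze_zero_norm' ?_ this
    filter_upwards [self_mem_nhdsWithin] with t ht
    rw [hnorm t ht]
  have key := integral_Ioi_of_hasDerivAt_of_tendsto (f := fun t => if t ≤ 0 then 0 else jI (p+1) (q+1) x t)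
    (f' := fun t => -(x * jI (p+1+1) q x t - (p + q - x) * jI (p+1) q x t
      - p * jI p q x t)) (a := 0) (m := 0) ?_ ?_ hnonint ?_
  · simp only [le_refl, if_true, sub_zero] at key
    have h12 : Integrable (fun t => x * jI (p+1+1) q x t - (p + q - x) * jI (p+1) q x t)
      (volume.restrict (Ioi 0)) := (i2.const_mul _).sub (i1.const_mul _)
    rw [integral_neg, integral_sub h12 (i0.const_mul _),
      integral_sub (i2.const_mul _) (i1.const_mul _), integral_const_mul, integral_const_mul,
      integral_const_mul] at key
    unfold kJ
    linear_combination -key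
  · rw [← continuousWithinAt_Ioi_iff_Ici]
    unfold ContinuousWithinAt
    simp only [le_refl, if_true]
    refine h0lim.congr' ?_
    filter_upwards [self_mem_nhdsWithin] with t ht
    rw [if_neg (not_le.mpr ht)]
  · intro t ht
    refine (hder t ht).congr_of_eventuallyEq ?_
    filter_upwards [Ioi_mem_nhds (show (0:ℝ) < t from ht)] with s hs
    rw [if_neg (not_le.mpr hs)]
  · refine htop.congr' ?_
    filter_upwards [eventually_gt_atTop 0] with t ht
    rw [if_neg (not_le.mpr ht)]

theorem kJ_bound (p q : ℂ) (hp : 0 < p.re) : ∃ B : ℝ, ∀ x : ℝ, 1 ≤ x → ‖kJ p q x‖ ≤ B := by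
  refine ⟨∫ t in Ioi (0:ℝ), rI p.re q.re 1 t, fun x hx => ?_⟩
  refine norm_integral_le_of_norm_le (rI_integrable p.re q.re 1 hp one_pos) ?_
  filter_upwards [ae_restrict_mem measurableSet_Ioi] with t ht
  have ht : 0 < t := ht
  rw [jI_norm _ _ _ _ ht]
  unfold rI
  gcongr

theorem beta_sub (p q : ℂ) (hp : 0 < p.re) (hq : (p+q).re < 1) :
    IntegrableOn (jI p q 0) (Ioi 0) ∧
    kJ p q 0 = Complex.Gamma p * Complex.Gamma (1 - p - q) / Complex.Gamma (1 - q) := by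
  have hq' : 0 < (1 - p - q).re := by simp at *; linarith
  have himg : (fun t : ℝ => t / (1+t)) '' (Ioi 0) = Ioo 0 1 := by
    ext u
    constructor
    · rintro ⟨t, ht, rfl⟩
      have ht : 0 < t := ht
      refine ⟨by positivity, ?_⟩
      simp only []
      rw [div_lt_one (by linarith)]; linarith
    · rintro ⟨h0, h1⟩
      have : 0 < 1 - u := by linarith
      refine ⟨u / (1-u), div_pos h0 this, ?_⟩
      simp only []
      field_simp
      ring
  have hd : ∀ t ∈ Ioi (0:ℝ), HasDerivWithinAt (fun t : ℝ => t / (1+t)) (1/(1+t)^2) (Ioi 0) t := by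
    intro t ht
    have ht : 0 < t := ht
    have := (hasDerivAt_id t).div ((hasDerivAt_id t).const_add 1) (by simp; linarith)
    refine (this.congr_deriv ?_).hasDerivWithinAt
    simp
  have hinj : InjOn (fun t : ℝ => t / (1+t)) (Ioi 0) := by
    intro t ht s hs h
    have ht : 0 < t := ht
    have hs : 0 < s := hs
    simp only [] at h
    rw [div_eq_div_iff (by linarith) (by linarith)] at h
    linarith
  have hg : ∀ t ∈ Ioi (0:ℝ), |1/(1+t)^2| • (fun u : ℝ => (u:ℂ) ^ (p-1) * (1-(u:ℂ)) ^ ((1-p-q)-1)) (t / (1+t))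
      = jI p q 0 t := by
    intro t ht
    have ht : 0 < t := ht
    have h1 : 0 < 1 + t := by linarith
    have h2 : (1:ℂ) - ((t/(1+t) : ℝ):ℂ) = (((1+t)⁻¹ : ℝ) : ℂ) := by
      have : (1:ℂ) + t ≠ 0 := by exact_mod_cast h1.ne'
      push_cast; field_simp; ring
    simp only []
    rw [h2, pw_cpow _ (div_pos ht h1), pw_cpow _ (inv_pos.mpr h1), abs_of_pos (by positivity)]
    unfold jI
    have h3 : pw ((1+t)⁻¹) (1-p-q-1) = pw (1+t) (p+q) := by
      unfold pw; rw [Real.log_inv]; congr 1; push_cast; ring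
    have h4 : pw (t/(1+t)) (p-1) = pw t (p-1) * pw (1+t) (1-p) := by
      unfold pw; rw [Real.log_div ht.ne' h1.ne', ← Complex.exp_add]; congr 1; push_cast; ring
    have h5 : pw (1+t) (-2) = ((1/(1+t)^2 : ℝ):ℂ) := by
      have e : pw (1+t) (-2) * (pw (1+t) 1 * pw (1+t) 1) = 1 := by
        rw [← pw_add, ← pw_add]
        have h0 : (-2:ℂ)+(1+1)=0 := by norm_num
        rw [h0, pw_zero]
      rw [pw_one _ h1] at e
      have : (1:ℂ) + t ≠ 0 := by exact_mod_cast h1.ne'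
      push_cast at *
      field_simp
      linear_combination e
    rw [h3, h4, Complex.real_smul, ← h5]
    have h6 : q - 1 = -2 + ((1-p) + (p+q)) := by ring
    rw [h6, pw_add (1+t) (-2), pw_add (1+t) (1-p) (p+q)]
    have h7 : Complex.exp (-(((0:ℝ):ℂ) * (t:ℂ))) = 1 := by simp
    simp only [h7]
    ring
  have hconv := Complex.betaIntegral_convergent hp hq'
  rw [intervalIntegrable_iff_integrableOn_Ioo_of_le zero_le_one, ← himg,
    integrableOn_image_iff_integrableOn_abs_deriv_smul measurableSet_Ioi hd hinj] at hconv
  refine ⟨hconv.congr_fun hg measurableSet_Ioi, ?_⟩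
  have hb := Complex.betaIntegral_eq_Gamma_mul_div p (1-p-q) hp hq'
  rw [Complex.betaIntegral, intervalIntegral.integral_of_le zero_le_one,
    integral_Ioc_eq_integral_Ioo, ← himg,
    integral_image_eq_integral_abs_deriv_smul measurableSet_Ioi hd hinj,
    setIntegral_congr_fun measurableSet_Ioi hg] at hb
  unfold kJ
  rw [hb]; congr 2; ring

theorem kJ_tendsto_zero (p q : ℂ) (hp : 0 < p.re) (hq : (p+q).re < 1) :
    Tendsto (kJ p q) (𝓝[>] 0)
      (𝓝 (Complex.Gamma p * Complex.Gamma (1 - p - q) / Complex.Gamma (1 - q))) := by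
  obtain ⟨h1, h2⟩ := beta_sub p q hp hq
  rw [← h2]
  refine tendsto_integral_filter_of_dominated_convergence (fun t => ‖jI p q 0 t‖) ?_ ?_ h1.norm ?_
  · exact Eventually.of_forall fun x => (jI_measurable p q x).aestronglyMeasurable
  · filter_upwards [self_mem_nhdsWithin] with x hx
    have hx : 0 < x := hx
    filter_upwards [ae_restrict_mem measurableSet_Ioi] with t ht
    have ht : 0 < t := ht
    rw [jI_norm _ _ _ _ ht, jI_norm _ _ _ _ ht]
    unfold rI
    gcongr
  · refine Eventually.of_forall fun t => ?_
    have : Continuous (fun x => jI p q x t) := by unfold jI; fun_prop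
    exact this.continuousAt.tendsto.mono_left nhdsWithin_le_nhds

theorem kJ_tendsto_zero' (p q : ℂ) (hp : 0 < p.re) (hq : 1 < (p+q).re) :
    Tendsto (fun x => pw x (p+q-1) * kJ p q x) (𝓝[>] 0) (𝓝 (Complex.Gamma (p+q-1))) := by
  have hpq : 0 < (p+q-1).re := by simp at *; linarith
  have e : ∀ x : ℝ, 0 < x → pw x (p+q-1) * kJ p q x =
      ∫ t in Ioi (0:ℝ), Complex.exp (-(t:ℂ)) * (pw t (p-1) * pw (x+t) (q-1)) := by
    intro x hx
    have := integral_comp_mul_left_Ioi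
      (fun t => Complex.exp (-(t:ℂ)) * (pw t (p-1) * pw (x+t) (q-1))) 0 hx
    rw [mul_zero] at this
    have hxc : (x:ℂ) ≠ 0 := by exact_mod_cast hx.ne'
    have h2 : (∫ t in Ioi (0:ℝ), Complex.exp (-(t:ℂ)) * (pw t (p-1) * pw (x+t) (q-1))) =
      x * ∫ t in Ioi (0:ℝ), Complex.exp (-((x*t:ℝ):ℂ)) * (pw (x*t) (p-1) * pw (x+x*t) (q-1)) := by
      rw [this, Complex.real_smul]; push_cast; field_simp
    rw [h2, kJ, ← integral_const_mul, ← integral_const_mul]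
    refine setIntegral_congr_fun measurableSet_Ioi (fun t ht => ?_)
    have ht : 0 < t := ht
    have h3 : x + x*t = x*(1+t) := by ring
    simp only [jI]
    rw [h3, pw_mul x t hx ht, pw_mul x (1+t) hx (by linarith)]
    have h4 : p + q - 1 = 1 + ((p-1) + (q-1)) := by ring
    rw [h4, pw_add, pw_add, pw_one x hx]
    push_cast; ring
  have e2 : Complex.Gamma (p+q-1) =
      ∫ t in Ioi (0:ℝ), Complex.exp (-(t:ℂ)) * (pw t (p-1) * pw (0+t) (q-1)) := by
    rw [Complex.Gamma_eq_integral hpq, Complex.GammaIntegral]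
    refine setIntegral_congr_fun measurableSet_Ioi (fun t ht => ?_)
    rw [pw_cpow t ht, zero_add, ← pw_add]
    push_cast
    congr 2; ring
  rw [e2]
  have key : Tendsto (fun x => ∫ t in Ioi (0:ℝ), Complex.exp (-(t:ℂ)) * (pw t (p-1) * pw (x+t) (q-1)))
      (𝓝[>] 0) (𝓝 (∫ t in Ioi (0:ℝ), Complex.exp (-(t:ℂ)) * (pw t (p-1) * pw (0+t) (q-1)))) := by
    refine tendsto_integral_filter_of_dominated_convergence
      (fun t => rI (p+q-1).re 1 1 t + rI p.re q.re 1 t) ?_ ?_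
      ((rI_integrable _ _ 1 hpq one_pos).add (rI_integrable _ _ 1 hp one_pos)) ?_
    · refine Eventually.of_forall fun x => Measurable.aestronglyMeasurable ?_
      refine Measurable.mul (by fun_prop) ((pw_measurable _).mul ((pw_measurable _).comp (measurable_const_add x)))
    · filter_upwards [Ioo_mem_nhdsGT (show (0:ℝ) < 1 by norm_num)] with x hx
      obtain ⟨hx, hx1⟩ := hx
      filter_upwards [ae_restrict_mem measurableSet_Ioi] with t ht
      have ht : 0 < t := ht
      rw [norm_mul, norm_mul, pw_norm t ht, pw_norm (x+t) (by linarith), Complex.norm_exp]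
      unfold rI
      simp only [Complex.neg_re, Complex.ofReal_re, Complex.sub_re, Complex.add_re, Complex.one_re,
        one_mul, sub_self, Real.rpow_zero, mul_one]
      rcases le_total (q.re - 1) 0 with h | h
      · have h1 : (x+t) ^ (q.re - 1) ≤ t ^ (q.re-1) :=
          Real.rpow_le_rpow_of_nonpos ht (by linarith) h
        have h2 : t ^ (p.re + q.re - 1 - 1) = t ^ (p.re-1) * t ^ (q.re-1) := by
          rw [← Real.rpow_add ht]; congr 1; ring
        rw [h2]
        have : 0 ≤ Real.exp (-t) * (t ^ (p.re-1) * (1+t) ^ (q.re-1)) := by positivity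
        refine le_add_of_le_of_nonneg ?_ this
        gcongr
      · have h1 : (x+t) ^ (q.re - 1) ≤ (1+t) ^ (q.re-1) :=
          Real.rpow_le_rpow (by linarith) (by linarith) h
        refine le_add_of_nonneg_of_le (by positivity) ?_
        gcongr
    · filter_upwards [ae_restrict_mem measurableSet_Ioi] with t ht
      have ht : 0 < t := ht
      have hc : ContinuousAt (fun x => pw (x+t) (q-1)) 0 := by
        have h1 : HasDerivAt (fun x => pw (x+t) (q-1)) _ 0 :=
          (pw_hasDerivAt (0+t) (by linarith) (q-1)).comp_add_const 0 t
        exact h1.continuousAt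
      refine Tendsto.const_mul _ (Tendsto.const_mul _ ?_)
      exact hc.tendsto.mono_left nhdsWithin_le_nhds
  refine key.congr' ?_
  filter_upwards [self_mem_nhdsWithin] with x hx
  rw [e x hx]

open Filter Topology MeasureTheory Set

/-- second Kummer solution -/
noncomputable def kV (a b : ℂ) (x : ℝ) : ℂ := pw x (1-b) * kf (a-b+1) (2-b) x

theorem kf_down (c d : ℂ) (hd : ∀ n : ℕ, d - 1 + n ≠ 0) (z : ℂ) :
    (d-1) * kf c (d-1) z = (d-1) * kf c d z + z * (c / d * kf (c+1) (d+1) z) := by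
  have hd1 : ∀ n : ℕ, d + n ≠ 0 := fun n => by
    have := hd (n+1); push_cast at this; intro h; apply this; linear_combination h
  have hk : ∀ j : ℕ, (d-1) * kc c (d-1) j = (d-1) * kc c d j + j * kc c d j := by
    intro j
    induction j with
    | zero => simp [kc_zero]
    | succ j ih =>
      rw [kc_succ, kc_succ]
      have h1 := hd j
      have h2 := hd1 j
      have h3 : (j:ℂ) + 1 ≠ 0 := Nat.cast_add_one_ne_zero j
      push_cast
      have : (d-1) * (kc c (d-1) j * ((c + j) / (d-1+j)) / (j+1)) =
        ((d-1) * kc c (d-1) j) * ((c + j) / (d-1+j)) / (j+1) := by ring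
      rw [this, ih]
      field_simp
      ring
  have s1 := ((kf_summable c d z).hasSum).mul_left (d-1)
  have s2 := kf_mul_hasSum c d hd1 z
  have s3 := ((kf_summable c (d-1) z).hasSum).mul_left (d-1)
  refine s3.unique ?_
  have s4 := s1.add s2
  have e : (fun i => (d - 1) * (kc c (d - 1) i * z ^ i)) =
      fun j => (d - 1) * (kc c d j * z ^ j) + j * kc c d j * z ^ j := by
    funext j
    linear_combination (z^j) * hk j
  rw [e]
  exact s4

theorem kV_hasDerivAt (a b : ℂ) (hb : ∀ n : ℤ, b ≠ n) (x : ℝ) (hx : 0 < x) :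
    HasDerivAt (kV a b) ((1-b) * kV (a+1) (b+1) x) x := by
  have h2 : ∀ n : ℕ, 2 - b + n ≠ 0 := fun n h => hb (n+2) (by push_cast; linear_combination -h)
  have h1 : ∀ n : ℕ, 2 - b - 1 + n ≠ 0 := fun n h => hb (n+1) (by push_cast; linear_combination -h)
  refine ((pw_hasDerivAt x hx (1-b)).mul (kf_hasDerivAt_real (a-b+1) (2-b) h2 x)).congr_deriv ?_
  have e := kf_down (a-b+1) (2-b) h1 x
  unfold kV
  have e1 : a + 1 - (b+1) + 1 = a - b + 1 := by ring
  have e2 : 2 - (b+1) = 2 - b - 1 := by ring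
  have e3 : 1 - (b+1) = 1 - b - 1 := by ring
  have e4 : pw x (1-b) = pw x (1-b-1) * x := by
    rw [← pw_one x hx, ← pw_add]; congr 1; ring
  rw [e1, e2, e3, e4]
  linear_combination -pw x (1-b-1) * e

theorem kJ_lin (a b : ℂ) (ha : 0 < a.re) (hb : ∀ n : ℤ, b ≠ n) :
    ∃ α β : ℂ, ∀ x : ℝ, 0 < x → kJ a (b-a) x = α * kf a b x + β * kV a b x := by
  obtain ⟨μ, hμ⟩ : ∃ μ, μ = (b-1)/2 := ⟨_, rfl⟩
  obtain ⟨κ, hκ⟩ : ∃ κ, κ = 1/2 + μ - a := ⟨_, rfl⟩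
  have hbμ : 2*μ+1 = b := by rw [hμ]; ring
  have haμ : 1/2-κ+μ = a := by rw [hκ]; ring
  have hnonint : ∀ n : ℤ, 2*μ ≠ (n:ℂ) := fun n h => hb (n+1) (by push_cast; linear_combination h - hbμ)
  have hμ0 : μ ≠ 0 := fun h => hnonint 0 (by simp [h])
  have hy := wsol_of_kummer κ μ (kJ a (b-a)) (fun x => -kJ (a+1) (b-a) x)
    (fun x => kJ (a+1+1) (b-a) x) (fun x hx => kJ_hasDerivAt a _ x ha hx)
    (fun x hx => by
      have := (kJ_hasDerivAt (a+1) (b-a) x (by simp; linarith) hx).neg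
      rw [neg_neg] at this; exact this)
    (fun x hx => by
      have := kJ_ode a (b-a) x ha hx
      rw [haμ, hbμ]
      linear_combination this)
  obtain ⟨y', hy'⟩ : ∃ y' : ℝ → ℂ, y' = (fun x => wE μ x * ((-1/2 + (1/2+μ)/x) * kJ a (b-a) x + -kJ (a+1) (b-a) x)) := ⟨_, rfl⟩
  rw [← hy'] at hy
  have hM := whittakerM_sol κ μ (nn_of_int hnonint)
  have hN := whittakerM_sol κ (-μ) (nn_of_int (int_neg hnonint))
  obtain ⟨A, hA⟩ : ∃ A : ℂ, A = (wE μ 1 * kJ a (b-a) 1) * whittakerM' κ μ 1 - y' 1 * whittakerM κ μ 1 := ⟨_, rfl⟩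
  obtain ⟨B, hB⟩ : ∃ B : ℂ, B = (wE μ 1 * kJ a (b-a) 1) * whittakerM' κ (-μ) 1 - y' 1 * whittakerM κ (-μ) 1 := ⟨_, rfl⟩
  refine ⟨B/(-2*μ), -A/(-2*μ), fun x hx => ?_⟩
  have w1 := wronsk_const κ μ _ _ _ _ hy hM x 1 hx one_pos
  have hN' : WSol κ μ (whittakerM κ (-μ)) (whittakerM' κ (-μ)) := by
    intro x hx
    have := hN x hx
    unfold wQ at *
    rwa [neg_sq] at this
  have w2 := wronsk_const κ μ _ _ _ _ hy hN' x 1 hx one_pos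
  have w3 := wronsk_MM κ μ hnonint x hx
  rw [← hA] at w1
  rw [← hB] at w2
  have m1 : whittakerM κ μ x = wE μ x * kf a b x := by
    rw [whittakerM_eq, haμ, hbμ]; rfl
  have m2 : whittakerM κ (-μ) x = wE μ x * kV a b x := by
    rw [whittakerM_eq]
    have e1 : 1/2 - κ + -μ = a - b + 1 := by rw [← haμ, ← hbμ]; ring
    have e2 : 2 * -μ + 1 = 2 - b := by rw [← hbμ]; ring
    rw [e1, e2, kV, wE, pw]
    have : Complex.exp ((1/2 + -μ) * (Real.log x : ℂ)) = Complex.exp ((1/2 + μ) * (Real.log x : ℂ)) *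
      Complex.exp ((1-b) * (Real.log x : ℂ)) := by
      rw [← Complex.exp_add]; congr 1; rw [← hbμ]; ring
    rw [this]; ring
  have hw : wE μ x ≠ 0 := by unfold wE; exact mul_ne_zero (Complex.exp_ne_zero _) (Complex.exp_ne_zero _)
  have key : (wE μ x) * ((-2*μ) * kJ a (b-a) x) = wE μ x * (B * kf a b x - A * kV a b x) := by
    rw [← w1, ← w2, ← w3]
    rw [m1, m2]; ring
  have key := mul_left_cancel₀ hw key
  field_simp
  linear_combination -key

theorem pw_tendsto_zero (s : ℂ) (hs : 0 < s.re) : Tendsto (fun x => pw x s) (𝓝[>] 0) (𝓝 0) := by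
  rw [tendsto_zero_iff_norm_tendsto_zero]
  have : Tendsto (fun x : ℝ => x ^ s.re) (𝓝[>] 0) (𝓝 (0 ^ s.re)) :=
    ((Real.continuousAt_rpow_const 0 s.re (Or.inr hs.le)).tendsto).mono_left nhdsWithin_le_nhds
  rw [Real.zero_rpow hs.ne'] at this
  refine this.congr' ?_
  filter_upwards [self_mem_nhdsWithin] with x hx
  rw [pw_norm x hx]

theorem kf_tendsto (a b : ℂ) (hb : ∀ n : ℕ, b + n ≠ 0) :
    Tendsto (fun x : ℝ => kf a b x) (𝓝[>] 0) (𝓝 1) := by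
  have := (kf_hasDerivAt_real a b hb 0).continuousAt.tendsto
  simp only [Complex.ofReal_zero, kf_zero] at this
  exact this.mono_left nhdsWithin_le_nhds

theorem kV_tendsto (a b : ℂ) (hb : ∀ n : ℤ, b ≠ n) (h : b.re < 1) :
    Tendsto (kV a b) (𝓝[>] 0) (𝓝 0) := by
  have h2 : ∀ n : ℕ, 2 - b + n ≠ 0 := fun n h => hb (n+2) (by push_cast; linear_combination -h)
  have := (pw_tendsto_zero (1-b) (by simp; linarith)).mul (kf_tendsto (a-b+1) (2-b) h2)
  rw [zero_mul] at this
  exact this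

theorem kJ_base (a b : ℂ) (ha : 0 < a.re) (hb : ∀ n : ℤ, b ≠ n) (hb1 : -1 < b.re) (hb2 : b.re < 1) :
    ∀ x : ℝ, 0 < x → kJ a (b-a) x = Complex.Gamma a * Complex.Gamma (1-b) / Complex.Gamma (a-b+1) * kf a b x
      + Complex.Gamma (b-1) * kV a b x := by
  obtain ⟨α, β, h⟩ := kJ_lin a b ha hb
  have hbn : ∀ n : ℕ, b + n ≠ 0 := fun n h => hb (-n) (by push_cast; linear_combination h)
  have hbn1 := shift_ne hbn
  have hbn2 := shift_ne hbn1
  have hz1 : ∀ n : ℤ, b + 1 ≠ n := fun n h => hb (n-1) (by push_cast; linear_combination h)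
  have hz2 : ∀ n : ℤ, b + 1 + 1 ≠ n := fun n h => hb (n-2) (by push_cast; linear_combination h)
  have hα : α = Complex.Gamma a * Complex.Gamma (1-b) / Complex.Gamma (a-b+1) := by
    have t1 := kJ_tendsto_zero a (b-a) ha (by simpa using hb2)
    have t2 := ((kf_tendsto a b hbn).const_mul α).add ((kV_tendsto a b hb hb2).const_mul β)
    have t3 := tendsto_nhds_unique (t1.congr' (by
      filter_upwards [self_mem_nhdsWithin] with x hx using h x hx)) t2
    rw [mul_one, mul_zero, add_zero] at t3
    rw [← t3]
    congr 2
    · congr 1; ring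
    · ring
  have hβ : β = Complex.Gamma (b-1) := by
    have d1 : ∀ x : ℝ, 0 < x → -kJ (a+1) (b-a) x = α * (a/b * kf (a+1) (b+1) x) + β * ((1-b) * kV (a+1) (b+1) x) := by
      intro x hx
      have e1 := kJ_hasDerivAt a (b-a) x ha hx
      have e2 := ((kf_hasDerivAt_real a b hbn x).const_mul α).add ((kV_hasDerivAt a b hb x hx).const_mul β)
      refine e1.unique (e2.congr_of_eventuallyEq ?_)
      filter_upwards [Ioi_mem_nhds hx] with z hz using h z hz
    have d2 : ∀ x : ℝ, 0 < x → kJ (a+1+1) (b-a) x = α * (a/b * ((a+1)/(b+1) * kf (a+1+1) (b+1+1) x)) +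
        β * ((1-b) * ((1-(b+1)) * kV (a+1+1) (b+1+1) x)) := by
      intro x hx
      have e1 := (kJ_hasDerivAt (a+1) (b-a) x (by simp; linarith) hx).neg
      have e2 := (((kf_hasDerivAt_real (a+1) (b+1) hbn1 x).const_mul (a/b)).const_mul α).add
        (((kV_hasDerivAt (a+1) (b+1) hz1 x hx).const_mul (1-b)).const_mul β)
      rw [neg_neg] at e1
      refine e1.unique (e2.congr_of_eventuallyEq ?_)
      filter_upwards [Ioi_mem_nhds hx] with z hz using d1 z hz
    have t1 := kJ_tendsto_zero' (a+1+1) (b-a) (by simp; linarith) (by simp; linarith)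
    have es : a+1+1+(b-a)-1 = b+1 := by ring
    rw [es] at t1
    have p0 := pw_tendsto_zero (b+1) (by simp; linarith)
    have t2 := ((p0.mul (kf_tendsto (a+1+1) (b+1+1) hbn2)).const_mul (α*(a/b*((a+1)/(b+1))))).add
      ((kf_tendsto (a-b+1) (-b) (fun n h => hb n (by linear_combination -h))).const_mul (β * ((1-b)*(-b))))
    have t3 := tendsto_nhds_unique (t1.congr' (by
      filter_upwards [self_mem_nhdsWithin] with x hx
      show _ = α*(a/b*((a+1)/(b+1))) * (pw x (b+1) * kf (a+1+1) (b+1+1) x) + β * ((1-b)*(-b)) * kf (a-b+1) (-b) x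
      rw [d2 x hx, kV]
      have e1 : a+1+1-(b+1+1)+1 = a-b+1 := by ring
      have e2 : 2 - (b+1+1) = -b := by ring
      have e3 : pw x (b+1) * pw x (1-(b+1+1)) = 1 := by
        rw [← pw_add, ← pw_zero x]; congr 1; ring
      rw [e1, e2]
      linear_combination (β * ((1-b)*(-b)) * kf (a-b+1) (-b) x) * e3)) t2
    have hb0 : b ≠ 0 := by simpa using hb 0
    have hb1' : b - 1 ≠ 0 := fun h => hb 1 (by push_cast; linear_combination h)
    have g1 := Complex.Gamma_add_one b hb0
    have g2 := Complex.Gamma_add_one (b-1) hb1'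
    rw [sub_add_cancel] at g2
    rw [g1, g2] at t3
    have : b * (b-1) ≠ 0 := mul_ne_zero hb0 hb1'
    refine mul_left_cancel₀ this ?_
    linear_combination -t3
  intro x hx
  rw [h x hx, hα, hβ]

theorem kJ_eq (a b : ℂ) (ha : 0 < a.re) (hb : ∀ n : ℤ, b ≠ n) (hb2 : b.re < 1) :
    ∀ x : ℝ, 0 < x → kJ a (b-a) x = Complex.Gamma a * Complex.Gamma (1-b) / Complex.Gamma (a-b+1) * kf a b x
      + Complex.Gamma (b-1) * kV a b x := by
  obtain ⟨n, hn⟩ := exists_nat_gt (-b.re - 1)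
  replace hn : -1 - (n:ℝ) < b.re := by linarith
  induction n generalizing a b with
  | zero => exact kJ_base a b ha hb (by simpa using hn) hb2
  | succ n ih =>
    by_cases hc : -1 < b.re
    · exact kJ_base a b ha hb hc hb2
    push_cast at hn
    have hbn : ∀ n : ℕ, b + n ≠ 0 := fun n h => hb (-n) (by push_cast; linear_combination h)
    have hz1 : ∀ n : ℤ, b + 1 ≠ n := fun n h => hb (n-1) (by push_cast; linear_combination h)
    have IH := ih (a+1) (b+1) (by simp; linarith) hz1 (by simp; linarith) (by simp; linarith)
    have hb0 : b ≠ 0 := by simpa using hb 0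
    have hb1' : b - 1 ≠ 0 := fun h => hb 1 (by push_cast; linear_combination h)
    have ha0 : a ≠ 0 := by intro h; rw [h] at ha; simp at ha
    have g1 := Complex.Gamma_add_one (-b) (neg_ne_zero.mpr hb0)
    have g2 := Complex.Gamma_add_one (b-1) hb1'
    have g3 := Complex.Gamma_add_one a ha0
    obtain ⟨D, hD⟩ : ∃ D : ℝ → ℂ, D = fun x => kJ a (b-a) x - (Complex.Gamma a * Complex.Gamma (1-b) / Complex.Gamma (a-b+1) * kf a b x
      + Complex.Gamma (b-1) * kV a b x) := ⟨_, rfl⟩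
    have hd : ∀ x : ℝ, 0 < x → HasDerivAt D 0 x := by
      intro x hx
      rw [hD]
      have e := (kJ_hasDerivAt a (b-a) x ha hx).sub
        (((kf_hasDerivAt_real a b hbn x).const_mul (Complex.Gamma a * Complex.Gamma (1-b) / Complex.Gamma (a-b+1))).add
          ((kV_hasDerivAt a b hb x hx).const_mul (Complex.Gamma (b-1))))
      refine e.congr_deriv ?_
      have i := IH x hx
      have e1 : b + 1 - (a+1) = b - a := by ring
      have e2 : 1 - (b+1) = -b := by ring
      have e3 : a+1-(b+1)+1 = a-b+1 := by ring
      have e4 : b + 1 - 1 = b := by ring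
      have e5 : -b + 1 = 1 - b := by ring
      rw [e1, e2, e3, e4] at i
      rw [e5] at g1
      rw [sub_add_cancel] at g2
      rw [i, g3, g1, g2]
      field_simp
      ring
    have t1 := kJ_tendsto_zero a (b-a) ha (by simpa using hb2)
    have t2 := ((kf_tendsto a b hbn).const_mul (Complex.Gamma a * Complex.Gamma (1-b) / Complex.Gamma (a-b+1))).add
      ((kV_tendsto a b hb hb2).const_mul (Complex.Gamma (b-1)))
    have t3 := t1.sub t2
    have e1 : 1 - a - (b-a) = 1 - b := by ring
    have e2 : 1 - (b-a) = a-b+1 := by ring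
    rw [e1, e2, mul_one, mul_zero, add_zero, sub_self] at t3
    intro x hx
    have : Tendsto D (𝓝[>] 0) (𝓝 (D x)) := by
      refine tendsto_const_nhds.congr' ?_
      filter_upwards [self_mem_nhdsWithin] with z hz
      exact const_Ioi D hd x z hx hz
    rw [hD] at this
    have := tendsto_nhds_unique this t3
    exact sub_eq_zero.mp this

open Filter Topology MeasureTheory Set

/-- derivative of Whittaker W -/
noncomputable def whittakerW' (κ μ : ℂ) (x : ℝ) : ℂ :=
  Complex.Gamma (-(2*μ)) / Complex.Gamma (1/2 - κ - μ) * whittakerM' κ μ x +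
  Complex.Gamma (2*μ) / Complex.Gamma (1/2 - κ + μ) * whittakerM' κ (-μ) x

theorem whittakerW_sol (κ μ : ℂ) (h : ∀ n : ℤ, 2*μ ≠ (n:ℂ)) :
    WSol κ μ (whittakerW κ μ) (whittakerW' κ μ) := by
  intro x hx
  obtain ⟨a1, a2⟩ := whittakerM_sol κ μ (nn_of_int h) x hx
  obtain ⟨b1, b2⟩ := whittakerM_sol κ (-μ) (nn_of_int (int_neg h)) x hx
  refine ⟨(a1.const_mul _).add (b1.const_mul _), ((a2.const_mul _).add (b2.const_mul _)).congr_deriv ?_⟩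
  unfold wQ whittakerW
  ring

theorem whittakerW_symm (κ μ : ℂ) (x : ℝ) : whittakerW κ (-μ) x = whittakerW κ μ x := by
  unfold whittakerW
  rw [neg_neg, sub_neg_eq_add, mul_neg, neg_neg, ← sub_eq_add_neg, add_comm]

theorem whittakerW'_symm (κ μ : ℂ) (x : ℝ) : whittakerW' κ (-μ) x = whittakerW' κ μ x := by
  unfold whittakerW'
  rw [neg_neg, sub_neg_eq_add, mul_neg, neg_neg, ← sub_eq_add_neg, add_comm]

theorem wronsk_WM (κ μ : ℂ) (h : ∀ n : ℤ, 2*μ ≠ (n:ℂ)) (x : ℝ) (hx : 0 < x) :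
    whittakerW κ μ x * whittakerM' κ μ x - whittakerW' κ μ x * whittakerM κ μ x =
      2 * μ * Complex.Gamma (2*μ) / Complex.Gamma (1/2 - κ + μ) := by
  have := wronsk_MM κ μ h x hx
  unfold whittakerW whittakerW'
  linear_combination -(Complex.Gamma (2*μ) / Complex.Gamma (1/2 - κ + μ)) * this

theorem whittakerW_rec (κ μ : ℂ) (h : ∀ n : ℤ, 2*μ ≠ (n:ℂ)) (x : ℝ) (hx : 0 < x) :
    whittakerW (κ+1) μ x = (x/2 - κ) * whittakerW κ μ x - x * whittakerW' κ μ x := by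
  have r1 := whittakerM_rec κ μ (nn_of_int h) x hx
  have r2 := whittakerM_rec κ (-μ) (nn_of_int (int_neg h)) x hx
  have g1 := Complex.one_div_Gamma_eq_self_mul_one_div_Gamma_add_one (1/2 - (κ+1) - μ)
  have g2 := Complex.one_div_Gamma_eq_self_mul_one_div_Gamma_add_one (1/2 - (κ+1) + μ)
  have e1 : 1/2 - (κ+1) - μ + 1 = 1/2 - κ - μ := by ring
  have e2 : 1/2 - (κ+1) + μ + 1 = 1/2 - κ + μ := by ring
  rw [e1] at g1
  rw [e2] at g2
  unfold whittakerW whittakerW'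
  rw [div_eq_mul_inv _ (Complex.Gamma (1/2 - (κ+1) - μ)), div_eq_mul_inv _ (Complex.Gamma (1/2 - (κ+1) + μ)), g1, g2]
  linear_combination (-(Complex.Gamma (-(2*μ)) * (Complex.Gamma (1/2 - κ - μ))⁻¹)) * r1 -
    (Complex.Gamma (2*μ) * (Complex.Gamma (1/2 - κ + μ))⁻¹) * r2

theorem whittakerW'_rec (κ μ : ℂ) (h : ∀ n : ℤ, 2*μ ≠ (n:ℂ)) (x : ℝ) (hx : 0 < x) :
    whittakerW' (κ+1) μ x = (1/2 - x * wQ κ μ x) * whittakerW κ μ x +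
      (x/2 - κ - 1) * whittakerW' κ μ x := by
  obtain ⟨a1, a2⟩ := whittakerW_sol κ μ h x hx
  obtain ⟨b1, -⟩ := whittakerW_sol (κ+1) μ h x hx
  have h1 : HasDerivAt (fun x : ℝ => (x:ℂ)) 1 x := Complex.ofRealCLM.hasDerivAt
  have := (((h1.div_const 2).sub_const κ).mul a1).sub (h1.mul a2)
  rw [b1.unique (this.congr_of_eventuallyEq (by
    filter_upwards [Ioi_mem_nhds hx] with z hz using whittakerW_rec κ μ h z hz))]
  ring

/-- rapid decay -/
def Dec (y : ℝ → ℂ) : Prop := ∀ n : ℕ, Tendsto (fun x : ℝ => (x:ℂ)^n * y x) atTop (𝓝 0)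

theorem Dec.add {y z : ℝ → ℂ} (hy : Dec y) (hz : Dec z) : Dec (fun x => y x + z x) := fun n => by
  have := (hy n).add (hz n)
  rw [add_zero] at this
  exact this.congr fun x => by ring

theorem Dec.const {y : ℝ → ℂ} (hy : Dec y) (c : ℂ) : Dec (fun x => c * y x) := fun n => by
  have := (hy n).const_mul c
  rw [mul_zero] at this
  exact this.congr fun x => by ring

theorem Dec.mulx {y : ℝ → ℂ} (hy : Dec y) : Dec (fun x => x * y x) := fun n => by
  exact (hy (n+1)).congr fun x => by ring

theorem Dec.congr {y z : ℝ → ℂ} (hy : Dec y) (h : ∀ x : ℝ, 1 ≤ x → z x = y x) : Dec z := fun n => by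
  refine (hy n).congr' ?_
  filter_upwards [eventually_ge_atTop 1] with x hx
  rw [h x hx]

theorem Dec.bound {y z : ℝ → ℂ} (hy : Dec y) (C : ℝ) (h : ∀ x : ℝ, 1 ≤ x → ‖z x‖ ≤ C * ‖y x‖) :
    Dec z := fun n => by
  have h1 := (tendsto_zero_iff_norm_tendsto_zero.mp (hy n)).const_mul C
  rw [mul_zero] at h1
  refine squeeze_zero_norm' ?_ h1
  filter_upwards [eventually_ge_atTop 1] with x hx
  rw [norm_mul, norm_mul]
  have := h x hx
  calc _ ≤ ‖(x:ℂ)^n‖ * (C * ‖y x‖) := by gcongr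
    _ = _ := by ring

theorem Dec.divx {y : ℝ → ℂ} (hy : Dec y) : Dec (fun x => (x:ℂ)⁻¹ * y x) := by
  refine hy.bound 1 fun x hx => ?_
  rw [norm_mul, norm_inv, Complex.norm_real, Real.norm_of_nonneg (by linarith)]
  gcongr
  exact inv_le_one_of_one_le₀ hx

theorem wE_norm (μ : ℂ) (x : ℝ) (hx : 0 < x) : ‖wE μ x‖ = x ^ (1/2 + μ.re) * Real.exp (-(1/2) * x) := by
  unfold wE
  have := pw_norm x hx (1/2+μ)
  rw [pw] at this
  rw [norm_mul, this, Complex.norm_exp, mul_comm]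
  congr 2
  · simp
  · simp; ring

theorem wE_dec (μ : ℂ) : Dec (wE μ) := fun n => by
  rw [tendsto_zero_iff_norm_tendsto_zero]
  refine (tendsto_rpow_mul_exp_neg_mul_atTop_nhds_zero (n + (1/2 + μ.re)) (1/2) (by norm_num)).congr' ?_
  filter_upwards [eventually_gt_atTop 0] with x hx
  rw [norm_mul, wE_norm μ x hx, norm_pow, Complex.norm_real, Real.norm_of_nonneg hx.le, Real.rpow_add hx,
    Real.rpow_natCast]
  ring

theorem W_decay_base (κ μ : ℂ) (h : ∀ n : ℤ, 2*μ ≠ (n:ℂ)) (hμ : μ.re < 0) (ha : 0 < (1/2 - κ + μ).re) :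
    Dec (whittakerW κ μ) ∧ Dec (whittakerW' κ μ) := by
  obtain ⟨a, haa⟩ : ∃ a, a = 1/2-κ+μ := ⟨_, rfl⟩
  obtain ⟨b, hbb⟩ : ∃ b, b = 2*μ+1 := ⟨_, rfl⟩
  rw [← haa] at ha
  have hb : ∀ n : ℤ, b ≠ n := fun n h' => h (n-1) (by push_cast; linear_combination h' - hbb)
  have hb2 : b.re < 1 := by rw [hbb]; simp; linarith
  have hG : Complex.Gamma a ≠ 0 := Complex.Gamma_ne_zero_of_re_pos ha
  have hW : ∀ x : ℝ, 0 < x → whittakerW κ μ x = (Complex.Gamma a)⁻¹ * (wE μ x * kJ a (b-a) x) := by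
    intro x hx
    have m1 : whittakerM κ μ x = wE μ x * kf a b x := by
      rw [whittakerM_eq, haa, hbb]; rfl
    have m2 : whittakerM κ (-μ) x = wE μ x * kV a b x := by
      rw [whittakerM_eq]
      have e1 : 1/2 - κ + -μ = a - b + 1 := by rw [haa, hbb]; ring
      have e2 : 2 * -μ + 1 = 2 - b := by rw [hbb]; ring
      rw [e1, e2, kV, wE, pw]
      have : Complex.exp ((1/2 + -μ) * (Real.log x : ℂ)) = Complex.exp ((1/2 + μ) * (Real.log x : ℂ)) *
        Complex.exp ((1-b) * (Real.log x : ℂ)) := by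
        rw [← Complex.exp_add]; congr 1; rw [hbb]; ring
      rw [this]; ring
    rw [kJ_eq a b ha hb hb2 x hx]
    unfold whittakerW
    rw [m1, m2]
    have e1 : 1/2 - κ - μ = a - b + 1 := by rw [haa, hbb]; ring
    have e2 : 2 * μ = b - 1 := by rw [hbb]; ring
    have e3 : -(b-1) = 1 - b := by ring
    rw [e1, e2, e3, ← haa]
    field_simp
  have hW' : ∀ x : ℝ, 0 < x → whittakerW' κ μ x = (Complex.Gamma a)⁻¹ * (((-1/2 + (1/2+μ)/x) * wE μ x) * kJ a (b-a) x +
      wE μ x * (-kJ (a+1) (b-a) x)) := by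
    intro x hx
    have d1 := ((wE_hasDerivAt μ x hx).mul (kJ_hasDerivAt a (b-a) x ha hx)).const_mul (Complex.Gamma a)⁻¹
    refine ((whittakerW_sol κ μ h x hx).1).unique (d1.congr_of_eventuallyEq ?_)
    filter_upwards [Ioi_mem_nhds hx] with z hz using hW z hz
  obtain ⟨B, hB⟩ := kJ_bound a (b-a) ha
  obtain ⟨B', hB'⟩ := kJ_bound (a+1) (b-a) (by simp; linarith)
  have d0 : Dec (fun x => wE μ x * kJ a (b-a) x) := (wE_dec μ).bound B fun x hx => by
    rw [norm_mul, mul_comm]; have := hB x hx; gcongr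
  have d1 : Dec (fun x => wE μ x * kJ (a+1) (b-a) x) := (wE_dec μ).bound B' fun x hx => by
    rw [norm_mul, mul_comm]; have := hB' x hx; gcongr
  constructor
  · exact (d0.const (Complex.Gamma a)⁻¹).congr fun x hx => hW x (by linarith)
  · refine ((((d0.const (-1/2)).add (d0.divx.const (1/2+μ))).add (d1.const (-1))).const (Complex.Gamma a)⁻¹).congr fun x hx => ?_
    rw [hW' x (by linarith)]
    ring

theorem W_decay_neg (κ μ : ℂ) (h : ∀ n : ℤ, 2*μ ≠ (n:ℂ)) (hμ : μ.re < 0) :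
    Dec (whittakerW κ μ) ∧ Dec (whittakerW' κ μ) := by
  obtain ⟨n, hn⟩ := exists_nat_gt (-(1/2 - κ + μ).re)
  induction n generalizing κ with
  | zero => exact W_decay_base κ μ h hμ (by simp only [Nat.cast_zero] at hn; linarith)
  | succ n ih =>
    obtain ⟨d0, d1⟩ := ih (κ-1) (by simp at *; linarith)
    have e : κ = (κ-1)+1 := by ring
    constructor
    · refine (((d0.mulx.const (1/2)).add (d0.const (-(κ-1)))).add (d1.mulx.const (-1))).congr fun x hx => ?_
      rw [e, whittakerW_rec (κ-1) μ h x (by linarith)]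
      rw [← e]
      ring
    · refine (((((d0.const (1/2)).add (d0.mulx.const (-1/4))).add (d0.const (κ-1))).add
        (d0.divx.const (-(μ^2-1/4)))).add ((d1.mulx.const (1/2)).add (d1.const (-κ)))).congr fun x hx => ?_
      rw [e, whittakerW'_rec (κ-1) μ h x (by linarith)]
      rw [← e]
      have hxc : (x:ℂ) ≠ 0 := by
        have : x ≠ 0 := by linarith
        exact_mod_cast this
      unfold wQ
      field_simp
      ring

theorem W_decay (κ μ : ℂ) (h : ∀ n : ℤ, 2*μ ≠ (n:ℂ)) (hμ : μ.re ≠ 0) :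
    Dec (whittakerW κ μ) ∧ Dec (whittakerW' κ μ) := by
  rcases lt_or_gt_of_ne hμ with hl | hl
  · exact W_decay_neg κ μ h hl
  · obtain ⟨a, b⟩ := W_decay_neg κ (-μ) (int_neg h) (by simpa using hl)
    exact ⟨a.congr fun x _ => (whittakerW_symm κ μ x).symm, b.congr fun x _ => (whittakerW'_symm κ μ x).symm⟩

open Filter Topology MeasureTheory Set

theorem Dec.tendsto {y : ℝ → ℂ} (h : Dec y) : Tendsto y atTop (𝓝 0) := by
  simpa using h 0

theorem hd_re {y : ℝ → ℂ} {d : ℂ} {x : ℝ} (h : HasDerivAt y d x) :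
    HasDerivAt (fun x => (y x).re) d.re x := by
  exact Complex.reCLM.hasFDerivAt.comp_hasDerivAt x h

theorem hd_im {y : ℝ → ℂ} {d : ℂ} {x : ℝ} (h : HasDerivAt y d x) :
    HasDerivAt (fun x => (y x).im) d.im x := by
  exact Complex.imCLM.hasFDerivAt.comp_hasDerivAt x h

theorem wQ_im (κ : ℝ) (μ : ℂ) (x : ℝ) : (wQ κ μ x).im = (μ^2).im / x^2 := by
  unfold wQ
  have : (1/4 - (κ:ℂ)/x + (μ^2 - 1/4)/(x:ℂ)^2) = (μ^2) / ((x^2:ℝ):ℂ) + ((1/4 - κ/x - (1/4)/x^2 : ℝ):ℂ) := by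
    push_cast; ring
  rw [this, Complex.add_im, Complex.div_ofReal_im, Complex.ofReal_im, add_zero]

theorem W_ne_offaxis (κ : ℝ) (μ : ℂ) (h1 : μ.re ≠ 0) (h2 : μ.im ≠ 0) (x₀ : ℝ) (hx : 0 < x₀) :
    whittakerW κ μ x₀ ≠ 0 := by
  intro h0
  have hnonint : ∀ n : ℤ, 2*μ ≠ (n:ℂ) := by
    intro n h
    have := congrArg Complex.im h
    simp at this
    exact h2 this
  obtain ⟨dy, dy'⟩ := W_decay κ μ hnonint h1
  have hs := whittakerW_sol κ μ hnonint
  obtain ⟨y, hy⟩ : ∃ y, y = whittakerW κ μ := ⟨_, rfl⟩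
  obtain ⟨y', hy'⟩ : ∃ y, y = whittakerW' κ μ := ⟨_, rfl⟩
  rw [← hy] at dy h0 hs
  rw [← hy'] at dy' hs
  obtain ⟨c, hc⟩ : ∃ c, c = (μ^2).im := ⟨_, rfl⟩
  have hc0 : c ≠ 0 := by
    rw [hc, pow_two, Complex.mul_im]
    have := mul_ne_zero h1 h2
    intro h
    apply this
    linarith
  have hg : ∀ x : ℝ, 0 < x → HasDerivAt (fun x => c * ((y x).re * (y' x).im - (y x).im * (y' x).re))
      (c^2/x^2 * ‖y x‖^2) x := by
    intro x hx
    obtain ⟨a, b⟩ := hs x hx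
    have := (((hd_re a).mul (hd_im b)).sub ((hd_im a).mul (hd_re b))).const_mul c
    refine this.congr_deriv ?_
    rw [Complex.mul_im, Complex.mul_re, wQ_im, ← hc, Complex.sq_norm, Complex.normSq_apply]
    ring
  obtain ⟨g, hgd⟩ : ∃ g : ℝ → ℝ, g = (fun x => c * ((y x).re * (y' x).im - (y x).im * (y' x).re)) := ⟨_, rfl⟩
  rw [← hgd] at hg
  have hmono : MonotoneOn g (Ici x₀) := by
    refine monotoneOn_of_deriv_nonneg (convex_Ici _) ?_ ?_ ?_
    · intro x hx'
      exact (hg x (lt_of_lt_of_le hx hx')).continuousAt.continuousWithinAt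
    · intro x hx'
      rw [interior_Ici] at hx'
      exact (hg x (lt_trans hx hx')).differentiableAt.differentiableWithinAt
    · intro x hx'
      rw [interior_Ici] at hx'
      rw [(hg x (lt_trans hx hx')).deriv]
      positivity
  have hlim : Tendsto g atTop (𝓝 0) := by
    rw [hgd]
    have r := (Complex.continuous_re.tendsto 0).comp dy.tendsto
    have i := (Complex.continuous_im.tendsto 0).comp dy.tendsto
    have r' := (Complex.continuous_re.tendsto 0).comp dy'.tendsto
    have i' := (Complex.continuous_im.tendsto 0).comp dy'.tendsto
    simpa using ((r.mul i').sub (i.mul r')).const_mul c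
  have g0 : g x₀ = 0 := by rw [hgd]; simp [h0]
  have gz : ∀ x, x₀ ≤ x → g x = 0 := by
    intro x hx'
    refine le_antisymm ?_ ?_
    · refine ge_of_tendsto hlim ?_
      filter_upwards [eventually_ge_atTop x] with z hz
      exact hmono hx' (le_trans hx' hz) hz
    · rw [← g0]; exact hmono (le_refl x₀) hx' hx'
  have yz : ∀ x, x₀ < x → y x = 0 := by
    intro x hx'
    have e : HasDerivAt g 0 x := (hasDerivAt_const x (0:ℝ)).congr_of_eventuallyEq (by
      filter_upwards [Ioi_mem_nhds hx'] with z hz using gz z (le_of_lt hz))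
    have := (hg x (hx.trans hx')).unique e
    have hxp : 0 < x := hx.trans hx'
    have h3 : c^2/x^2 ≠ 0 := by positivity
    have := (mul_eq_zero.mp this).resolve_left h3
    simpa using this
  have hx1 : x₀ < x₀ + 1 := by linarith
  have yz' : y' (x₀+1) = 0 := by
    refine ((hs (x₀+1) (by linarith)).1).unique ((hasDerivAt_const _ (0:ℂ)).congr_of_eventuallyEq (by
      filter_upwards [Ioi_mem_nhds hx1] with z hz using yz z hz))
  have w := wronsk_WM κ μ hnonint (x₀+1) (by linarith)
  rw [← hy, ← hy', yz _ hx1, yz'] at w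
  have hG : Complex.Gamma (2*μ) ≠ 0 := Complex.Gamma_ne_zero fun m h => hnonint (-m) (by rw [h]; push_cast; ring)
  have hG' : Complex.Gamma (1/2 - κ + μ) ≠ 0 := Complex.Gamma_ne_zero fun m h => by
    have := congrArg Complex.im h
    simp at this
    exact h2 this
  have hμ : μ ≠ 0 := by rintro rfl; simp at h1
  have : 2 * μ * Complex.Gamma (2*μ) / Complex.Gamma (1/2 - κ + μ) ≠ 0 := by
    refine div_ne_zero (mul_ne_zero (mul_ne_zero two_ne_zero hμ) hG) hG'
  apply this
  rw [← w]; ring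

/-- bound constant -/
noncomputable def mK (κ x₀ m : ℝ) : ℝ :=
  (x₀+1)^(1/2+m) * ((2 + (1/2 + (1/2+m)/x₀)*2) * Real.exp ((|1/2-κ+m|+1)*(x₀+1)) +
    2*|1/2-κ+m| * Real.exp ((|1/2-κ+m|+2)*(x₀+1)))

theorem kf_bound_real (a b : ℝ) (hb : 1 ≤ b) (x R : ℝ) (hx : 0 ≤ x) (hxR : x ≤ R) :
    ‖kf a b x‖ ≤ Real.exp ((|a|+1)*R) := by
  refine (kf_norm_le a b x (|a|+1) fun j => ?_).trans ?_
  · have h1 : ((a:ℂ) + j) / ((b:ℂ) + j) = (((a + j)/(b+j) : ℝ) : ℂ) := by push_cast; rfl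
    have hj : (0:ℝ) ≤ j := Nat.cast_nonneg j
    rw [h1, Complex.norm_real, Real.norm_eq_abs, abs_div, abs_of_pos (a := b + j) (by linarith), div_le_iff₀ (by linarith)]
    have := abs_add_le a j
    rw [abs_of_nonneg hj] at this
    have := abs_nonneg a
    nlinarith
  · rw [Complex.norm_real, Real.norm_of_nonneg hx]
    gcongr

theorem W_real_bound (κ x₀ m : ℝ) (hx : 0 < x₀) (hm : 0 < m) (hnonint : ∀ n : ℤ, 2*(m:ℂ) ≠ (n:ℂ))
    (hk : κ^2 + 1/4 ≤ m^2) :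
    ‖2 * (m:ℂ) * Complex.Gamma (2*m) / Complex.Gamma (1/2 - κ + m)‖ ≤ mK κ x₀ m * ‖whittakerW κ m x₀‖ := by
  obtain ⟨dy, dy'⟩ := W_decay κ m hnonint (by simpa using hm.ne')
  have hs := whittakerW_sol κ m hnonint
  have w := wronsk_WM κ m hnonint
  have hM := whittakerM_sol κ m (nn_of_int hnonint)
  obtain ⟨y, hy⟩ : ∃ y, y = whittakerW κ m := ⟨_, rfl⟩
  obtain ⟨y', hy'⟩ : ∃ y, y = whittakerW' κ m := ⟨_, rfl⟩
  obtain ⟨ω, hω⟩ : ∃ ω, ω = 2 * (m:ℂ) * Complex.Gamma (2*m) / Complex.Gamma (1/2 - κ + m) := ⟨_, rfl⟩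
  rw [← hω] at w
  rw [← hy] at dy hs w
  rw [← hy'] at dy' hs w
  rw [← hω, ← hy]
  have hQ : ∀ x : ℝ, 0 < x → ∃ q : ℝ, 0 ≤ q ∧ wQ κ m x = q := by
    intro x hx
    refine ⟨1/4 - κ/x + (m^2-1/4)/x^2, ?_, by unfold wQ; push_cast; ring⟩
    have : 1/4 - κ/x + (m^2-1/4)/x^2 = ((x/2-κ)^2 + (m^2 - 1/4 - κ^2))/x^2 := by
      field_simp; ring
    rw [this]
    have : 0 ≤ m^2 - 1/4 - κ^2 := by linarith
    positivity
  have hg : ∀ x : ℝ, 0 < x → HasDerivAt (fun x => (y x).re * (y' x).re + (y x).im * (y' x).im)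
      (‖y' x‖^2 + (wQ κ m x).re * ‖y x‖^2) x := by
    intro x hx
    obtain ⟨a, b⟩ := hs x hx
    obtain ⟨q, hq, hq'⟩ := hQ x hx
    refine (((hd_re a).mul (hd_re b)).add ((hd_im a).mul (hd_im b))).congr_deriv ?_
    rw [hq', Complex.re_ofReal_mul, Complex.im_ofReal_mul, Complex.sq_norm, Complex.sq_norm, Complex.normSq_apply, Complex.normSq_apply, Complex.ofReal_re]
    ring
  obtain ⟨g, hgd⟩ : ∃ g : ℝ → ℝ, g = (fun x => (y x).re * (y' x).re + (y x).im * (y' x).im) := ⟨_, rfl⟩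
  rw [← hgd] at hg
  have hmono : MonotoneOn g (Ioi 0) := by
    refine monotoneOn_of_deriv_nonneg (convex_Ioi _) ?_ ?_ ?_
    · intro x hx'
      exact (hg x hx').continuousAt.continuousWithinAt
    · intro x hx'
      rw [interior_Ioi] at hx'
      exact (hg x hx').differentiableAt.differentiableWithinAt
    · intro x hx'
      rw [interior_Ioi] at hx'
      rw [(hg x hx').deriv]
      obtain ⟨q, hq, hq'⟩ := hQ x hx'
      rw [hq', Complex.ofReal_re]
      positivity
  have hlim : Tendsto g atTop (𝓝 0) := by
    rw [hgd]
    have r := (Complex.continuous_re.tendsto 0).comp dy.tendsto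
    have i := (Complex.continuous_im.tendsto 0).comp dy.tendsto
    have r' := (Complex.continuous_re.tendsto 0).comp dy'.tendsto
    have i' := (Complex.continuous_im.tendsto 0).comp dy'.tendsto
    simpa using ((r.mul r').add (i.mul i'))
  have gneg : ∀ x, 0 < x → g x ≤ 0 := by
    intro x hx'
    refine ge_of_tendsto hlim ?_
    filter_upwards [eventually_ge_atTop x] with z hz
    exact hmono hx' (lt_of_lt_of_le hx' hz) hz
  have hN : ∀ x : ℝ, 0 < x → HasDerivAt (fun x => ‖y x‖^2) (2 * g x) x := by
    intro x hx
    obtain ⟨a, b⟩ := hs x hx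
    have e : (fun x => ‖y x‖^2) = fun x => (y x).re * (y x).re + (y x).im * (y x).im := by
      funext x; rw [Complex.sq_norm, Complex.normSq_apply]
    rw [e]
    refine (((hd_re a).mul (hd_re a)).add ((hd_im a).mul (hd_im a))).congr_deriv ?_
    rw [hgd]; ring
  have hanti : AntitoneOn (fun x => ‖y x‖^2) (Ioi 0) := by
    refine antitoneOn_of_deriv_nonpos (convex_Ioi _) ?_ ?_ ?_
    · intro x hx'
      exact (hN x hx').continuousAt.continuousWithinAt
    · intro x hx'
      rw [interior_Ioi] at hx'
      exact (hN x hx').differentiableAt.differentiableWithinAt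
    · intro x hx'
      rw [interior_Ioi] at hx'
      rw [(hN x hx').deriv]
      have := gneg x hx'
      linarith
  have hyb : ∀ x, x₀ ≤ x → ‖y x‖ ≤ ‖y x₀‖ := by
    intro x hx'
    have := hanti (show x₀ ∈ Ioi 0 from hx) (show x ∈ Ioi 0 from lt_of_lt_of_le hx hx') hx'
    exact le_of_sq_le_sq this (norm_nonneg _)
  obtain ⟨a, ha⟩ : ∃ a : ℝ, a = 1/2-κ+m := ⟨_, rfl⟩
  obtain ⟨E1, hE1⟩ : ∃ E : ℝ, E = Real.exp ((|a|+1)*(x₀+1)) := ⟨_, rfl⟩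
  obtain ⟨E2, hE2⟩ : ∃ E : ℝ, E = Real.exp ((|a|+2)*(x₀+1)) := ⟨_, rfl⟩
  obtain ⟨P, hP⟩ : ∃ P : ℝ, P = (x₀+1)^(1/2+m) := ⟨_, rfl⟩
  have hE1p : 0 < E1 := by rw [hE1]; positivity
  have hE2p : 0 < E2 := by rw [hE2]; positivity
  have hPp : 0 < P := by rw [hP]; positivity
  have hwE : ∀ x ∈ Icc x₀ (x₀+1), ‖wE m x‖ ≤ P := by
    rintro x ⟨h1, h2⟩
    have hxp : 0 < x := by linarith
    rw [wE_norm _ x hxp, Complex.ofReal_re, hP]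
    calc _ ≤ (x₀+1)^(1/2+m) * 1 := by
          gcongr
          · rw [Real.exp_le_one_iff]; linarith
      _ = _ := by ring
  have hca : (1/2 - (κ:ℂ) + m) = (a:ℂ) := by rw [ha]; push_cast; ring
  have hcb : (2*(m:ℂ)+1) = ((2*m+1:ℝ):ℂ) := by push_cast; ring
  have hk1 : ∀ x ∈ Icc x₀ (x₀+1), ‖kf (1/2-κ+m) (2*m+1) x‖ ≤ E1 := by
    rintro x ⟨h1, h2⟩
    rw [hca, hcb, hE1]
    exact kf_bound_real a _ (by linarith) x _ (by linarith) h2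
  have hk2 : ∀ x ∈ Icc x₀ (x₀+1), ‖kf (1/2-κ+m+1) (2*m+1+1) x‖ ≤ E2 := by
    rintro x ⟨h1, h2⟩
    have e1 : (1/2 - (κ:ℂ) + m + 1) = ((a+1:ℝ):ℂ) := by rw [ha]; push_cast; ring
    have e2 : (2*(m:ℂ)+1+1) = ((2*m+2:ℝ):ℂ) := by push_cast; ring
    rw [e1, e2, hE2]
    refine (kf_bound_real (a+1) _ (by linarith) x _ (by linarith) h2).trans ?_
    have : |a+1| ≤ |a| + 1 := by simpa using abs_add_le a 1
    rw [Real.exp_le_exp]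
    have : (|a+1|+1) ≤ |a|+2 := by linarith
    gcongr
  have hMb : ∀ x ∈ Icc x₀ (x₀+1), ‖whittakerM κ m x‖ ≤ P * E1 := by
    intro x hx'
    have h1 := hwE x hx'
    have h2 := hk1 x hx'
    rw [whittakerM_eq, ← wE, norm_mul]
    gcongr
  have hM'b : ∀ x ∈ Icc x₀ (x₀+1), ‖whittakerM' κ m x‖ ≤ P * ((1/2 + (1/2+m)/x₀) * E1 + |a| * E2) := by
    intro x hx'
    have h1 := hwE x hx'
    have h2 := hk1 x hx'
    have h3 := hk2 x hx'
    have hxp : 0 < x := lt_of_lt_of_le hx hx'.1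
    rw [whittakerM', norm_mul]
    gcongr
    refine (norm_add_le _ _).trans ?_
    rw [norm_mul, norm_mul]
    have h4 : ‖(-1/2 : ℂ) + (1/2+m)/x‖ ≤ 1/2 + (1/2+m)/x₀ := by
      refine (norm_add_le _ _).trans ?_
      have e1 : ‖(-1/2:ℂ)‖ = 1/2 := by norm_num
      have e2 : ((1/2 + (m:ℂ))/x) = (((1/2+m)/x : ℝ):ℂ) := by push_cast; ring
      rw [e1, e2, Complex.norm_real, Real.norm_of_nonneg (by positivity)]
      gcongr
      exact hx'.1
    have h5 : ‖(1/2 - (κ:ℂ) + m) / (2*m+1)‖ ≤ |a| := by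
      rw [hca, hcb, ← Complex.ofReal_div, Complex.norm_real, Real.norm_eq_abs, abs_div]
      refine div_le_self (abs_nonneg _) ?_
      rw [abs_of_pos (by linarith)]; linarith
    gcongr
  have hmv := (convex_Icc x₀ (x₀+1)).norm_image_sub_le_of_norm_hasDerivWithin_le
    (f := fun x : ℝ => y x * whittakerM κ m x + ω * x) (f' := fun x => 2 * (y x * whittakerM' κ m x))
    (C := 2 * (‖y x₀‖ * (P * ((1/2 + (1/2+m)/x₀) * E1 + |a| * E2)))) (x := x₀) (y := x₀+1)
    (fun x hx' => by
      have hxp : 0 < x := lt_of_lt_of_le hx hx'.1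
      have h1 : HasDerivAt (fun x : ℝ => (x:ℂ)) 1 x := Complex.ofRealCLM.hasDerivAt
      refine ((((hs x hxp).1.mul (hM x hxp).1).add (h1.const_mul ω)).congr_deriv ?_).hasDerivWithinAt
      linear_combination -(w x hxp))
    (fun x hx' => by
      have h1 := hyb x hx'.1
      have h2 := hM'b x hx'
      rw [norm_mul, norm_mul, Complex.norm_ofNat]
      gcongr)
    (by constructor <;> linarith) (by constructor <;> linarith)
  have hm1 := hMb x₀ (by constructor <;> linarith)
  have hm2 := hMb (x₀+1) (by constructor <;> linarith)
  have hy2 := hyb (x₀+1) (by linarith)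
  have n1 : ‖x₀ + 1 - x₀‖ = 1 := by simp
  rw [n1, mul_one] at hmv
  have eω : ω = ((fun x : ℝ => y x * whittakerM κ m x + ω * x) (x₀+1) - (fun x : ℝ => y x * whittakerM κ m x + ω * x) x₀)
    - y (x₀+1) * whittakerM κ m (x₀+1) + y x₀ * whittakerM κ m x₀ := by
    push_cast; ring
  have : ‖ω‖ ≤ 2 * (‖y x₀‖ * (P * ((1/2 + (1/2+m)/x₀) * E1 + |a| * E2))) + ‖y x₀‖ * (P * E1) + ‖y x₀‖ * (P * E1) := by
    rw [eω]
    refine (norm_add_le _ _).trans (add_le_add ((norm_sub_le _ _).trans (add_le_add hmv ?_)) ?_)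
    · rw [norm_mul]; gcongr
    · rw [norm_mul]; gcongr
  refine this.trans (le_of_eq ?_)
  unfold mK
  rw [← ha, ← hE1, ← hE2, ← hP]
  ring

theorem F_even (κ x₀ : ℝ) (F : ℂ → ℂ) (hF : Differentiable ℂ F)
    (hFW : ∀ μ : ℂ, (∀ n : ℤ, 2*μ ≠ (n:ℂ)) → F μ = whittakerW (κ:ℂ) μ x₀) (μ : ℂ) :
    F (-μ) = F μ := by
  have hd : Dense ((Complex.im) ⁻¹' ({0}ᶜ)) := (dense_compl_singleton (0:ℝ)).preimage Complex.isOpenMap_im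
  have := Continuous.ext_on hd (hF.continuous.comp continuous_neg) hF.continuous (by
    intro z hz
    have hnonint : ∀ n : ℤ, 2*z ≠ (n:ℂ) := by
      intro n h
      have := congrArg Complex.im h
      simp at this
      exact hz this
    show F (-z) = F z
    rw [hFW z hnonint, hFW (-z) (int_neg hnonint), whittakerW_symm])
  exact congrFun this μ

theorem F_real_ne (κ x₀ : ℝ) (hx : 0 < x₀) (F : ℂ → ℂ) (hF : Differentiable ℂ F)
    (hFW : ∀ μ : ℂ, (∀ n : ℤ, 2*μ ≠ (n:ℂ)) → F μ = whittakerW (κ:ℂ) μ x₀) (m : ℝ)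
    (hm : |κ| + 1 < m) : F m ≠ 0 := by
  have hκ := abs_nonneg κ
  have hκ' := le_abs_self κ
  have key : ‖Complex.Gamma (2*m+1) / Complex.Gamma (1/2 - κ + m)‖ ≤ mK κ x₀ m * ‖F m‖ := by
    have hcl := (dense_irrational).open_subset_closure_inter (isOpen_Ioi (a := |κ|+1)) hm
    have hne := mem_closure_iff_nhdsWithin_neBot.mp hcl
    have hnp : ∀ (z : ℂ), 0 < z.re → ∀ n : ℕ, z ≠ -n := fun z hz n h => by
      rw [h] at hz; simp at hz
      have : (0:ℝ) ≤ n := Nat.cast_nonneg n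
      linarith
    have c1 : ContinuousAt (fun t : ℝ => ‖Complex.Gamma (2*t+1) / Complex.Gamma (1/2 - κ + t)‖) m := by
      have d1 : ContinuousAt Complex.Gamma (2*(m:ℂ)+1) :=
        (Complex.differentiableAt_Gamma _ (hnp _ (by simp; linarith))).continuousAt
      have hp2 : 0 < (1/2 - (κ:ℂ) + m).re := by simp; linarith
      have d2 : ContinuousAt Complex.Gamma (1/2 - (κ:ℂ) + m) :=
        (Complex.differentiableAt_Gamma _ (hnp _ hp2)).continuousAt
      refine ContinuousAt.norm (ContinuousAt.div ?_ ?_ (Complex.Gamma_ne_zero_of_re_pos hp2))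
      · exact ContinuousAt.comp (f := fun t : ℝ => 2*(t:ℂ)+1) d1 (by fun_prop)
      · exact ContinuousAt.comp (f := fun t : ℝ => 1/2 - (κ:ℂ) + t) d2 (by fun_prop)
    have c2 : ContinuousAt (fun t : ℝ => mK κ x₀ t * ‖F t‖) m := by
      have := hF.continuous
      have hx1 : x₀ + 1 ≠ 0 := by linarith
      refine ContinuousAt.mul ?_ (by fun_prop)
      unfold mK
      refine ContinuousAt.mul ?_ (by fun_prop)
      refine ContinuousAt.rpow continuousAt_const (by fun_prop) (Or.inl hx1)
    refine le_of_tendsto_of_tendsto (c1.mono_left nhdsWithin_le_nhds) (c2.mono_left nhdsWithin_le_nhds) (b := 𝓝[Ioi (|κ|+1) ∩ {x | Irrational x}] m) ?_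
    filter_upwards [self_mem_nhdsWithin] with t ht
    obtain ⟨ht1, ht2⟩ := ht
    have ht1 : |κ|+1 < t := ht1
    have ht2 : Irrational t := ht2
    have hnonint : ∀ n : ℤ, 2*(t:ℂ) ≠ (n:ℂ) := by
      intro n h
      apply ht2
      refine ⟨n/2, ?_⟩
      have : 2 * t = n := by exact_mod_cast h
      push_cast
      linarith
    have := W_real_bound κ x₀ t hx (by linarith) hnonint (by
      have h1 : κ^2 = |κ|^2 := (sq_abs κ).symm
      nlinarith)
    rw [hFW t hnonint]
    rw [Complex.Gamma_add_one (2*(t:ℂ)) (by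
      have := hnonint 0
      simpa using this)]
    exact this
  intro h0
  rw [h0, norm_zero, mul_zero] at key
  have hp2 : 0 < (1/2 - (κ:ℂ) + m).re := by simp; linarith
  have hp1 : 0 < (2*(m:ℂ)+1).re := by simp; linarith
  have := div_ne_zero (Complex.Gamma_ne_zero_of_re_pos hp1) (Complex.Gamma_ne_zero_of_re_pos hp2)
  exact this (norm_le_zero_iff.mp key)

theorem F_zeros (κ x₀ : ℝ) (hx : 0 < x₀) (F : ℂ → ℂ) (hF : Differentiable ℂ F)
    (hFW : ∀ μ : ℂ, (∀ n : ℤ, 2*μ ≠ (n:ℂ)) → F μ = whittakerW (κ:ℂ) μ x₀) (ρ : ℂ) (h : F ρ = 0) :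
    ρ.re = 0 ∨ (ρ.im = 0 ∧ |ρ.re| ≤ |κ| + 1) := by
  by_contra hc
  push Not at hc
  obtain ⟨h1, h2⟩ := hc
  by_cases h3 : ρ.im = 0
  · have h4 := h2 h3
    have e : ρ = (ρ.re : ℂ) := by apply Complex.ext <;> simp [h3]
    rcases lt_or_gt_of_ne h1 with hl | hl
    · rw [abs_of_neg hl] at h4
      refine F_real_ne κ x₀ hx F hF hFW (-ρ.re) h4 ?_
      push_cast
      rw [F_even κ x₀ F hF hFW, ← e, h]
    · rw [abs_of_pos hl] at h4
      refine F_real_ne κ x₀ hx F hF hFW (ρ.re) h4 ?_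
      rw [← e, h]
  · have hnonint : ∀ n : ℤ, 2*ρ ≠ (n:ℂ) := by
      intro n h
      have := congrArg Complex.im h
      simp at this
      exact h3 this
    rw [hFW ρ hnonint] at h
    exact W_ne_offaxis κ ρ h1 h3 x₀ hx h

open Filter Topology MeasureTheory Set

/-- main Stirling term -/
noncomputable def sP (z : ℂ) : ℂ := (z - 1/2) * Complex.log z - z

/-- increment of the Stirling remainder -/
noncomputable def sh (z : ℂ) : ℂ := (z + 1/2) * Complex.log (1 + z⁻¹) - 1

/-- Stirling remainder -/
noncomputable def sH (z : ℂ) : ℂ := ∑' k : ℕ, sh (z + k)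

theorem log_succ (z : ℂ) (hz : z.im < 0) :
    Complex.log (z+1) = Complex.log z + Complex.log (1 + z⁻¹) := by
  have hz0 : z ≠ 0 := by rintro rfl; simp at hz
  have him : 0 < (1 + z⁻¹).im := by
    rw [Complex.add_im, Complex.one_im, Complex.inv_im, zero_add]
    have : 0 < Complex.normSq z := Complex.normSq_pos.mpr hz0
    apply div_pos <;> linarith
  have h0 : (1 + z⁻¹) ≠ 0 := by intro h; rw [h] at him; simp at him
  have e : z + 1 = z * (1 + z⁻¹) := by field_simp
  rw [e, Complex.log_mul hz0 h0]
  have a1 : z.arg < 0 := Complex.arg_neg_iff.mpr hz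
  have a2 := Complex.neg_pi_lt_arg z
  have a3 : 0 ≤ (1+z⁻¹).arg := Complex.arg_nonneg_iff.mpr him.le
  have a4 := Complex.arg_le_pi (1+z⁻¹)
  constructor <;> linarith

theorem sP_succ (z : ℂ) (hz : z.im < 0) : sh z = sP (z+1) - sP z - Complex.log z := by
  unfold sh sP
  rw [log_succ z hz]
  ring

theorem sh_bound (z : ℂ) (hz : 2 ≤ ‖z‖) : ‖sh z‖ ≤ 2 / ‖z‖^2 := by
  have hz0 : z ≠ 0 := by rintro rfl; simp at hz; linarith
  obtain ⟨w, hw⟩ : ∃ w, w = z⁻¹ := ⟨_, rfl⟩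
  have hw0 : w ≠ 0 := by rw [hw]; exact inv_ne_zero hz0
  have hzw : z = w⁻¹ := by rw [hw, inv_inv]
  have hwn : ‖w‖ ≤ 1/2 := by
    rw [hw, norm_inv, one_div]
    gcongr
  have h1 := Complex.norm_log_sub_logTaylor_le 2 (z := w) (by linarith)
  have e : Complex.logTaylor (2+1) w = w - w^2/2 := by
    simp [Complex.logTaylor_succ, Complex.logTaylor_zero]
    ring
  rw [e] at h1
  have h2 : ‖Complex.log (1+w) - (w - w^2/2)‖ ≤ ‖w‖^3 * (2/3) := by
    refine h1.trans ?_
    have : (1 - ‖w‖)⁻¹ ≤ 2 := by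
      rw [inv_le_comm₀ (by linarith) (by norm_num)]; linarith
    have h3 : ((2:ℕ):ℝ) + 1 = 3 := by norm_num
    rw [h3]
    have h4 : 0 ≤ ‖w‖^3 := by positivity
    norm_num
    nlinarith
  have e2 : sh z = -w^2/4 + (w⁻¹ + 1/2) * (Complex.log (1+w) - (w - w^2/2)) := by
    unfold sh
    rw [hzw, inv_inv]
    field_simp
    ring
  have e3 : 2 / ‖z‖^2 = 2 * ‖w‖^2 := by rw [hw, norm_inv, inv_pow]; rfl
  rw [e2, e3]
  refine (norm_add_le _ _).trans ?_
  have n1 : ‖-w^2/4‖ = ‖w‖^2/4 := by rw [norm_div, norm_neg, norm_pow]; norm_num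
  have n2 : ‖w⁻¹ + 1/2‖ ≤ ‖w‖⁻¹ + 1/2 := by
    refine (norm_add_le _ _).trans ?_
    rw [norm_inv]; norm_num
  have hp : 0 < ‖w‖ := norm_pos_iff.mpr hw0
  rw [n1, norm_mul]
  calc _ ≤ ‖w‖^2/4 + (‖w‖⁻¹ + 1/2) * (‖w‖^3 * (2/3)) := by gcongr
    _ = ‖w‖^2/4 + (‖w‖^2 * (2/3) + ‖w‖^2 * ‖w‖ /3) := by field_simp
    _ ≤ 2 * ‖w‖^2 := by nlinarith [sq_nonneg ‖w‖]

theorem norm_lower (r : ℝ) (hr : 0 ≤ r) (z : ℂ) (h1 : -r < z.re) (h2 : z.im < -2) (k : ℕ) :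
    2 ≤ ‖z + k‖ ∧ (k+1)/(r+2) ≤ ‖z + k‖ := by
  have a1 : 2 ≤ ‖z + k‖ := by
    have := Complex.abs_im_le_norm (z + k)
    rw [Complex.add_im, Complex.natCast_im, add_zero, abs_of_neg (by linarith)] at this
    linarith
  refine ⟨a1, ?_⟩
  have a2 : (k:ℝ) - r ≤ ‖z + k‖ := by
    have := Complex.re_le_norm (z+k)
    rw [Complex.add_re, Complex.natCast_re] at this
    linarith
  by_cases hc : (k:ℝ) + 1 ≤ 2*(r+2)
  · refine le_trans ?_ a1
    rw [div_le_iff₀ (by linarith)]; linarith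
  · refine le_trans ?_ a2
    push Not at hc
    rw [div_le_iff₀ (by linarith)]
    nlinarith

/-- majorant -/
noncomputable def su (r : ℝ) (k : ℕ) : ℝ := 2*(r+2)^2 * (1/((k:ℝ)+1)^2)

theorem su_summable (r : ℝ) : Summable (su r) := by
  have := (summable_nat_add_iff 1).mpr (Real.summable_one_div_nat_pow.mpr (one_lt_two))
  have h := this.mul_left (2*(r+2)^2)
  refine h.congr fun k => ?_
  unfold su; push_cast; rfl

theorem sh_le (r : ℝ) (hr : 0 ≤ r) (z : ℂ) (h1 : -r < z.re) (h2 : z.im < -2) (k : ℕ) :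
    ‖sh (z + k)‖ ≤ su r k := by
  obtain ⟨a, b⟩ := norm_lower r hr z h1 h2 k
  refine (sh_bound _ a).trans ?_
  have hp : (0:ℝ) < (k+1)/(r+2) := by positivity
  calc 2 / ‖z+k‖^2 ≤ 2 / ((k+1)/(r+2))^2 := by gcongr
    _ = su r k := by unfold su; field_simp

theorem slit_of_im {z : ℂ} (h : z.im ≠ 0) : z ∈ Complex.slitPlane := Or.inr h

theorem sh_diff (z : ℂ) (hz : z.im < 0) : DifferentiableAt ℂ sh z := by
  have hz0 : z ≠ 0 := by rintro rfl; simp at hz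
  have him : 0 < (1 + z⁻¹).im := by
    rw [Complex.add_im, Complex.one_im, Complex.inv_im, zero_add]
    have : 0 < Complex.normSq z := Complex.normSq_pos.mpr hz0
    apply div_pos <;> linarith
  unfold sh
  have : DifferentiableAt ℂ (fun z : ℂ => Complex.log (1 + z⁻¹)) z :=
    DifferentiableAt.clog ((differentiableAt_inv hz0).const_add 1) (slit_of_im him.ne')
  fun_prop

theorem sreg_open (r : ℝ) : IsOpen {z : ℂ | -r < z.re ∧ z.im < -2} :=
  (isOpen_lt continuous_const Complex.continuous_re).inter (isOpen_lt Complex.continuous_im continuous_const)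

theorem sH_diffOn (r : ℝ) (hr : 0 ≤ r) : DifferentiableOn ℂ sH {z : ℂ | -r < z.re ∧ z.im < -2} := by
  refine Complex.differentiableOn_tsum_of_summable_norm (su_summable r) (fun k => ?_) (sreg_open r) (fun k z hz => ?_)
  · intro z hz
    have h2 : z.im < -2 := hz.2
    have : DifferentiableAt ℂ (fun z : ℂ => sh (z + k)) z :=
      DifferentiableAt.comp z (f := fun z : ℂ => z + k) (sh_diff _ (by simp; linarith)) (by fun_prop)
    exact this.differentiableWithinAt
  · exact sh_le r hr z hz.1 hz.2 k

theorem sH_bound (r : ℝ) (hr : 0 ≤ r) (z : ℂ) (h1 : -r < z.re) (h2 : z.im < -2) :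
    ‖sH z‖ ≤ ∑' k, su r k :=
  tsum_of_norm_bounded (su_summable r).hasSum (sh_le r hr z h1 h2)

theorem sum_sh (z : ℂ) (hz : z.im < 0) (n : ℕ) : ∑ k ∈ Finset.range n, sh (z + k) =
    sP (z+n) - sP z - ∑ k ∈ Finset.range n, Complex.log (z + k) := by
  induction n with
  | zero => simp
  | succ n ih =>
    rw [Finset.sum_range_succ, ih, Finset.sum_range_succ, sP_succ (z+n) (by simpa using hz)]
    push_cast
    rw [add_assoc z (n:ℂ) 1]
    ring

theorem stir_real : Tendsto (fun n : ℕ => ((Nat.factorial n : ℂ)) * Complex.exp (n - (n+1/2) * Real.log n)) atTop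
    (𝓝 ((Real.sqrt (2*Real.pi) : ℝ):ℂ)) := by
  have h := (Stirling.tendsto_stirlingSeq_sqrt_pi).const_mul (Real.sqrt 2)
  rw [← Real.sqrt_mul (by norm_num)] at h
  have h' := (Complex.continuous_ofReal.tendsto _).comp h
  refine h'.congr' ?_
  filter_upwards [eventually_gt_atTop 0] with n hn
  have hn' : (0:ℝ) < n := by exact_mod_cast hn
  have e1 : Real.sqrt (2*n) = Real.sqrt 2 * Real.exp (1/2 * Real.log n) := by
    rw [Real.sqrt_mul (by norm_num)]
    congr 1
    rw [Real.sqrt_eq_rpow, Real.rpow_def_of_pos hn']; congr 1; ring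
  have e2 : ((n:ℝ) / Real.exp 1)^n = Real.exp (n * (Real.log n - 1)) := by
    rw [Real.exp_nat_mul, Real.exp_sub, Real.exp_log hn']
  have e3 : Real.sqrt 2 * Stirling.stirlingSeq n = (Nat.factorial n : ℝ) * Real.exp (n - (n+1/2) * Real.log n) := by
    unfold Stirling.stirlingSeq
    rw [e1, e2]
    have e4 : Real.exp (n - (n+1/2) * Real.log n) = (Real.exp (1/2 * Real.log n) * Real.exp (n * (Real.log n - 1)))⁻¹ := by
      rw [← Real.exp_add, ← Real.exp_neg]; congr 1; ring
    rw [e4]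
    have : Real.sqrt 2 ≠ 0 := by positivity
    field_simp
  simp only [Function.comp]
  rw [e3]
  push_cast
  rfl

theorem gamma_stirling (z : ℂ) (hz : z.im < -2) :
    Complex.Gamma z = (Real.sqrt (2*Real.pi) : ℝ) * Complex.exp (sP z + sH z) := by
  have hr : (0:ℝ) ≤ |z.re| + 1 := by positivity
  have hre : -(|z.re|+1) < z.re := by have := neg_abs_le z.re; linarith
  have hsum : Summable (fun k : ℕ => sh (z+k)) :=
    Summable.of_norm_bounded (su_summable (|z.re|+1)) (sh_le _ hr z hre hz)
  have t1 : Tendsto (fun n : ℕ => Complex.exp (sP z + ∑ k ∈ Finset.range (n+1), sh (z+k))) atTop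
      (𝓝 (Complex.exp (sP z + sH z))) := by
    have := (hsum.hasSum.tendsto_sum_nat.comp (tendsto_add_atTop_nat 1)).const_add (sP z)
    exact (Complex.continuous_exp.tendsto _).comp this
  have hg : Tendsto (fun n : ℕ => (z+1)/n) atTop (𝓝 0) := by
    have := (tendsto_inv_atTop_nhds_zero_nat (𝕜 := ℂ)).const_mul (z+1)
    simpa [div_eq_mul_inv] using this
  have hl1 : Tendsto (fun n : ℕ => (n:ℂ) * Complex.log (1 + (z+1)/n)) atTop (𝓝 (z+1)) := by
    refine Complex.tendsto_nat_mul_log_one_add_of_tendsto ?_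
    refine tendsto_const_nhds.congr' ?_
    filter_upwards [eventually_gt_atTop 0] with n hn
    have hn' : (n:ℂ) ≠ 0 := by exact_mod_cast hn.ne'
    field_simp
  have hl2 : Tendsto (fun n : ℕ => (z+1/2) * Complex.log (1 + (z+1)/n)) atTop (𝓝 0) := by
    have c : ContinuousAt Complex.log (1+0) := continuousAt_clog (by simp)
    have := ((c.tendsto.comp (hg.const_add 1))).const_mul (z+1/2)
    simpa using this
  have t2 : Tendsto (fun n : ℕ => Complex.exp (-((n:ℂ) * Complex.log (1 + (z+1)/n) + (z+1/2) * Complex.log (1 + (z+1)/n)) + z + 1))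
      atTop (𝓝 1) := by
    have := (((hl1.add hl2).neg).add_const z).add_const 1
    have h2 := (Complex.continuous_exp.tendsto _).comp this
    have e : -(z + 1 + 0) + z + 1 = 0 := by ring
    rw [e, Complex.exp_zero] at h2
    exact h2
  have t3 := (stir_real.mul t2).mul t1
  rw [mul_one] at t3
  refine tendsto_nhds_unique (Complex.GammaSeq_tendsto_Gamma z) (t3.congr' ?_)
  filter_upwards [eventually_gt_atTop 0] with n hn
  have hn' : (n:ℂ) ≠ 0 := by exact_mod_cast hn.ne'
  have hnr : (0:ℝ) < n := by exact_mod_cast hn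
  rw [sum_sh z (by linarith)]
  unfold Complex.GammaSeq
  have hne : ∀ k : ℕ, z + k ≠ 0 := by
    intro k h
    have := congrArg Complex.im h
    simp at this
    linarith
  have hprod : Complex.exp (∑ k ∈ Finset.range (n+1), Complex.log (z + k)) = ∏ j ∈ Finset.range (n + 1), (z + ↑j) := by
    rw [Complex.exp_sum]
    exact Finset.prod_congr rfl fun k _ => Complex.exp_log (hne k)
  have hpn : ∏ j ∈ Finset.range (n + 1), (z + (j:ℂ)) ≠ 0 := Finset.prod_ne_zero_iff.mpr fun k _ => hne k
  have hpow : (n:ℂ)^z = Complex.exp (z * Real.log n) := by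
    rw [Complex.cpow_def_of_ne_zero hn', Complex.ofReal_log hnr.le, mul_comm]; simp
  have hlog : Complex.log (z + ((n+1:ℕ):ℂ)) = Real.log n + Complex.log (1 + (z+1)/n) := by
    have h1 : 1 + (z+1)/n ≠ 0 := by
      intro h
      apply hne (n+1)
      push_cast
      field_simp at h
      linear_combination h
    rw [← Complex.log_ofReal_mul hnr h1]
    congr 1
    push_cast
    field_simp
    ring
  have hfin : Complex.exp (n - (n+1/2) * Real.log n) *
      Complex.exp (-((n:ℂ) * Complex.log (1 + (z+1)/n) + (z+1/2) * Complex.log (1 + (z+1)/n)) + z + 1) *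
      Complex.exp (sP z + (sP (z + ((n+1:ℕ):ℂ)) - sP z - ∑ k ∈ Finset.range (n+1), Complex.log (z + k))) =
      Complex.exp (z * Real.log n) * (Complex.exp (∑ k ∈ Finset.range (n+1), Complex.log (z + k)))⁻¹ := by
    rw [← Complex.exp_neg, ← Complex.exp_add, ← Complex.exp_add, ← Complex.exp_add]
    congr 1
    have : sP (z + ((n+1:ℕ):ℂ)) = (z + n + 1/2) * (Real.log n + Complex.log (1 + (z+1)/n)) - (z + n + 1) := by
      rw [sP, hlog]; push_cast; ring
    rw [this]
    ring
  rw [hpow, ← hprod]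
  linear_combination (Nat.factorial n : ℂ) * hfin

theorem sH_props (r : ℝ) (hr : 0 ≤ r) : ∃ B : ℝ, 0 ≤ B ∧ ∀ z : ℂ, -r < z.re → z.im < -3 →
    DifferentiableAt ℂ sH z ∧ ‖sH z‖ ≤ B ∧ ‖deriv sH z‖ ≤ B := by
  refine ⟨∑' k, su (r+1) k, tsum_nonneg fun k => by unfold su; positivity, fun z h1 h2 => ?_⟩
  have hr1 : 0 ≤ r + 1 := by linarith
  have hd := sH_diffOn (r+1) hr1
  have hsub : Metric.closedBall z 1 ⊆ {z : ℂ | -(r+1) < z.re ∧ z.im < -2} := by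
    intro w hw
    rw [Metric.mem_closedBall, dist_eq_norm] at hw
    have a := (Complex.abs_re_le_norm (w - z)).trans hw
    have b := (Complex.abs_im_le_norm (w - z)).trans hw
    rw [abs_le, Complex.sub_re] at a
    rw [abs_le, Complex.sub_im] at b
    constructor <;> linarith
  refine ⟨hd.differentiableAt ((sreg_open _).mem_nhds ⟨by linarith, by linarith⟩), sH_bound (r+1) hr1 z (by linarith) (by linarith), ?_⟩
  have hc : DiffContOnCl ℂ sH (Metric.ball z 1) := by
    refine DifferentiableOn.diffContOnCl ?_
    rw [closure_ball z one_ne_zero]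
    exact hd.mono hsub
  have := Complex.norm_deriv_le_of_forall_mem_sphere_norm_le one_pos hc (C := ∑' k, su (r+1) k) (fun w hw => by
    have := hsub (Metric.sphere_subset_closedBall hw)
    exact sH_bound (r+1) hr1 w this.1 this.2)
  simpa using this

open Filter Topology MeasureTheory Set

/-- strip -/
def strip : Set ℂ := {μ : ℂ | -(1/4) < μ.re ∧ μ.re < 1/4 ∧ 1 < μ.im}

theorem strip_open : IsOpen strip :=
  (isOpen_lt continuous_const Complex.continuous_re).inter
    ((isOpen_lt Complex.continuous_re continuous_const).inter (isOpen_lt continuous_const Complex.continuous_im))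

theorem strip_ratio (s : ℂ) (μ : ℂ) (h : μ ∈ strip) (j : ℕ) :
    ‖(s + μ + j) / (2*μ + 1 + j)‖ ≤ ‖s‖ + 3 := by
  obtain ⟨h1, h2, h3⟩ := h
  have b1 : (j:ℝ) ≤ ‖2*μ+1+j‖ := by
    have := Complex.re_le_norm (2*μ+1+j)
    simp at this
    linarith
  have b2 : 2 * μ.im ≤ ‖2*μ+1+j‖ := by
    have := Complex.abs_im_le_norm (2*μ+1+j)
    have h4 := le_abs_self (2*μ+1+j).im
    simp at this h4
    linarith
  have b3 : ‖μ‖ ≤ 1/4 + μ.im := by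
    have := Complex.norm_le_abs_re_add_abs_im μ
    rw [abs_of_pos (a := μ.im) (by linarith)] at this
    have h5 : |μ.re| ≤ 1/4 := abs_le.mpr ⟨by linarith, by linarith⟩
    linarith
  have b4 : ‖s + μ + j‖ ≤ ‖s‖ + ‖μ‖ + j := by
    refine (norm_add_le _ _).trans ?_
    rw [Complex.norm_natCast]
    gcongr
    exact norm_add_le _ _
  have hs := norm_nonneg s
  rw [norm_div, div_le_iff₀ (by linarith)]
  nlinarith

theorem strip_ne (μ : ℂ) (h : μ ∈ strip) (n : ℕ) : 2*μ + 1 + n ≠ 0 := by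
  intro h0
  have := congrArg Complex.im h0
  simp at this
  have := h.2.2
  linarith

theorem kfm_diffOn (s : ℂ) (x₀ : ℝ) :
    DifferentiableOn ℂ (fun μ => kf (s + μ) (2*μ+1) x₀) strip := by
  refine Complex.differentiableOn_tsum_of_summable_norm
    (Real.summable_pow_div_factorial ((‖s‖+3) * |x₀|)) (fun j => ?_) strip_open (fun j μ hμ => ?_)
  · intro μ hμ
    refine DifferentiableAt.differentiableWithinAt ?_
    refine DifferentiableAt.mul ?_ (differentiableAt_const _)
    unfold kc
    refine DifferentiableAt.div ?_ ?_ ?_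
    · exact ((Polynomial.differentiable _).comp (by fun_prop : Differentiable ℂ fun μ : ℂ => s + μ)).differentiableAt
    · refine DifferentiableAt.mul ?_ (differentiableAt_const _)
      exact ((Polynomial.differentiable _).comp (by fun_prop : Differentiable ℂ fun μ : ℂ => 2*μ+1)).differentiableAt
    · refine mul_ne_zero (poch_ne _ (strip_ne μ hμ) j) ?_
      exact_mod_cast (Nat.factorial_ne_zero j)
  · exact kf_term_bound _ (‖s‖+3) (kc_bound _ _ _ (strip_ratio s μ hμ)) x₀ |x₀| (by simp) j

theorem kfm_bound (s : ℂ) (x₀ : ℝ) (μ : ℂ) (hμ : μ ∈ strip) :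
    ‖kf (s + μ) (2*μ+1) x₀‖ ≤ Real.exp ((‖s‖+3) * |x₀|) := by
  have := kf_norm_le (s+μ) (2*μ+1) x₀ _ (strip_ratio s μ hμ)
  simpa using this

theorem I_strip (τ : ℝ) (h : 1 < τ) : Complex.I * τ ∈ strip := by
  refine ⟨?_, ?_, ?_⟩ <;> simp <;> linarith

theorem kfm_tendsto (s : ℂ) (x₀ : ℝ) :
    Tendsto (fun τ : ℝ => kf (s + Complex.I * τ) (2*(Complex.I*τ)+1) x₀) atTop (𝓝 (Complex.exp (x₀/2))) := by
  have hI : Tendsto (fun τ : ℝ => ((τ:ℂ))⁻¹) atTop (𝓝 0) := by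
    have := (Complex.continuous_ofReal.tendsto 0).comp tendsto_inv_atTop_zero
    simpa [Function.comp_def] using this
  have hrat : ∀ j : ℕ, Tendsto (fun τ : ℝ => (s + Complex.I * τ + j) / (2*(Complex.I*τ)+1+j)) atTop (𝓝 (1/2)) := by
    intro j
    have h1 : Tendsto (fun τ : ℝ => (s + j) * (τ:ℂ)⁻¹ + Complex.I) atTop (𝓝 ((s+j)*0 + Complex.I)) :=
      (hI.const_mul _).add_const _
    have h2 : Tendsto (fun τ : ℝ => (1 + j) * (τ:ℂ)⁻¹ + 2 * Complex.I) atTop (𝓝 ((1+j)*0 + 2 * Complex.I)) :=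
      (hI.const_mul _).add_const _
    have h3 := h1.div h2 (by simp)
    have e : ((s+j)*0 + Complex.I) / ((1+j)*0 + 2 * Complex.I) = 1/2 := by
      have := Complex.I_ne_zero
      rw [mul_zero, mul_zero, zero_add, zero_add]
      field_simp
    rw [e] at h3
    refine h3.congr' ?_
    filter_upwards [eventually_gt_atTop 1] with τ hτ
    have h0 : (τ:ℂ) ≠ 0 := by
      have : τ ≠ 0 := by linarith
      exact_mod_cast this
    have hn := strip_ne _ (I_strip τ hτ) j
    have e1 : (s+j)*(τ:ℂ)⁻¹ + Complex.I = (s + Complex.I * τ + j) * (τ:ℂ)⁻¹ := by field_simp; ring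
    have e2 : (1+j)*(τ:ℂ)⁻¹ + 2*Complex.I = (2*(Complex.I*τ)+1+j) * (τ:ℂ)⁻¹ := by field_simp; ring
    show ((s+j)*(τ:ℂ)⁻¹ + Complex.I) / ((1+j)*(τ:ℂ)⁻¹ + 2*Complex.I) = _
    rw [e1, e2, mul_div_mul_right _ _ (inv_ne_zero h0)]
  have hkc : ∀ j : ℕ, Tendsto (fun τ : ℝ => kc (s + Complex.I * τ) (2*(Complex.I*τ)+1) j) atTop
      (𝓝 ((1/2)^j / (Nat.factorial j))) := by
    intro j
    induction j with
    | zero => simp [kc_zero]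
    | succ j ih =>
      simp only [kc_succ]
      have := (ih.mul (hrat j)).div_const ((j:ℂ)+1)
      refine this.trans_eq ?_
      congr 1
      rw [Nat.factorial_succ]
      have h3 : (j:ℂ) + 1 ≠ 0 := Nat.cast_add_one_ne_zero j
      have h4 : (Nat.factorial j : ℂ) ≠ 0 := by exact_mod_cast (Nat.factorial_ne_zero j)
      push_cast
      field_simp
      ring
  have e : Complex.exp (x₀/2) = ∑' j : ℕ, ((1/2)^j / (Nat.factorial j)) * (x₀:ℂ)^j := by
    rw [Complex.exp_eq_exp_ℂ, NormedSpace.exp_eq_tsum_div]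
    refine tsum_congr fun j => ?_
    rw [div_pow, div_pow, one_pow]
    ring
  rw [e]
  unfold kf
  refine tendsto_tsum_of_dominated_convergence (Real.summable_pow_div_factorial ((‖s‖+3) * |x₀|)) (fun j => (hkc j).mul_const _) ?_
  filter_upwards [eventually_gt_atTop 1] with τ hτ j
  exact kf_term_bound _ (‖s‖+3) (kc_bound _ _ _ (strip_ratio s _ (I_strip τ hτ))) x₀ |x₀| (by simp) j

theorem kfm_props (s : ℂ) (x₀ : ℝ) (hx : 0 < x₀) : ∃ τ₁ B : ℝ, 0 ≤ B ∧ ∀ τ : ℝ, τ₁ ≤ τ →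
    kf (s + Complex.I * τ) (2*(Complex.I*τ)+1) x₀ ∈ Complex.slitPlane ∧
    ∃ d : ℂ, HasDerivAt (fun τ : ℝ => Complex.log (kf (s + Complex.I * τ) (2*(Complex.I*τ)+1) x₀)) d τ ∧ ‖d‖ ≤ B := by
  have ht := (Complex.continuous_re.tendsto _).comp (kfm_tendsto s x₀)
  have e : (Complex.exp (x₀/2)).re = Real.exp (x₀/2) := by
    rw [← Complex.exp_ofReal_re]; push_cast; rfl
  rw [e] at ht
  have h1 : (1/2 : ℝ) < Real.exp (x₀/2) := by
    have := Real.one_lt_exp_iff.mpr (show 0 < x₀/2 by linarith)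
    linarith
  obtain ⟨τ₁, hτ₁⟩ := eventually_atTop.mp (ht.eventually (lt_mem_nhds h1))
  refine ⟨max τ₁ 2, 2 * (Real.exp ((‖s‖+3) * |x₀|) / (1/8)), by positivity, fun τ hτ => ?_⟩
  have hre := hτ₁ τ ((le_max_left _ _).trans hτ)
  simp only [Function.comp] at hre
  have hτ2 : 2 ≤ τ := (le_max_right _ _).trans hτ
  have hsl : kf (s + Complex.I * τ) (2*(Complex.I*τ)+1) x₀ ∈ Complex.slitPlane := Or.inl (by linarith)
  refine ⟨hsl, ?_⟩
  have hmem := I_strip τ (by linarith)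
  have hd : HasDerivAt (fun μ => kf (s + μ) (2*μ+1) x₀) (deriv (fun μ => kf (s + μ) (2*μ+1) x₀) (Complex.I*τ)) (Complex.I*τ) :=
    ((kfm_diffOn s x₀).differentiableAt (strip_open.mem_nhds hmem)).hasDerivAt
  have hsub : Metric.closedBall (Complex.I*τ) (1/8) ⊆ strip := by
    intro w hw
    rw [Metric.mem_closedBall, dist_eq_norm] at hw
    have a := (Complex.abs_re_le_norm (w - Complex.I*τ)).trans hw
    have b := (Complex.abs_im_le_norm (w - Complex.I*τ)).trans hw
    rw [abs_le] at a b
    simp at a b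
    refine ⟨?_, ?_, ?_⟩ <;> linarith
  have hc : DiffContOnCl ℂ (fun μ => kf (s + μ) (2*μ+1) x₀) (Metric.ball (Complex.I*τ) (1/8)) := by
    refine DifferentiableOn.diffContOnCl ?_
    rw [closure_ball _ (by norm_num)]
    exact (kfm_diffOn s x₀).mono hsub
  have hb := Complex.norm_deriv_le_of_forall_mem_sphere_norm_le (by norm_num) hc (C := Real.exp ((‖s‖+3) * |x₀|)) (fun w hw =>
    kfm_bound s x₀ w (hsub (Metric.sphere_subset_closedBall hw)))
  have hI : HasDerivAt (fun τ : ℝ => Complex.I * (τ:ℂ)) Complex.I τ := by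
    have : HasDerivAt (fun x : ℝ => (x:ℂ)) 1 τ := Complex.ofRealCLM.hasDerivAt
    simpa using this.const_mul Complex.I
  have hcomp := (HasDerivAt.scomp τ (h := fun τ : ℝ => Complex.I * (τ:ℂ)) hd hI).clog_real hsl
  refine ⟨_, hcomp, ?_⟩
  rw [norm_div, smul_eq_mul, norm_mul, Complex.norm_I, one_mul]
  have hn : 1/2 ≤ ‖kf (s + Complex.I * τ) (2*(Complex.I*τ)+1) x₀‖ := hre.le.trans (Complex.re_le_norm _)
  have : 0 < ‖kf (s + Complex.I * τ) (2*(Complex.I*τ)+1) x₀‖ := by linarith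
  show _ / ‖kf (s + Complex.I * τ) (2*(Complex.I*τ)+1) x₀‖ ≤ _
  rw [div_le_iff₀ this]
  have hp : (0:ℝ) ≤ Real.exp ((‖s‖+3) * |x₀|) / (1/8) := by positivity
  nlinarith

open Filter Topology MeasureTheory Set

theorem kc_conj (a b : ℂ) (j : ℕ) :
    kc ((starRingEnd ℂ) a) ((starRingEnd ℂ) b) j = (starRingEnd ℂ) (kc a b j) := by
  induction j with
  | zero => simp [kc_zero]
  | succ j ih => rw [kc_succ, kc_succ, ih]; simp

theorem kf_conj (a b : ℂ) (x : ℝ) :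
    kf ((starRingEnd ℂ) a) ((starRingEnd ℂ) b) x = (starRingEnd ℂ) (kf a b x) := by
  unfold kf
  rw [Complex.conj_tsum]
  refine tsum_congr fun j => ?_
  rw [kc_conj]; simp

theorem whittakerM_conj (κ x : ℝ) (μ : ℂ) :
    whittakerM κ ((starRingEnd ℂ) μ) x = (starRingEnd ℂ) (whittakerM κ μ x) := by
  have h2 : (starRingEnd ℂ) (2:ℂ) = 2 := Complex.conj_ofNat 2
  rw [whittakerM_eq, whittakerM_eq, map_mul, map_mul, ← Complex.exp_conj, ← Complex.exp_conj,
    ← kf_conj]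
  simp [h2]

theorem whittakerW_axis (κ x τ : ℝ) : whittakerW κ (Complex.I * τ) x =
    ((2 * (Complex.Gamma (-(2*(Complex.I*τ))) / Complex.Gamma (1/2 - κ - Complex.I*τ) *
      whittakerM κ (Complex.I*τ) x).re : ℝ) : ℂ) := by
  have hc : (starRingEnd ℂ) (Complex.I * τ) = - (Complex.I * τ) := by simp
  have h2 : (starRingEnd ℂ) (2:ℂ) = 2 := Complex.conj_ofNat 2
  have e : Complex.Gamma (2*(Complex.I*τ)) / Complex.Gamma (1/2 - κ + Complex.I*τ) *
      whittakerM κ (-(Complex.I*τ)) x = (starRingEnd ℂ)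
      (Complex.Gamma (-(2*(Complex.I*τ))) / Complex.Gamma (1/2 - κ - Complex.I*τ) *
      whittakerM κ (Complex.I*τ) x) := by
    rw [← hc, whittakerM_conj, map_mul, map_div₀, ← Complex.Gamma_conj, ← Complex.Gamma_conj]
    simp [h2]
  unfold whittakerW
  rw [e, Complex.add_conj]

theorem sP_deriv (z : ℂ) (hz : z ∈ Complex.slitPlane) :
    HasDerivAt sP (Complex.log z - 1/(2*z)) z := by
  have h0 : z ≠ 0 := Complex.slitPlane_ne_zero hz
  have h := (((hasDerivAt_id z).sub_const (1/2)).mul (Complex.hasDerivAt_log hz)).sub (hasDerivAt_id z)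
  have e : (1 * Complex.log z + (id z - 1/2) * z⁻¹ - 1 : ℂ) = Complex.log z - 1/(2*z) := by
    simp only [id]; field_simp; ring
  rw [← e]; exact h

/-- the phase exponent -/
noncomputable def gG (κ x₀ : ℝ) (τ : ℝ) : ℂ :=
  (sP (-(2*(Complex.I*τ))) + sH (-(2*(Complex.I*τ)))) -
  (sP (1/2 - κ - Complex.I*τ) + sH (1/2 - κ - Complex.I*τ)) +
  (-(x₀:ℂ)/2 + (1/2 + Complex.I*τ) * (Real.log x₀ : ℂ)) +
  Complex.log (kf (1/2 - κ + Complex.I * τ) (2*(Complex.I*τ)+1) x₀)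

theorem A_eq (κ x₀ τ : ℝ) (hτ : 3 < τ)
    (hk : kf (1/2 - κ + Complex.I * τ) (2*(Complex.I*τ)+1) x₀ ≠ 0) :
    Complex.Gamma (-(2*(Complex.I*τ))) / Complex.Gamma (1/2 - κ - Complex.I*τ) *
      whittakerM κ (Complex.I*τ) x₀ = Complex.exp (gG κ x₀ τ) := by
  rw [gamma_stirling (-(2*(Complex.I*τ))) (by simp; linarith),
    gamma_stirling (1/2 - κ - Complex.I*τ) (by simp; linarith), whittakerM_eq]
  unfold gG
  have hs : ((Real.sqrt (2*Real.pi) : ℝ) : ℂ) ≠ 0 := by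
    have : Real.sqrt (2*Real.pi) ≠ 0 := by positivity
    exact_mod_cast this
  rw [mul_div_mul_left _ _ hs, ← Complex.exp_sub, ← Complex.exp_add, ← mul_assoc, ← Complex.exp_add,
    Complex.exp_add _ (Complex.log _), Complex.exp_log hk]

theorem log_bd (σ τ : ℝ) (h1 : 1 ≤ τ) (h2 : |σ| ≤ τ) :
    Real.log τ ≤ Real.log ‖(σ:ℂ) - Complex.I*τ‖ ∧
    Real.log ‖(σ:ℂ) - Complex.I*τ‖ ≤ Real.log (2*τ) ∧
    τ * Real.log ‖(σ:ℂ) - Complex.I*τ‖ ≤ τ * Real.log τ + σ^2 := by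
  have hn : ‖(σ:ℂ) - Complex.I*τ‖^2 = σ^2 + τ^2 := by
    rw [← Complex.normSq_eq_norm_sq, Complex.normSq_apply]; simp; ring
  have hs : σ^2 ≤ τ^2 := sq_le_sq' (by linarith [neg_abs_le σ]) (by linarith [le_abs_self σ])
  set N := ‖(σ:ℂ) - Complex.I*τ‖
  have hN : 0 ≤ N := norm_nonneg _
  have l1 : τ ≤ N := by nlinarith [sq_nonneg σ]
  have l2 : N ≤ 2*τ := by nlinarith
  refine ⟨Real.log_le_log (by linarith) l1, Real.log_le_log (by linarith) l2, ?_⟩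
  have ht0 : 0 < τ := by linarith
  have hN0 : 0 < N := by linarith
  have : Real.log (N/τ) ≤ N/τ - 1 := Real.log_le_sub_one_of_pos (by positivity)
  rw [Real.log_div (by positivity) (by positivity)] at this
  have h3 : τ * (Real.log N - Real.log τ) ≤ τ * (N/τ - 1) := by gcongr
  have h4 : τ * (N/τ - 1) = N - τ := by field_simp
  have h5 : N - τ ≤ σ^2 := by nlinarith
  nlinarith

theorem log_axis (τ : ℝ) (h : 0 < τ) : Complex.log (-(2*(Complex.I*τ))) =
    (Real.log (2*τ) : ℝ) + (-(Real.pi/2) : ℝ) * Complex.I := by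
  have : -(2*(Complex.I*τ)) = ((2*τ : ℝ):ℂ) * (-Complex.I) := by push_cast; ring
  rw [this, Complex.log_ofReal_mul (by positivity) (by simp), Complex.log_neg_I]
  push_cast; ring

theorem phase_val (κ x₀ : ℝ) : ∃ τ₀ B : ℝ, ∀ τ : ℝ, τ₀ ≤ τ →
    |-(gG κ x₀ τ).im - (τ * Real.log τ + (2*Real.log 2 - 1 - Real.log x₀)*τ)| ≤ B := by
  set σ : ℝ := 1/2 - κ with hσ
  obtain ⟨B, hB0, hB⟩ := sH_props (|σ|+1) (by positivity)
  refine ⟨|σ| + 4, 2*B + σ^2 + (|κ| + 2) * Real.pi, fun τ hτ => ?_⟩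
  have hσ0 := abs_nonneg σ
  have ht : 0 < τ := by linarith
  have hc : (1/2 - (κ:ℂ)) = (σ:ℂ) := by rw [hσ]; push_cast; ring
  obtain ⟨a1, a2, a3⟩ := log_bd σ τ (by linarith) (by linarith)
  have b1 := (hB (-(2*(Complex.I*τ))) (by simp; linarith) (by simp; linarith)).2.1
  have b2 := (hB ((σ:ℂ) - Complex.I*τ) (by simp; linarith [neg_abs_le σ]) (by simp; linarith)).2.1
  have c1 := abs_le.1 ((Complex.abs_im_le_norm _).trans b1)
  have c2 := abs_le.1 ((Complex.abs_im_le_norm _).trans b2)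
  have e1 : (sP (-(2*(Complex.I*τ)))).im = -(2*τ*Real.log (2*τ)) + Real.pi/4 + 2*τ := by
    unfold sP; rw [log_axis τ ht]; simp; ring
  have e2 : (sP ((σ:ℂ) - Complex.I*τ)).im = -κ * Complex.arg ((σ:ℂ) - Complex.I*τ)
      - τ * Real.log ‖(σ:ℂ) - Complex.I*τ‖ + τ := by
    unfold sP
    simp only [Complex.sub_im, Complex.mul_im, Complex.log_re, Complex.log_im, Complex.sub_re]
    simp; rw [hσ]; ring
  have ha := Complex.abs_arg_le_pi ((σ:ℂ) - Complex.I*τ)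
  have ha2 := Complex.abs_arg_le_pi (kf (σ + Complex.I * τ) (2*(Complex.I*τ)+1) x₀)
  have hk : |κ * Complex.arg ((σ:ℂ) - Complex.I*τ)| ≤ |κ| * Real.pi := by
    rw [abs_mul]; gcongr
  have hl : Real.log (2*τ) = Real.log 2 + Real.log τ := Real.log_mul (by norm_num) (by positivity)
  have e3 : (gG κ x₀ τ).im = (-(2*τ*Real.log (2*τ)) + Real.pi/4 + 2*τ + (sH (-(2*(Complex.I*τ)))).im)
      - (-κ * Complex.arg ((σ:ℂ) - Complex.I*τ)
      - τ * Real.log ‖(σ:ℂ) - Complex.I*τ‖ + τ + (sH ((σ:ℂ) - Complex.I*τ)).im) + τ * Real.log x₀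
      + Complex.arg (kf (σ + Complex.I * τ) (2*(Complex.I*τ)+1) x₀) := by
    unfold gG
    rw [hc]
    rw [Complex.add_im, Complex.add_im, Complex.sub_im, Complex.add_im, Complex.add_im (sP _), Complex.add_im (_/_), e1, e2, Complex.log_im]
    have : ((1/2 + Complex.I*τ) * (Real.log x₀ : ℂ)).im = τ * Real.log x₀ := by simp
    rw [this]
    have : (-(x₀:ℂ)/2).im = 0 := by
      have : (-(x₀:ℂ)/2) = ((-x₀/2 : ℝ):ℂ) := by push_cast; ring
      rw [this]; exact Complex.ofReal_im _
    rw [this]; ring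
  rw [e3, hl]
  have h5 : τ * Real.log τ ≤ τ * Real.log ‖(σ:ℂ) - Complex.I*τ‖ := by gcongr
  have hp := Real.pi_pos
  rw [abs_le] at ha2 hk ⊢
  constructor <;> nlinarith

theorem phase_deriv (κ x₀ : ℝ) (hx : 0 < x₀) : ∃ τ₀ : ℝ, ∀ τ : ℝ, τ₀ ≤ τ →
    3 < τ ∧ kf (1/2 - κ + Complex.I * τ) (2*(Complex.I*τ)+1) x₀ ≠ 0 ∧
    ∃ d : ℝ, 0 < d ∧ HasDerivAt (fun τ : ℝ => -(gG κ x₀ τ).im) d τ := by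
  set σ : ℝ := 1/2 - κ with hσ
  have hc : (1/2 - (κ:ℂ)) = (σ:ℂ) := by rw [hσ]; push_cast; ring
  obtain ⟨B, hB0, hB⟩ := sH_props (|σ|+1) (by positivity)
  obtain ⟨τ₁, B2, hB20, hB2⟩ := kfm_props (σ:ℂ) x₀ hx
  set K := 3*B + B2 + |Real.log x₀| + 3 with hK
  refine ⟨max τ₁ (max (|σ| + 4) (Real.exp (K+1))), fun τ hτ => ?_⟩
  have hτ1 := (le_max_left _ _).trans hτ
  have hτ2 := ((le_max_left _ _).trans (le_max_right _ _)).trans hτ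
  have hτ3 := ((le_max_right _ _).trans (le_max_right _ _)).trans hτ
  have hσ0 := abs_nonneg σ
  have ht : 0 < τ := by linarith
  obtain ⟨hsl, d, hd, hdB⟩ := hB2 τ hτ1
  obtain ⟨a1, a2, a3⟩ := log_bd σ τ (by linarith) (by linarith)
  obtain ⟨p1, -, p2⟩ := hB (-(2*(Complex.I*τ))) (by simp; linarith) (by simp; linarith)
  obtain ⟨q1, -, q2⟩ := hB ((σ:ℂ) - Complex.I*τ) (by simp; linarith [neg_abs_le σ]) (by simp; linarith)
  refine ⟨by linarith, by rw [hc]; exact Complex.slitPlane_ne_zero hsl, ?_⟩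
  have i1 : HasDerivAt (fun τ : ℝ => -(2*(Complex.I*(τ:ℂ)))) (-(2*(Complex.I*1))) τ :=
    (((Complex.ofRealCLM.hasDerivAt (x := τ)).const_mul Complex.I).const_mul 2).neg
  have i2 : HasDerivAt (fun τ : ℝ => (σ:ℂ) - Complex.I*(τ:ℂ)) (-(Complex.I*1)) τ :=
    ((Complex.ofRealCLM.hasDerivAt (x := τ)).const_mul Complex.I).const_sub (σ:ℂ)
  have i3 : HasDerivAt (fun τ : ℝ => -(x₀:ℂ)/2 + (1/2 + Complex.I*(τ:ℂ)) * (Real.log x₀ : ℂ))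
      (Complex.I*1 * (Real.log x₀ : ℂ)) τ :=
    ((((Complex.ofRealCLM.hasDerivAt (x := τ)).const_mul Complex.I).const_add (1/2)).mul_const
      (Real.log x₀ : ℂ)).const_add _
  have s1 : -(2*(Complex.I*(τ:ℂ))) ∈ Complex.slitPlane := slit_of_im (by simp; linarith)
  have s2 : (σ:ℂ) - Complex.I*(τ:ℂ) ∈ Complex.slitPlane := slit_of_im (by simp; linarith)
  have j1 := ((sP_deriv _ s1).add p1.hasDerivAt).comp τ i1
  have j2 := ((sP_deriv _ s2).add q1.hasDerivAt).comp τ i2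
  have j := (((j1.sub j2).add i3).add hd)
  have jim := (hd_im j).neg
  refine ⟨_, ?_, jim.congr_of_eventuallyEq (Eventually.of_forall fun t => ?_)⟩
  swap
  · unfold gG; rw [hc]; rfl
  have n1 : ‖1/(2*(-(2*(Complex.I*(τ:ℂ)))))‖ ≤ 1 := by
    rw [norm_div, norm_one]
    apply div_le_one_of_le₀ _ (norm_nonneg _)
    simp; rw [abs_of_pos ht]; linarith
  have hn : τ ≤ ‖(σ:ℂ) - Complex.I*τ‖ := by
    have := Complex.abs_im_le_norm ((σ:ℂ) - Complex.I*τ)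
    simp at this; rwa [abs_of_pos ht] at this
  have n2 : ‖1/(2*((σ:ℂ) - Complex.I*(τ:ℂ)))‖ ≤ 1 := by
    rw [norm_div, norm_one]
    apply div_le_one_of_le₀ _ (norm_nonneg _)
    rw [norm_mul]; simp only [Complex.norm_ofNat]; linarith
  have r1 := abs_le.1 ((Complex.abs_re_le_norm _).trans n1)
  have r2 := abs_le.1 ((Complex.abs_re_le_norm _).trans n2)
  have r3 := abs_le.1 ((Complex.abs_re_le_norm _).trans p2)
  have r4 := abs_le.1 ((Complex.abs_re_le_norm _).trans q2)
  have r5 := abs_le.1 ((Complex.abs_im_le_norm _).trans hdB)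
  have l1 : (Complex.log (-(2*(Complex.I*τ)))).re = Real.log (2*τ) := by
    rw [log_axis τ ht]; simp
  have l2 : (Complex.log ((σ:ℂ) - Complex.I*τ)).re = Real.log ‖(σ:ℂ) - Complex.I*τ‖ := Complex.log_re _
  have im1 : ∀ w : ℂ, (w * -(2*(Complex.I*1))).im = -2 * w.re := fun w => by simp; ring
  have im2 : ∀ w : ℂ, (w * -(Complex.I*1)).im = - w.re := fun w => by simp
  have im3 : (Complex.I*1 * (Real.log x₀ : ℂ)).im = Real.log x₀ := by simp
  have hL : K + 1 ≤ Real.log (2*τ) := by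
    rw [Real.le_log_iff_exp_le (by positivity)]; linarith
  have hlx := neg_abs_le (Real.log x₀)
  have hlx2 := le_abs_self (Real.log x₀)
  rw [Complex.add_im, Complex.add_im, Complex.sub_im, im1, im2, im3]
  simp only [Complex.add_re]
  rw [Complex.sub_re, Complex.sub_re (Complex.log ((σ:ℂ) - Complex.I*τ)), l1, l2]
  linarith

open Filter Topology MeasureTheory Set

theorem count_cos (ψ : ℝ → ℝ) (a : ℝ) (hc : ContinuousOn ψ (Ici a)) (hm : StrictMonoOn ψ (Ici a))
    (T : ℝ) (hT : a ≤ T) :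
    {τ : ℝ | a < τ ∧ τ ≤ T ∧ Real.cos (ψ τ) = 0}.Finite ∧
    |({τ : ℝ | a < τ ∧ τ ≤ T ∧ Real.cos (ψ τ) = 0}.ncard : ℝ) - (ψ T - ψ a)/Real.pi| ≤ 1 := by
  have hp := Real.pi_pos
  set g : ℝ → ℝ := fun τ => ψ τ / Real.pi - 1/2 with hg
  have gc : ContinuousOn g (Ici a) := (hc.div_const _).sub continuousOn_const
  have gm : StrictMonoOn g (Ici a) := fun x hx y hy hxy => by
    have := hm hx hy hxy
    simp only [hg]; gcongr
  have hcos : ∀ τ, Real.cos (ψ τ) = 0 ↔ ∃ k : ℤ, g τ = k := fun τ => by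
    rw [Real.cos_eq_zero_iff]
    refine exists_congr fun k => ?_
    simp only [hg]
    constructor
    · intro h; rw [h]; field_simp; ring
    · intro h
      have : ψ τ / Real.pi = k + 1/2 := by linarith
      rw [div_eq_iff hp.ne'] at this
      rw [this]; ring
  set S := {τ : ℝ | a < τ ∧ τ ≤ T ∧ Real.cos (ψ τ) = 0} with hS
  have hsub : S ⊆ Ici a := fun τ h => h.1.le
  have hinj : InjOn g S := gm.injOn.mono hsub
  have himg : g '' S = (fun k : ℤ => (k:ℝ)) '' (Finset.Ioc ⌊g a⌋ ⌊g T⌋ : Set ℤ) := by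
    ext y
    constructor
    · rintro ⟨τ, ⟨h1, h2, h3⟩, rfl⟩
      obtain ⟨k, hk⟩ := (hcos τ).1 h3
      refine ⟨k, ?_, hk.symm⟩
      simp only [Finset.coe_Ioc, mem_Ioc]
      constructor
      · rw [Int.floor_lt, ← hk]; exact gm self_mem_Ici h1.le h1
      · rw [Int.le_floor, ← hk]; exact gm.monotoneOn h1.le hT h2
    · rintro ⟨k, hk, rfl⟩
      simp only [Finset.coe_Ioc, mem_Ioc] at hk
      have h1 := Int.floor_lt.1 hk.1
      have h2 := Int.le_floor.1 hk.2
      obtain ⟨τ, ht, he⟩ := intermediate_value_Ioc hT (gc.mono Icc_subset_Ici_self) ⟨h1, h2⟩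
      exact ⟨τ, ⟨ht.1, ht.2, (hcos τ).2 ⟨k, he⟩⟩, he⟩
  have hfin : S.Finite := by
    apply Set.Finite.of_finite_image _ hinj
    rw [himg]; exact (Finset.finite_toSet _).image _
  refine ⟨hfin, ?_⟩
  have hcard : S.ncard = (⌊g T⌋ - ⌊g a⌋).toNat := by
    rw [← Set.ncard_image_of_injOn hinj, himg, Set.ncard_image_of_injective _ Int.cast_injective,
      Set.ncard_coe_finset, Int.card_Ioc]
  have hle : ⌊g a⌋ ≤ ⌊g T⌋ := Int.floor_le_floor (gm.monotoneOn self_mem_Ici hT hT)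
  have hcr : (S.ncard : ℝ) = ⌊g T⌋ - ⌊g a⌋ := by
    have : ((S.ncard : ℤ)) = ⌊g T⌋ - ⌊g a⌋ := by rw [hcard]; omega
    exact_mod_cast this
  rw [hcr]
  have e : (ψ T - ψ a)/Real.pi = g T - g a := by simp only [hg]; ring
  rw [e, abs_le]
  have := Int.floor_le (g T); have := Int.lt_floor_add_one (g T)
  have := Int.floor_le (g a); have := Int.lt_floor_add_one (g a)
  constructor <;> linarith

theorem Z_fin (κ x₀ : ℝ) (hx : 0 < x₀) (F : ℂ → ℂ) (hF : Differentiable ℂ F)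
    (hFW : ∀ μ : ℂ, (∀ n : ℤ, 2*μ ≠ (n:ℂ)) → F μ = whittakerW (κ:ℂ) μ x₀) (a : ℝ) :
    {ρ : ℂ | F ρ = 0 ∧ |ρ.im| ≤ a}.Finite := by
  by_contra hinf
  have hK : IsCompact (Metric.closedBall (0:ℂ) (|κ| + 1 + a)) := isCompact_closedBall _ _
  have hsub : {ρ : ℂ | F ρ = 0 ∧ |ρ.im| ≤ a} ⊆ Metric.closedBall (0:ℂ) (|κ| + 1 + a) := by
    rintro ρ ⟨h1, h2⟩
    rw [mem_closedBall_zero_iff]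
    have h3 := Complex.norm_le_abs_re_add_abs_im ρ
    have h4 : |ρ.re| ≤ |κ| + 1 := by
      rcases F_zeros κ x₀ hx F hF hFW ρ h1 with h | h
      · rw [h]; simp; positivity
      · exact h.2
    linarith
  obtain ⟨z, -, hz⟩ := Set.Infinite.exists_accPt_of_subset_isCompact hinf hK hsub
  have hfr : ∃ᶠ w in 𝓝[≠] z, F w = 0 :=
    (accPt_iff_frequently_nhdsNE.1 hz).mono fun w hw => hw.1
  have han : AnalyticOnNhd ℂ F univ := fun w _ => hF.analyticAt w
  have := han.eqOn_zero_of_preconnected_of_frequently_eq_zero isPreconnected_univ (mem_univ z) hfr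
  exact F_real_ne κ x₀ hx F hF hFW (|κ|+2) (by linarith) (this (mem_univ _))

/-- Zero-counting asymptotics for the entire function `μ ↦ W_{κ,μ}(x₀)`:
`N(T) = (2/π)·T·log T + (2/π)·(2 log 2 - 1 - log x₀)·T + O(1)`. -/
theorem stmt_17 (κ x₀ : ℝ) (hx : 0 < x₀) (F : ℂ → ℂ) (hF : Differentiable ℂ F)
    (hFW : ∀ μ : ℂ, (∀ n : ℤ, 2*μ ≠ (n:ℂ)) → F μ = whittakerW (κ:ℂ) μ x₀) :
    ∃ T₁ C : ℝ, 0 < C ∧ ∀ T : ℝ, T₁ ≤ T →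
      {ρ : ℂ | F ρ = 0 ∧ |ρ.im| ≤ T}.Finite ∧
      |(({ρ : ℂ | F ρ = 0 ∧ |ρ.im| ≤ T}).ncard : ℝ) -
        ((2/Real.pi) * T * Real.log T +
         (2/Real.pi) * (2*Real.log 2 - 1 - Real.log x₀) * T)| ≤ C := by
  obtain ⟨τ₁, B, hB⟩ := phase_val κ x₀
  obtain ⟨τ₂, hD⟩ := phase_deriv κ x₀ hx
  have hp := Real.pi_pos
  set a := max τ₁ τ₂ with ha
  set ψ : ℝ → ℝ := fun τ => -(gG κ x₀ τ).im with hψ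
  have hc : ContinuousOn ψ (Ici a) := fun τ hτ => by
    obtain ⟨-, -, d, -, hd⟩ := hD τ ((le_max_right _ _).trans hτ)
    exact hd.continuousAt.continuousWithinAt
  have hm : StrictMonoOn ψ (Ici a) := by
    apply strictMonoOn_of_deriv_pos (convex_Ici a) hc
    intro τ hτ
    obtain ⟨-, -, d, hd0, hd⟩ := hD τ ((le_max_right _ _).trans (interior_subset hτ))
    rw [hd.deriv]; exact hd0
  have ha3 : 3 < a := (hD a (le_max_right _ _)).1
  have hFz : ∀ τ : ℝ, a ≤ τ → (F (Complex.I * τ) = 0 ↔ Real.cos (ψ τ) = 0) := fun τ hτ => by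
    obtain ⟨h3, hk, -⟩ := hD τ ((le_max_right _ _).trans hτ)
    rw [hFW _ (fun n h => by
      have := congrArg Complex.im h
      simp at this; linarith), whittakerW_axis, A_eq κ x₀ τ h3 hk, Complex.exp_re,
      Complex.ofReal_eq_zero]
    have he := (Real.exp_pos (gG κ x₀ τ).re).ne'
    simp [hψ, he]
  set Z := {ρ : ℂ | F ρ = 0 ∧ |ρ.im| ≤ a} with hZ
  have hZf : Z.Finite := Z_fin κ x₀ hx F hF hFW a
  refine ⟨a, (Z.ncard : ℝ) + 2 + 2*(|ψ a| + |B|)/Real.pi, by positivity, fun T hT => ?_⟩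
  refine ⟨Z_fin κ x₀ hx F hF hFW T, ?_⟩
  obtain ⟨hSf, hSc⟩ := count_cos ψ a hc hm T hT
  set S := {τ : ℝ | a < τ ∧ τ ≤ T ∧ Real.cos (ψ τ) = 0} with hS
  have hset : {ρ : ℂ | F ρ = 0 ∧ |ρ.im| ≤ T} =
      Z ∪ ((fun τ : ℝ => Complex.I * (τ:ℂ)) '' S ∪ (fun τ : ℝ => -(Complex.I * (τ:ℂ))) '' S) := by
    ext ρ
    constructor
    · rintro ⟨h1, h2⟩
      by_cases h3 : |ρ.im| ≤ a
      · exact Or.inl ⟨h1, h3⟩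
      right
      push Not at h3
      have hre : ρ.re = 0 := by
        rcases F_zeros κ x₀ hx F hF hFW ρ h1 with h | h
        · exact h
        · rw [h.1] at h3; simp at h3; linarith
      rcases le_total 0 ρ.im with h0 | h0
      · left
        rw [abs_of_nonneg h0] at h2 h3
        have e : Complex.I * (ρ.im : ℂ) = ρ := by apply Complex.ext <;> simp [hre]
        exact ⟨ρ.im, ⟨h3, h2, (hFz _ h3.le).1 (by rw [e]; exact h1)⟩, e⟩
      · right
        rw [abs_of_nonpos h0] at h2 h3
        have e : -(Complex.I * ((-ρ.im : ℝ) : ℂ)) = ρ := by apply Complex.ext <;> simp [hre]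
        refine ⟨-ρ.im, ⟨h3, h2, (hFz _ h3.le).1 ?_⟩, e⟩
        rw [← F_even κ x₀ F hF hFW, e]; exact h1
    · rintro (h | ⟨τ, ⟨h1, h2, h3⟩, rfl⟩ | ⟨τ, ⟨h1, h2, h3⟩, rfl⟩)
      · exact ⟨h.1, h.2.trans hT⟩
      · refine ⟨(hFz _ h1.le).2 h3, ?_⟩
        simp; rw [abs_of_pos (by linarith)]; exact h2
      · refine ⟨?_, ?_⟩
        · simp only []; rw [F_even κ x₀ F hF hFW]; exact (hFz _ h1.le).2 h3
        · simp; rw [abs_of_pos (by linarith)]; exact h2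
  have d1 : Disjoint ((fun τ : ℝ => Complex.I * (τ:ℂ)) '' S) ((fun τ : ℝ => -(Complex.I * (τ:ℂ))) '' S) := by
    rw [Set.disjoint_left]
    rintro _ ⟨τ, h, rfl⟩ ⟨t, h', he⟩
    have := congrArg Complex.im he
    simp at this
    linarith [h.1, h'.1]
  have d2 : Disjoint Z ((fun τ : ℝ => Complex.I * (τ:ℂ)) '' S ∪ (fun τ : ℝ => -(Complex.I * (τ:ℂ))) '' S) := by
    rw [Set.disjoint_left]
    rintro ρ ⟨-, h⟩ (⟨τ, h', rfl⟩ | ⟨τ, h', rfl⟩)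
    · simp at h; rw [abs_of_pos (by linarith [h'.1])] at h; linarith [h'.1]
    · simp at h; rw [abs_of_pos (by linarith [h'.1])] at h; linarith [h'.1]
  have hN : ({ρ : ℂ | F ρ = 0 ∧ |ρ.im| ≤ T}).ncard = Z.ncard + (S.ncard + S.ncard) := by
    rw [hset, Set.ncard_union_eq d2 hZf ((hSf.image _).union (hSf.image _)),
      Set.ncard_union_eq d1 (hSf.image _) (hSf.image _), Set.ncard_image_of_injective,
      Set.ncard_image_of_injective]
    · intro x y h; have := congrArg Complex.im h; simpa using this
    · intro x y h; have := congrArg Complex.im h; simpa using this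
  rw [hN]
  push_cast
  have hv := hB T ((le_max_left _ _).trans hT)
  set V := T * Real.log T + (2*Real.log 2 - 1 - Real.log x₀)*T with hV
  have e1 : (2/Real.pi) * T * Real.log T +
         (2/Real.pi) * (2*Real.log 2 - 1 - Real.log x₀) * T = 2 * (V / Real.pi) := by rw [hV]; ring
  rw [e1]
  have e2 : (Z.ncard:ℝ) + ((S.ncard:ℝ) + S.ncard) - 2*(V/Real.pi) =
      Z.ncard + 2 * ((S.ncard:ℝ) - (ψ T - ψ a)/Real.pi) + 2*((ψ T - V) - ψ a)/Real.pi := by ring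
  rw [e2]
  have t1 : |2*((ψ T - V) - ψ a)/Real.pi| ≤ 2*(|ψ a| + |B|)/Real.pi := by
    rw [abs_div, abs_of_pos hp, abs_mul, abs_two]
    gcongr
    have h1 := abs_sub (ψ T - V) (ψ a)
    have h2 : |ψ T - V| ≤ |B| := le_trans hv (le_abs_self B)
    linarith
  have hz0 : (0:ℝ) ≤ Z.ncard := by positivity
  rw [abs_le] at t1 hSc ⊢
  constructor <;> linarith
end

section
/- Fix a real number κ and a real x₀ > 0, and suppose F : ℂ → ℂ is an entire function such that F(μ) = W_{κ,μ}(x₀) for every complex μ with 2μ not an integer. Then F has infinitely many purely imaginary zeros: the set {t ∈ ℝ : F(i·t) = 0} is infinite. -/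
open Filter Topology

/-- Summand of Gudermann's series. -/
noncomputable def gudJ (s : ℂ) : ℂ := (s + 1/2) * (Complex.log (s+1) - Complex.log s) - 1

/-- Gudermann's series. -/
noncomputable def gudMu (s : ℂ) : ℂ := ∑' k : ℕ, gudJ (s + k)

/-- Main exponent in Stirling's formula. -/
noncomputable def stMain (s : ℂ) : ℂ := (s - 1/2) * Complex.log s - s

lemma log_add_one_sub {s : ℂ} (hs : 0 < s.im) :
    Complex.log (s+1) - Complex.log s = Complex.log (1 + s⁻¹) := by
  have hs0 : s ≠ 0 := by rintro rfl; simp at hs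
  have him : (1 + s⁻¹).im < 0 := by
    simp only [Complex.add_im, Complex.one_im, Complex.inv_im, zero_add]
    have : 0 < Complex.normSq s := Complex.normSq_pos.mpr hs0
    rw [neg_div]; have := div_pos hs this; linarith
  have h1 : (1 + s⁻¹) ≠ 0 := by intro h; rw [h] at him; simp at him
  have he : s + 1 = (1 + s⁻¹) * s := by field_simp
  rw [he, (Complex.log_mul_eq_add_log_iff h1 hs0).mpr]
  · ring
  · have a1 := Complex.arg_neg_iff.mpr him
    have a2 := Complex.arg_nonneg_iff.mpr hs.le
    have a3 := Complex.arg_le_pi s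
    have a4 := Complex.neg_pi_lt_arg (1 + s⁻¹)
    constructor <;> linarith

lemma gudJ_bound {s : ℂ} (hs : 2 ≤ s.im) : ‖gudJ s‖ ≤ 2 / Complex.normSq s := by
  have hs0 : s ≠ 0 := by rintro rfl; norm_num at hs
  have hn : 2 ≤ ‖s‖ := hs.trans ((le_abs_self _).trans (Complex.abs_im_le_norm s))
  rw [gudJ, log_add_one_sub (by linarith)]
  set w := s⁻¹ with hw
  have hw0 : w ≠ 0 := inv_ne_zero hs0
  have hsw : s = w⁻¹ := by simp [hw]
  have hwn : ‖w‖ ≤ 1/2 := by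
    rw [hw, norm_inv, one_div]; exact inv_anti₀ (by norm_num) hn
  have hb := Complex.norm_log_sub_logTaylor_le 2 (z := w) (by linarith)
  have ht : Complex.logTaylor (2+1) w = w - w^2/2 := by
    simp [Complex.logTaylor_succ, Complex.logTaylor_zero]; ring
  rw [ht] at hb
  set r := Complex.log (1 + w) - (w - w^2/2) with hr
  have hinv : (1 - ‖w‖)⁻¹ ≤ 2 := by
    rw [inv_le_comm₀ (by linarith) (by norm_num)]; linarith
  have hw3 : 0 < ‖w‖ := norm_pos_iff.mpr hw0
  have hb2 : ‖r‖ ≤ ‖w‖^3 := by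
    refine hb.trans ?_
    norm_num
    have : ‖w‖^3 * (1 - ‖w‖)⁻¹ ≤ ‖w‖^3 * 2 := by gcongr
    have : 0 < ‖w‖^3 := by positivity
    linarith
  have hl : Complex.log (1 + w) = w - w^2/2 + r := by rw [hr]; ring
  have e : (s + 1/2) * Complex.log (1 + w) - 1 = r * s + r / 2 - w^2/4 := by
    rw [hl, hsw]; field_simp; ring
  rw [e]
  have hns : Complex.normSq s = (‖w‖^2)⁻¹ := by
    rw [Complex.normSq_eq_norm_sq, hsw]; simp
  rw [hns, div_inv_eq_mul]
  have n1 : ‖r * s‖ ≤ ‖w‖^2 := by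
    rw [norm_mul, hsw, norm_inv]
    calc ‖r‖ * ‖w‖⁻¹ ≤ ‖w‖^3 * ‖w‖⁻¹ := by gcongr
      _ = ‖w‖^2 := by field_simp
  have n2 : ‖r / 2‖ ≤ ‖w‖^2/4 := by
    rw [norm_div]; norm_num
    have : ‖w‖^3 ≤ ‖w‖^2 * (1/2) := by
      rw [pow_succ]; gcongr
    linarith
  have n3 : ‖w^2/4‖ = ‖w‖^2/4 := by simp
  have := norm_sub_le (r * s + r/2) (w^2/4)
  have := norm_add_le (r*s) (r/2)
  have : 0 ≤ ‖w‖^2 := by positivity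
  linarith

lemma gudJ_bound2 {s : ℂ} (hs : 2 ≤ s.im) (k : ℕ) :
    ‖gudJ (s + k)‖ ≤ 2 * (3 + s.re^2) * (1 / ((k:ℝ)+1)^2) := by
  refine (gudJ_bound (by simpa using hs)).trans ?_
  rw [Complex.normSq_apply]
  simp only [Complex.add_re, Complex.natCast_re, Complex.add_im, Complex.natCast_im, add_zero]
  have h4 : 4 ≤ s.im * s.im := by nlinarith
  have hk : (0:ℝ) < (k:ℝ) + 1 := by positivity
  rw [mul_one_div, div_le_div_iff₀ (by nlinarith [mul_self_nonneg (s.re + k)]) (by positivity)]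
  nlinarith [sq_nonneg (s.re + k + s.re), sq_nonneg (s.re + k - 1), sq_nonneg (s.re + 1),
    mul_nonneg (sq_nonneg s.re) (mul_self_nonneg (s.re + k)), mul_nonneg (sq_nonneg s.re) (sub_nonneg.mpr h4)]

lemma summable_aux (C : ℝ) : Summable fun k : ℕ => C * (1 / ((k:ℝ)+1)^2) := by
  apply Summable.mul_left
  have := (summable_nat_add_iff 1).mpr (Real.summable_one_div_nat_pow.mpr (one_lt_two))
  simpa using this

lemma gudJ_summable {s : ℂ} (hs : 2 ≤ s.im) : Summable fun k : ℕ => gudJ (s + k) :=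
  Summable.of_norm_bounded (summable_aux _) (gudJ_bound2 hs)

lemma gudMu_tendsto (a c : ℝ) (hc : 1 ≤ c) :
    Tendsto (fun t : ℝ => gudMu (a + Complex.I * (c * t))) atTop (𝓝 0) := by
  have : (0:ℂ) = ∑' k : ℕ, 0 := by simp
  rw [this]
  unfold gudMu
  refine tendsto_tsum_of_dominated_convergence (summable_aux (2 * (3 + a^2))) ?_ ?_
  · intro k
    have hz : Tendsto (fun t : ℝ => 2 / t) atTop (𝓝 0) :=
      tendsto_const_nhds.div_atTop tendsto_id
    refine squeeze_zero_norm' ?_ hz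
    filter_upwards [eventually_ge_atTop 2] with t ht
    have hct : t ≤ c * t := by nlinarith
    refine (gudJ_bound (by simp; linarith)).trans ?_
    rw [Complex.normSq_apply]
    simp
    apply div_le_div_of_nonneg_left (by norm_num) (by linarith)
    nlinarith [mul_self_nonneg (a + k)]
  · filter_upwards [eventually_ge_atTop 2] with t ht k
    have hct : t ≤ c * t := by nlinarith
    have := gudJ_bound2 (s := a + Complex.I * (c * t)) (by simp; linarith) k
    simpa using this

lemma gudMu_succ {s : ℂ} (hs : 2 ≤ s.im) : gudMu s = gudJ s + gudMu (s+1) := by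
  unfold gudMu
  rw [(gudJ_summable hs).tsum_eq_zero_add]
  congr 1
  · simp
  · congr 1; ext k; push_cast; ring_nf

noncomputable def stE (s : ℂ) : ℂ := Complex.exp (stMain s + gudMu s)

lemma stE_succ {s : ℂ} (hs : 2 ≤ s.im) : stE (s+1) = s * stE s := by
  have hs0 : s ≠ 0 := by rintro rfl; norm_num at hs
  unfold stE
  rw [gudMu_succ hs]
  have h : ∀ z, s * Complex.exp z = Complex.exp (Complex.log s + z) := fun z => by
    rw [Complex.exp_add, Complex.exp_log hs0]
  rw [h]
  congr 1
  unfold stMain gudJ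
  ring

lemma stE_prod {s : ℂ} (hs : 2 ≤ s.im) (n : ℕ) :
    stE (s+n) = (∏ j ∈ Finset.range n, (s + j)) * stE s := by
  induction n with
  | zero => simp
  | succ n ih =>
    rw [Finset.prod_range_succ]
    have := stE_succ (s := s + n) (by simpa using hs)
    push_cast
    rw [← add_assoc, this, ih]; ring

lemma gammaSeq_div {s : ℂ} (hs : 2 ≤ s.im) {n : ℕ} (hn : n ≠ 0) :
    Complex.GammaSeq s n = stE s * ((Stirling.stirlingSeq n : ℝ) * (√2 : ℝ) *
      Complex.exp (-((n + (s+1/2)) * Complex.log (1 + (s+1)/n) - (s+1)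
        + gudMu (s + (n+1 : ℕ))))) := by
  have hnr : (0:ℝ) < n := by positivity
  have hnc : (n:ℂ) ≠ 0 := by exact_mod_cast hn
  have hE : ∀ z, stE z ≠ 0 := fun z => Complex.exp_ne_zero _
  have hprod : (∏ j ∈ Finset.range (n+1), (s + j)) = stE (s + (n+1:ℕ)) / stE s := by
    rw [stE_prod hs, mul_div_cancel_right₀ _ (hE s)]
  have hfac : (n.factorial : ℂ) = (Stirling.stirlingSeq n : ℝ) * (√2 : ℝ) *
      Complex.exp ((n+1/2) * Complex.log n - n) := by
    have h0 : (n.factorial : ℝ) = Stirling.stirlingSeq n * √2 *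
      Real.exp ((n+1/2) * Real.log n - n) := by
      have h1 : Real.exp ((n+1/2) * Real.log n - n) = √n * (n / Real.exp 1)^n := by
        rw [Real.sqrt_eq_rpow, Real.rpow_def_of_pos hnr, div_pow, ← Real.exp_nat_mul]
        have : (n:ℝ)^n = Real.exp (n * Real.log n) := by
          rw [mul_comm, Real.exp_mul, Real.exp_log hnr, Real.rpow_natCast]
        rw [this, ← Real.exp_sub, ← Real.exp_add]
        congr 1; ring
      rw [h1, Stirling.stirlingSeq, Real.sqrt_mul (by norm_num)]
      field_simp
    have := congrArg (fun x : ℝ => (x:ℂ)) h0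
    push_cast at this
    exact this
  have hlog : Complex.log (s + (n+1:ℕ)) = Complex.log n + Complex.log (1 + (s+1)/n) := by
    have e : s + (n+1:ℕ) = (n:ℝ) * (1 + (s+1)/n) := by push_cast; field_simp; ring
    rw [e, Complex.log_ofReal_mul hnr]
    · simp [Complex.natCast_log]
    · intro h
      rw [h, mul_zero] at e
      have := congrArg Complex.im e
      simp at this; linarith
  rw [Complex.GammaSeq, hprod, hfac, Complex.cpow_def_of_ne_zero hnc]
  rw [div_div_eq_mul_div, div_eq_iff (hE _)]
  nth_rewrite 3 [stE]
  have key : Complex.exp (Complex.log n * s) * Complex.exp ((n+1/2) * Complex.log n - n) =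
     Complex.exp (-((n + (s+1/2)) * Complex.log (1 + (s+1)/n) - (s+1)
        + gudMu (s + (n+1 : ℕ)))) * Complex.exp (stMain (s + (n+1:ℕ)) + gudMu (s + (n+1:ℕ))) := by
    rw [← Complex.exp_add, ← Complex.exp_add]
    congr 1
    rw [stMain, hlog]; push_cast; ring
  linear_combination (stE s * (Stirling.stirlingSeq n : ℝ) * (√2 : ℝ)) * key

/-- Stirling's formula off the real axis. -/
lemma gamma_stirling_s18 {s : ℂ} (hs : 2 ≤ s.im) :
    Complex.Gamma s = (√Real.pi * √2 : ℝ) * Complex.exp (stMain s + gudMu s) := by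
  have h1 := Complex.GammaSeq_tendsto_Gamma s
  have hdiv : Tendsto (fun n : ℕ => (s+1)/(n:ℂ)) atTop (𝓝 0) :=
    tendsto_const_div_atTop_nhds_zero_nat (s+1)
  have hA : Tendsto (fun n : ℕ => (n:ℂ) * Complex.log (1 + (s+1)/n)) atTop (𝓝 (s+1)) := by
    apply Complex.tendsto_nat_mul_log_one_add_of_tendsto
    refine tendsto_const_nhds.congr' ?_
    filter_upwards [eventually_ne_atTop 0] with n hn
    have hnc : (n:ℂ) ≠ 0 := by exact_mod_cast hn
    field_simp
  have hB : Tendsto (fun n : ℕ => Complex.log (1 + (s+1)/n)) atTop (𝓝 0) := by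
    have : ContinuousAt Complex.log (1 + 0) := by
      apply continuousAt_clog; simp
    have := this.tendsto.comp (hdiv.const_add 1)
    simpa [Function.comp_def] using this
  have hM : Tendsto (fun n : ℕ => gudMu (s + (n+1:ℕ))) atTop (𝓝 0) := by
    have := (tendsto_sum_nat_add (fun k : ℕ => gudJ (s + k))).comp (tendsto_add_atTop_nat 1)
    refine this.congr fun n => ?_
    simp only [gudMu, Function.comp]
    congr 1; ext k; push_cast; ring_nf
  have hS : Tendsto (fun n : ℕ => ((Stirling.stirlingSeq n : ℝ) : ℂ)) atTop (𝓝 (√Real.pi : ℝ)) :=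
    (Complex.continuous_ofReal.tendsto _).comp Stirling.tendsto_stirlingSeq_sqrt_pi
  have hX : Tendsto (fun n : ℕ => -((n + (s+1/2)) * Complex.log (1 + (s+1)/n) - (s+1)
        + gudMu (s + (n+1 : ℕ)))) atTop (𝓝 0) := by
    have := (((hA.add (hB.const_mul (s+1/2))).sub_const (s+1)).add hM).neg
    simp only [mul_zero, add_zero, sub_self, neg_zero] at this
    refine this.congr fun n => ?_
    ring
  have hX' := (Complex.continuous_exp.tendsto _).comp hX
  have h2 := ((hS.mul_const ((√2:ℝ):ℂ)).mul hX').const_mul (stE s)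
  have h3 := tendsto_nhds_unique (h1.congr' (by
    filter_upwards [eventually_ne_atTop 0] with n hn
    exact gammaSeq_div hs hn)) h2
  rw [h3, stE]; simp; ring

/-- Ratio of Pochhammer symbols. -/
noncomputable def pochQ (κ : ℝ) (t : ℝ) (j : ℕ) : ℂ :=
  (Polynomial.eval (1/2 - (κ:ℂ) + -(Complex.I * t)) (ascPochhammer ℂ j)) /
      (Polynomial.eval (2 * -(Complex.I * t) + 1) (ascPochhammer ℂ j))

lemma pochQ_succ (κ t : ℝ) (j : ℕ) : pochQ κ t (j+1) = pochQ κ t j *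
    ((1/2 - (κ:ℂ) + -(Complex.I * t) + j) / (2 * -(Complex.I * t) + 1 + j)) := by
  unfold pochQ
  rw [ascPochhammer_succ_eval, ascPochhammer_succ_eval, mul_div_mul_comm]

lemma den_norm (t : ℝ) (j : ℕ) :
    2 * t ≤ ‖2 * -(Complex.I * t) + 1 + (j:ℂ)‖ ∧ 1 + (j:ℝ) ≤ ‖2 * -(Complex.I * t) + 1 + (j:ℂ)‖ := by
  constructor
  · refine le_trans ?_ (Complex.abs_im_le_norm _)
    simp [abs_mul]; exact le_abs_self t
  · refine le_trans ?_ (Complex.abs_re_le_norm _)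
    simp; exact le_abs_self _

lemma ratio_bound (κ : ℝ) {t : ℝ} (ht : 1 ≤ t) (j : ℕ) :
    ‖(1/2 - (κ:ℂ) + -(Complex.I * t) + j) / (2 * -(Complex.I * t) + 1 + j)‖ ≤ |κ| + 3 := by
  obtain ⟨h1, h2⟩ := den_norm t j
  set d := ‖2 * -(Complex.I * t) + 1 + (j:ℂ)‖
  have hj : (0:ℝ) ≤ j := by positivity
  have hd : 0 < d := by linarith
  rw [norm_div, div_le_iff₀ hd]
  have e1 : ‖1/2 - (κ:ℂ) + -(Complex.I * t) + j‖ ≤ 1/2 + |κ| + t + j := by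
    refine (norm_add_le _ _).trans ?_
    gcongr
    · refine (norm_add_le _ _).trans ?_
      gcongr
      · refine (norm_sub_le _ _).trans ?_
        simp
      · simp [abs_of_nonneg (by linarith : (0:ℝ) ≤ t)]
    · simp
  refine e1.trans ?_
  nlinarith [abs_nonneg κ, mul_nonneg (abs_nonneg κ) (by linarith : 0 ≤ d - 1)]

lemma ratio_tendsto (κ : ℝ) (j : ℕ) :
    Tendsto (fun t : ℝ => (1/2 - (κ:ℂ) + -(Complex.I * t) + j) / (2 * -(Complex.I * t) + 1 + j))
      atTop (𝓝 (1/2)) := by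
  rw [tendsto_iff_norm_sub_tendsto_zero]
  have hz : Tendsto (fun t : ℝ => ‖-(κ:ℂ) + j/2‖ / t) atTop (𝓝 0) :=
    tendsto_const_nhds.div_atTop tendsto_id
  refine squeeze_zero' (Eventually.of_forall fun _ => norm_nonneg _) ?_ hz
  filter_upwards [eventually_ge_atTop 1] with t ht
  obtain ⟨h1, h2⟩ := den_norm t j
  have hd : (2 * -(Complex.I * t) + 1 + (j:ℂ)) ≠ 0 := by
    rw [← norm_pos_iff]; linarith
  have : (1/2 - (κ:ℂ) + -(Complex.I * t) + j) / (2 * -(Complex.I * t) + 1 + j) - 1/2 =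
      (-(κ:ℂ) + j/2) / (2 * -(Complex.I * t) + 1 + j) := by
    rw [div_sub_div _ _ hd two_ne_zero, div_eq_div_iff (mul_ne_zero hd two_ne_zero) hd]; ring
  rw [this, norm_div]
  apply div_le_div_of_nonneg_left (norm_nonneg _) (by linarith) (by linarith)

lemma pochQ_bound (κ : ℝ) {t : ℝ} (ht : 1 ≤ t) (j : ℕ) : ‖pochQ κ t j‖ ≤ (|κ| + 3)^j := by
  induction j with
  | zero => simp [pochQ]
  | succ j ih =>
    rw [pochQ_succ, norm_mul, pow_succ]
    exact mul_le_mul ih (ratio_bound κ ht j) (norm_nonneg _) (by positivity)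

lemma pochQ_tendsto (κ : ℝ) (j : ℕ) :
    Tendsto (fun t : ℝ => pochQ κ t j) atTop (𝓝 ((1/2)^j)) := by
  induction j with
  | zero => simp [pochQ]
  | succ j ih =>
    simp_rw [pochQ_succ, pow_succ]
    exact ih.mul (ratio_tendsto κ j)

/-- The series factor. -/
noncomputable def serS (κ x t : ℝ) : ℂ :=
  ∑' j : ℕ, (Polynomial.eval (1/2 - (κ:ℂ) + -(Complex.I * t)) (ascPochhammer ℂ j)) /
      ((Polynomial.eval (2 * -(Complex.I * t) + 1) (ascPochhammer ℂ j)) * (Nat.factorial j : ℂ))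
      * (x:ℂ)^j

lemma serS_tendsto (κ x : ℝ) :
    Tendsto (fun t : ℝ => serS κ x t) atTop (𝓝 (Real.exp (x/2) : ℝ)) := by
  have hexp : ((Real.exp (x/2) : ℝ) : ℂ) = ∑' j : ℕ, (1/2:ℂ)^j / (j.factorial : ℂ) * (x:ℂ)^j := by
    rw [Complex.ofReal_exp, Complex.exp_eq_exp_ℂ, NormedSpace.exp_eq_tsum_div]
    refine tsum_congr fun j => ?_
    push_cast
    rw [div_pow, div_pow]; ring
  rw [hexp]
  unfold serS
  have hr : ∀ (t : ℝ) (j : ℕ),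
    (Polynomial.eval (1/2 - (κ:ℂ) + -(Complex.I * t)) (ascPochhammer ℂ j)) /
      ((Polynomial.eval (2 * -(Complex.I * t) + 1) (ascPochhammer ℂ j)) * (Nat.factorial j : ℂ))
      * (x:ℂ)^j = pochQ κ t j / (j.factorial : ℂ) * (x:ℂ)^j := by
    intro t j; rw [pochQ, div_div]
  simp_rw [hr]
  refine tendsto_tsum_of_dominated_convergence
    (bound := fun j => ((|κ|+3) * |x|)^j / (j.factorial : ℝ)) (Real.summable_pow_div_factorial _) ?_ ?_
  · intro j
    exact ((pochQ_tendsto κ j).div_const _).mul_const _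
  · filter_upwards [eventually_ge_atTop 1] with t ht j
    rw [norm_mul, norm_div, norm_pow, Complex.norm_natCast, Complex.norm_real, Real.norm_eq_abs,
      mul_pow, div_mul_eq_mul_div]
    gcongr
    exact pochQ_bound κ ht j

/-- Complex exponent whose imaginary part is the phase. -/
noncomputable def phD (κ x t : ℝ) : ℂ :=
  stMain (((0:ℝ):ℂ) + Complex.I * ((2:ℝ) * t)) -
    stMain (((1/2 - κ : ℝ):ℂ) + Complex.I * ((1:ℝ) * t)) - Complex.I * (t * Real.log x : ℝ)

/-- The factor tending to a positive constant. -/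
noncomputable def phU (κ x t : ℝ) : ℂ :=
  Complex.exp (gudMu (((0:ℝ):ℂ) + Complex.I * ((2:ℝ) * t)) -
    gudMu (((1/2 - κ : ℝ):ℂ) + Complex.I * ((1:ℝ) * t))) * serS κ x t

/-- Half of the function on the imaginary axis. -/
noncomputable def halfA (κ x t : ℝ) : ℂ :=
  Complex.Gamma (2 * (Complex.I * t)) / Complex.Gamma (1/2 - (κ:ℂ) + Complex.I * t) *
    whittakerM κ (-(Complex.I * t)) x

lemma phU_tendsto (κ x : ℝ) :
    Tendsto (fun t : ℝ => (phU κ x t).re) atTop (𝓝 (Real.exp (x/2))) := by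
  have h1 := (gudMu_tendsto 0 2 (by norm_num)).sub (gudMu_tendsto (1/2-κ) 1 le_rfl)
  have h2 := ((Complex.continuous_exp.tendsto _).comp h1).mul (serS_tendsto κ x)
  have h3 := (Complex.continuous_re.tendsto _).comp h2
  simp only [sub_self, Complex.exp_zero, one_mul, Complex.ofReal_re] at h3
  exact h3

lemma halfA_eq (κ x : ℝ) {t : ℝ} (ht : 2 ≤ t) :
    halfA κ x t = Complex.exp (phD κ x t) *
      (Real.exp (-x/2 + 1/2 * Real.log x) : ℝ) * phU κ x t := by
  have e1 : 2 * (Complex.I * t) = ((0:ℝ):ℂ) + Complex.I * ((2:ℝ) * t) := by push_cast; ring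
  have e2 : 1/2 - (κ:ℂ) + Complex.I * t = ((1/2 - κ : ℝ):ℂ) + Complex.I * ((1:ℝ) * t) := by
    push_cast; ring
  unfold halfA phD phU whittakerM
  rw [e1, e2, gamma_stirling_s18 (by simp; linarith), gamma_stirling_s18 (by simp; linarith)]
  have hc : ((√Real.pi * √2 : ℝ) : ℂ) ≠ 0 := by
    have : 0 < √Real.pi * √2 := by positivity
    exact_mod_cast this.ne'
  rw [mul_div_mul_left _ _ hc, ← Complex.exp_sub, serS]
  simp only [← mul_assoc]
  congr 1
  rw [Complex.ofReal_exp]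
  simp only [← Complex.exp_add]
  congr 1
  push_cast
  ring

lemma F_eq (κ x t : ℝ) :
    whittakerW κ (Complex.I * t) x = ((2 * (halfA κ x t).re : ℝ) : ℂ) := by
  have hI : (starRingEnd ℂ) (Complex.I * t) = -(Complex.I * t) := by simp
  have hcA : (starRingEnd ℂ) (halfA κ x t) =
      Complex.Gamma (-(2 * (Complex.I * t))) / Complex.Gamma (1/2 - (κ:ℂ) - Complex.I * t) *
        whittakerM κ (Complex.I * t) x := by
    have h2 : (starRingEnd ℂ) (2:ℂ) = 2 := Complex.conj_ofNat 2
    unfold halfA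
    have hM : (starRingEnd ℂ) (whittakerM κ (-(Complex.I * t)) x) =
        whittakerM κ (Complex.I * t) x := by
      unfold whittakerM
      rw [map_mul, map_mul, Complex.conj_tsum, ← Complex.exp_conj, ← Complex.exp_conj]
      have hp : ∀ (z : ℂ) (j : ℕ), (starRingEnd ℂ) (Polynomial.eval z (ascPochhammer ℂ j)) =
          Polynomial.eval ((starRingEnd ℂ) z) (ascPochhammer ℂ j) := by
        intro z j
        induction j with
        | zero => simp
        | succ j ih => rw [ascPochhammer_succ_eval, ascPochhammer_succ_eval, map_mul, ih]; simp
      congr 1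
      · simp [h2]
      · congr 1; ext j
        rw [map_mul, map_div₀, map_mul, hp, hp]
        simp [h2]
    have h12 : (starRingEnd ℂ) (1/2:ℂ) = 1/2 := by rw [map_div₀, h2, map_one]
    have g1 : (starRingEnd ℂ) (2 * (Complex.I * t)) = -(2 * (Complex.I * t)) := by
      rw [map_mul, hI, h2]; ring
    have g2 : (starRingEnd ℂ) (1/2 - (κ:ℂ) + Complex.I * t) = 1/2 - (κ:ℂ) - Complex.I * t := by
      rw [map_add, hI, map_sub, h12, Complex.conj_ofReal]; ring
    rw [map_mul, map_div₀, hM, ← Complex.Gamma_conj, ← Complex.Gamma_conj, g1, g2]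
  have := Complex.add_conj (halfA κ x t)
  rw [hcA] at this
  rw [← this, whittakerW, halfA]
  ring

lemma phD_im (κ x : ℝ) {t : ℝ} (ht : 2 ≤ t) :
    (phD κ x t).im = 2 * t * Real.log (2 * t)
      - 1/2 * Complex.arg (((0:ℝ):ℂ) + Complex.I * ((2:ℝ) * t)) - 2 * t
      - (t * Real.log ‖(((1/2 - κ : ℝ):ℂ) + Complex.I * ((1:ℝ) * t))‖ -
        κ * Complex.arg ((((1/2 - κ : ℝ):ℂ) + Complex.I * ((1:ℝ) * t))) - t) - t * Real.log x := by
  have hn : ‖(((0:ℝ):ℂ) + Complex.I * ((2:ℝ) * t))‖ = 2 * t := by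
    simp [abs_of_nonneg (by linarith : 0 ≤ t)]
  unfold phD stMain
  have aux : ∀ a c : ℝ, (((a:ℂ) + Complex.I * (c * t) - 1/2) *
      Complex.log ((a:ℂ) + Complex.I * (c * t)) - ((a:ℂ) + Complex.I * (c * t))).im =
      c * t * Real.log ‖(a:ℂ) + Complex.I * (c * t)‖ +
        (a - 1/2) * Complex.arg ((a:ℂ) + Complex.I * (c * t)) - c * t := by
    intro a c
    rw [Complex.sub_im, Complex.mul_im, Complex.log_re, Complex.log_im]
    simp
    ring
  rw [Complex.sub_im, Complex.sub_im, aux, aux, hn]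
  simp only [Complex.mul_im, Complex.I_re, Complex.I_im, Complex.ofReal_re, Complex.ofReal_im]
  ring

lemma phD_tendsto (κ x : ℝ) : Tendsto (fun t : ℝ => (phD κ x t).im) atTop atTop := by
  have h1 : Tendsto (fun t : ℝ => Real.log (2 * t) + (- 1 - Real.log x)) atTop atTop :=
    tendsto_atTop_add_const_right _ _
      (Real.tendsto_log_atTop.comp (tendsto_id.const_mul_atTop (by norm_num)))
  have h2 : Tendsto (fun t : ℝ => t * (Real.log (2 * t) + (- 1 - Real.log x)) +
      (-(Real.pi/2) - |κ| * Real.pi)) atTop atTop :=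
    tendsto_atTop_add_const_right _ _ (tendsto_id.atTop_mul_atTop₀ h1)
  refine tendsto_atTop_mono' _ ?_ h2
  filter_upwards [eventually_ge_atTop 2, eventually_ge_atTop |1/2 - κ|] with t ht ht2
  rw [phD_im κ x ht]
  set s := (((1/2 - κ : ℝ):ℂ) + Complex.I * ((1:ℝ) * t)) with hs
  have hsn : ‖s‖ ≤ 2 * t := by
    refine (norm_add_le _ _).trans ?_
    rw [Complex.norm_real, Real.norm_eq_abs]
    have : ‖Complex.I * (((1:ℝ):ℂ) * t)‖ = t := by simp [abs_of_nonneg (by linarith : 0 ≤ t)]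
    linarith
  have hs0 : 0 < ‖s‖ := by
    refine lt_of_lt_of_le ?_ (Complex.abs_im_le_norm s)
    rw [hs]; simp; linarith
  have hl : Real.log ‖s‖ ≤ Real.log (2 * t) := Real.log_le_log hs0 hsn
  have hl2 : t * Real.log ‖s‖ ≤ t * Real.log (2 * t) := by gcongr
  have a1 := Complex.arg_le_pi (((0:ℝ):ℂ) + Complex.I * ((2:ℝ) * t))
  have a2 : |κ * Complex.arg s| ≤ |κ| * Real.pi := by
    rw [abs_mul]; gcongr; exact Complex.abs_arg_le_pi s
  have a3 := neg_abs_le (κ * Complex.arg s)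
  linarith

lemma phD_cont (κ x : ℝ) : ContinuousOn (fun t : ℝ => (phD κ x t).im) (Set.Ioi 0) := by
  refine Complex.continuous_im.comp_continuousOn ?_
  unfold phD stMain
  have hlog : ∀ a c : ℝ, 0 < c → ContinuousOn
      (fun t : ℝ => Complex.log ((a:ℂ) + Complex.I * (c * t))) (Set.Ioi 0) := by
    intro a c hc
    refine ContinuousOn.clog (by fun_prop) ?_
    intro t ht
    right
    simp
    exact ⟨hc.ne', (ne_of_gt ht)⟩
  have l1 := hlog 0 2 (by norm_num)
  have l2 := hlog (1/2 - κ) 1 (by norm_num)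
  fun_prop

lemma halfA_re (κ x : ℝ) {t : ℝ} (ht : 2 ≤ t) (n : ℕ) (hn : (phD κ x t).im = n * Real.pi) :
    ∃ R : ℝ, 0 < R ∧ (halfA κ x t).re = (-1)^n * (R * (phU κ x t).re) := by
  refine ⟨Real.exp (phD κ x t).re * Real.exp (-x/2 + 1/2 * Real.log x), by positivity, ?_⟩
  have he : Complex.exp (phD κ x t) = (((-1)^n * Real.exp (phD κ x t).re : ℝ) : ℂ) := by
    rw [Complex.exp_eq_exp_re_mul_sin_add_cos, hn, ← Complex.ofReal_cos, ← Complex.ofReal_sin,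
      Real.sin_nat_mul_pi, Real.cos_nat_mul_pi]
    push_cast; ring
  rw [halfA_eq κ x ht, he, ← Complex.ofReal_mul, Complex.re_ofReal_mul]
  ring

/-- The entire function `μ ↦ W_{κ,μ}(x₀)` has infinitely many purely imaginary zeros. -/
theorem stmt_18 (κ x₀ : ℝ) (hx : 0 < x₀) (F : ℂ → ℂ) (hF : Differentiable ℂ F)
    (hFW : ∀ μ : ℂ, (∀ n : ℤ, 2*μ ≠ (n:ℂ)) → F μ = whittakerW (κ:ℂ) μ x₀) :
    {t : ℝ | F (Complex.I * t) = 0}.Infinite := by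
  intro hfin
  have hval : ∀ t : ℝ, 0 < t → F (Complex.I * t) = ((2 * (halfA κ x₀ t).re : ℝ) : ℂ) := by
    intro t ht
    rw [hFW, F_eq]
    intro n hn
    have := congrArg Complex.im hn
    simp at this
    exact ht.ne' this
  obtain ⟨B, hB⟩ := hfin.bddAbove
  have hU : ∀ᶠ t in atTop, 0 < (phU κ x₀ t).re :=
    (phU_tendsto κ x₀).eventually (lt_mem_nhds (Real.exp_pos _))
  obtain ⟨T, hT⟩ := eventually_atTop.mp
    ((hU.and (eventually_ge_atTop 2)).and (eventually_gt_atTop B))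
  have hT2 : 2 ≤ T := (hT T le_rfl).1.2
  have hhit : ∀ y, (phD κ x₀ T).im ≤ y → ∃ t, T ≤ t ∧ (phD κ x₀ t).im = y := by
    intro y hy
    obtain ⟨b, hb1, hb2⟩ := ((phD_tendsto κ x₀).eventually_ge_atTop y |>.and
      (eventually_ge_atTop T)).exists
    have hc : ContinuousOn (fun t : ℝ => (phD κ x₀ t).im) (Set.Icc T b) :=
      (phD_cont κ x₀).mono fun t ht => lt_of_lt_of_le (by linarith) ht.1
    obtain ⟨t, ht, hty⟩ := intermediate_value_Icc hb2 hc ⟨hy, hb1⟩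
    exact ⟨t, ht.1, hty⟩
  obtain ⟨m, hm⟩ := exists_nat_ge ((phD κ x₀ T).im / Real.pi)
  have hm' : (phD κ x₀ T).im ≤ m * Real.pi := (div_le_iff₀ Real.pi_pos).mp hm
  obtain ⟨t1, ht1, hp1⟩ := hhit ((m:ℝ) * Real.pi) hm'
  obtain ⟨t2, ht2, hp2⟩ := hhit (((m+1:ℕ):ℝ) * Real.pi) (by push_cast; nlinarith [Real.pi_pos])
  obtain ⟨R1, hR1, e1⟩ := halfA_re κ x₀ (hT2.trans ht1) m hp1
  obtain ⟨R2, hR2, e2⟩ := halfA_re κ x₀ (hT2.trans ht2) (m+1) hp2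
  have u1 := mul_pos hR1 (hT t1 ht1).1.1
  have u2 := mul_pos hR2 (hT t2 ht2).1.1
  let f : ℝ → ℝ := fun t => (F (Complex.I * t)).re
  have hfc : Continuous f := by
    have := hF.continuous
    fun_prop
  have hf : ∀ t, T ≤ t → f t = 2 * (halfA κ x₀ t).re := by
    intro t ht
    simp only [f]
    rw [hval t (by linarith), Complex.ofReal_re]
  have hzero : ∃ t ∈ Set.uIcc t1 t2, f t = 0 := by
    have h := intermediate_value_uIcc (f := f) (a := t1) (b := t2) hfc.continuousOn
    have : (0:ℝ) ∈ Set.uIcc (f t1) (f t2) := by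
      rw [hf t1 ht1, hf t2 ht2, e1, e2, pow_succ, Set.mem_uIcc]
      rcases neg_one_pow_eq_or ℝ m with h | h
      · right; rw [h]; constructor <;> linarith
      · left; rw [h]; constructor <;> linarith
    obtain ⟨t, ht, h0⟩ := h this
    exact ⟨t, ht, h0⟩
  obtain ⟨t, ht, h0⟩ := hzero
  have hTt : T ≤ t := (le_inf ht1 ht2).trans ht.1
  have hz : F (Complex.I * t) = 0 := by
    rw [hval t (by linarith), ← hf t hTt, h0, Complex.ofReal_zero]
  have : t ≤ B := hB hz
  linarith [(hT t hTt).2]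
end
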